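/- Let n ≥ 3 and 0 < λ ≤ Λ. Let p > 1 and assume either λ(n−2) > Λ and p ≤ (λ(n−2)+Λ)/(λ(n−2)−Λ), or λ(n−2) ≤ Λ. If u is continuous on the closed half space, bounded, nonnegative in ℝⁿ₊, equal to 0 on the boundary ∂ℝⁿ₊ = {xₙ = 0}, and is a viscosity solution of M⁺_{λ,Λ}(D²u) + u^p = 0 in ℝⁿ₊, then u is identically zero. -/

import Mathlib

open scoped BigOperators

/-- The Pucci maximal operator `M⁺_{λ,Λ}`: for a symmetric matrix it equals
`Λ · (sum of positive eigenvalues) + λ · (sum of negative eigenvalues)`. -/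
noncomputable def pucciMax (lam Lam : ℝ) {n : ℕ} (M : Matrix (Fin n) (Fin n) ℝ) : ℝ :=
  if h : M.IsHermitian then
    ∑ i, (Lam * max (h.eigenvalues i) 0 + lam * min (h.eigenvalues i) 0)
  else 0

/-- The Hessian matrix of `φ` at `x`. -/
noncomputable def hess {n : ℕ} (φ : EuclideanSpace ℝ (Fin n) → ℝ)
    (x : EuclideanSpace ℝ (Fin n)) : Matrix (Fin n) (Fin n) ℝ :=
  fun i j => iteratedFDeriv ℝ 2 φ x ![EuclideanSpace.single i 1, EuclideanSpace.single j 1]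

/-- `u` is a viscosity supersolution of `M⁺_{λ,Λ}(D²u) + g = 0` in `Ω`. -/
def PucciSupersol (lam Lam : ℝ) {n : ℕ} (Ω : Set (EuclideanSpace ℝ (Fin n)))
    (u g : EuclideanSpace ℝ (Fin n) → ℝ) : Prop :=
  ∀ x₀ ∈ Ω, ∀ φ : EuclideanSpace ℝ (Fin n) → ℝ, ContDiff ℝ 2 φ →
    IsLocalMin (fun x => u x - φ x) x₀ → pucciMax lam Lam (hess φ x₀) + g x₀ ≤ 0

/-- `u` is a viscosity subsolution of `M⁺_{λ,Λ}(D²u) + g = 0` in `Ω`. -/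
def PucciSubsol (lam Lam : ℝ) {n : ℕ} (Ω : Set (EuclideanSpace ℝ (Fin n)))
    (u g : EuclideanSpace ℝ (Fin n) → ℝ) : Prop :=
  ∀ x₀ ∈ Ω, ∀ φ : EuclideanSpace ℝ (Fin n) → ℝ, ContDiff ℝ 2 φ →
    IsLocalMax (fun x => u x - φ x) x₀ → 0 ≤ pucciMax lam Lam (hess φ x₀) + g x₀

open Filter Topology Metric Set
open scoped RealInnerProductSpace

/-- Second derivative of `φ` at `x` along the line with direction `v`. -/
noncomputable def d2 {F : Type*} [AddCommGroup F] [Module ℝ F] (φ : F → ℝ) (x v : F) : ℝ :=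
  deriv (deriv fun t : ℝ => φ (x + t • v)) 0

/-- A finite family `v` whose matrix `∑ vₖ ⊗ vₖ` lies between `lam` and `Lam`. -/
def IsFrame {ι F : Type*} [Fintype ι] [NormedAddCommGroup F] [InnerProductSpace ℝ F]
    (lam Lam : ℝ) (v : ι → F) : Prop :=
  ∀ ξ : F, lam * ‖ξ‖ ^ 2 ≤ ∑ k, ⟪v k, ξ⟫ ^ 2 ∧ ∑ k, ⟪v k, ξ⟫ ^ 2 ≤ Lam * ‖ξ‖ ^ 2

section SecondDerivative

variable {F : Type*} [NormedAddCommGroup F] [NormedSpace ℝ F]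

theorem d2_eq_of_hasDerivAt {φ : F → ℝ} {x v : F} {g : ℝ → ℝ} {c : ℝ}
    (h : ∀ᶠ t in 𝓝 (0 : ℝ), HasDerivAt (fun s : ℝ => φ (x + s • v)) (g t) t)
    (h' : HasDerivAt g c 0) : d2 φ x v = c := by
  have : deriv (fun s : ℝ => φ (x + s • v)) =ᶠ[𝓝 0] g := h.mono fun t ht => ht.deriv
  rw [d2, this.deriv_eq, h'.deriv]

theorem d2_congr {φ ψ : F → ℝ} {x : F} (h : φ =ᶠ[𝓝 x] ψ) (v : F) : d2 φ x v = d2 ψ x v := by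
  have hc : Tendsto (fun s : ℝ => x + s • v) (𝓝 0) (𝓝 x) := by
    have : Continuous fun s : ℝ => x + s • v := by fun_prop
    simpa using this.tendsto 0
  have h1 : (fun s : ℝ => φ (x + s • v)) =ᶠ[𝓝 0] fun s => ψ (x + s • v) := hc.eventually h
  exact h1.deriv.deriv_eq

theorem d2_eq_fderiv {φ : F → ℝ} {x : F} (h : ContDiffAt ℝ 2 φ x) (v : F) :
    d2 φ x v = fderiv ℝ (fderiv ℝ φ) x v v := by
  have hline : ∀ t : ℝ, HasDerivAt (fun s : ℝ => x + s • v) v t := fun t => by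
    simpa using ((hasDerivAt_id t).smul_const v).const_add x
  have hc : Tendsto (fun s : ℝ => x + s • v) (𝓝 0) (𝓝 x) := by
    have : Continuous fun s : ℝ => x + s • v := by fun_prop
    simpa using this.tendsto 0
  refine d2_eq_of_hasDerivAt (g := fun t => fderiv ℝ φ (x + t • v) v) ?_ ?_
  · have h1 := hc.eventually (h.eventually (by simp))
    filter_upwards [h1] with t ht
    exact (ht.differentiableAt (by simp)).hasFDerivAt.comp_hasDerivAt t (hline t)
  · have h1 : DifferentiableAt ℝ (fderiv ℝ φ) x :=
      (h.fderiv_right (m := 1) (by norm_num)).differentiableAt (by simp)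
    have h2 : HasFDerivAt (fderiv ℝ φ) (fderiv ℝ (fderiv ℝ φ) x) (x + (0 : ℝ) • v) := by
      simpa using h1.hasFDerivAt
    have h3 := h2.comp_hasDerivAt (0 : ℝ) (hline 0)
    exact ((ContinuousLinearMap.apply ℝ ℝ v).hasFDerivAt).comp_hasDerivAt (0 : ℝ) h3

theorem d2_add {φ ψ : F → ℝ} {x : F} (h : ContDiffAt ℝ 2 φ x) (h' : ContDiffAt ℝ 2 ψ x) (v : F) :
    d2 (fun y => φ y + ψ y) x v = d2 φ x v + d2 ψ x v := by
  rw [d2_eq_fderiv h, d2_eq_fderiv h', d2_eq_fderiv (h.add h')]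
  have h1 : fderiv ℝ (fun y => φ y + ψ y) =ᶠ[𝓝 x] fun y => fderiv ℝ φ y + fderiv ℝ ψ y := by
    filter_upwards [h.eventually (by simp), h'.eventually (by simp)] with y hy hy'
    exact fderiv_fun_add (hy.differentiableAt (by simp)) (hy'.differentiableAt (by simp))
  rw [h1.fderiv_eq, fderiv_fun_add ((h.fderiv_right (m := 1) (by norm_num)).differentiableAt (by simp))
    ((h'.fderiv_right (m := 1) (by norm_num)).differentiableAt (by simp))]
  rfl

theorem d2_const_mul (φ : F → ℝ) (c : ℝ) (x v : F) :
    d2 (fun y => c * φ y) x v = c * d2 φ x v := by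
  simp only [d2, deriv_const_mul_field']

theorem d2_neg (φ : F → ℝ) (x v : F) : d2 (fun y => -φ y) x v = -d2 φ x v := by
  simpa using d2_const_mul φ (-1) x v

theorem d2_smul {φ : F → ℝ} {x : F} (h : ContDiffAt ℝ 2 φ x) (c : ℝ) (v : F) :
    d2 φ x (c • v) = c ^ 2 * d2 φ x v := by
  rw [d2_eq_fderiv h, d2_eq_fderiv h]
  simp; ring

theorem d2_add_const (φ : F → ℝ) (c : ℝ) (x v : F) :
    d2 (fun y => φ y + c) x v = d2 φ x v := by
  simp only [d2, deriv_add_const']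

theorem d2_nonpos_of_isLocalMax {φ : F → ℝ} {x : F} (h : ContDiffAt ℝ 2 φ x)
    (hx : IsLocalMax φ x) (v : F) : d2 φ x v ≤ 0 := by
  have hc : ContinuousAt (fun s : ℝ => x + s • v) 0 := by
    have : Continuous fun s : ℝ => x + s • v := by fun_prop
    exact this.continuousAt
  have hmax : IsLocalMax (fun s : ℝ => φ (x + s • v)) 0 := by
    have := hc.tendsto
    simp only [zero_smul, add_zero] at this
    have := this.eventually hx
    simpa [IsLocalMax, IsMaxFilter] using this
  by_contra! hpos
  have hcont : ContinuousAt (fun s : ℝ => φ (x + s • v)) 0 :=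
    ContinuousAt.comp (f := fun s : ℝ => x + s • v) (by simpa using h.continuousAt) hc
  have hmin := isLocalMin_of_deriv_deriv_pos hpos hmax.deriv_eq_zero hcont
  have hconst : (fun s : ℝ => φ (x + s • v)) =ᶠ[𝓝 0] fun _ => φ (x + (0 : ℝ) • v) := by
    filter_upwards [hmax, hmin] with s h1 h2 using le_antisymm h1 h2
  have : d2 φ x v = 0 := by
    rw [d2, hconst.deriv.deriv_eq]; simp
  linarith

theorem eventually_abs_d2_sub_le {φ : F → ℝ} (hφ : ContDiff ℝ 2 φ) (x : F) {ε : ℝ} (hε : 0 < ε) :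
    ∀ᶠ y in 𝓝 x, ∀ v : F, |d2 φ y v - d2 φ x v| ≤ ε * ‖v‖ ^ 2 := by
  have hc : Continuous (fderiv ℝ (fderiv ℝ φ)) :=
    (hφ.fderiv_right (m := 1) (by norm_num)).continuous_fderiv (by simp)
  filter_upwards [(Metric.continuousAt_iff' (α := F →L[ℝ] F →L[ℝ] ℝ)).1 hc.continuousAt _ hε] with y hy v
  have hy' : ‖fderiv ℝ (fderiv ℝ φ) y - fderiv ℝ (fderiv ℝ φ) x‖ < ε :=
    have h : dist (fderiv ℝ (fderiv ℝ φ) y) (fderiv ℝ (fderiv ℝ φ) x) =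
        ‖fderiv ℝ (fderiv ℝ φ) y - fderiv ℝ (fderiv ℝ φ) x‖ :=
      dist_eq_norm (fderiv ℝ (fderiv ℝ φ) y) (fderiv ℝ (fderiv ℝ φ) x)
    h ▸ hy
  rw [d2_eq_fderiv hφ.contDiffAt, d2_eq_fderiv hφ.contDiffAt]
  have := (fderiv ℝ (fderiv ℝ φ) y - fderiv ℝ (fderiv ℝ φ) x).le_opNorm₂ v v
  simp only [sub_apply, Real.norm_eq_abs] at this
  nlinarith [sq_nonneg ‖v‖]

end SecondDerivative

section Frames

variable {n : ℕ} {ι : Type*} [Fintype ι] {lam Lam : ℝ}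

theorem sum_sq_inner_single (w : EuclideanSpace ℝ (Fin n)) :
    ∑ i, ⟪w, EuclideanSpace.single i (1 : ℝ)⟫ ^ 2 = ‖w‖ ^ 2 := by
  rw [EuclideanSpace.norm_sq_eq]
  simp [EuclideanSpace.inner_single_right]

theorem IsFrame.sum_norm_sq_le {v : ι → EuclideanSpace ℝ (Fin n)} (hv : IsFrame lam Lam v) :
    ∑ k, ‖v k‖ ^ 2 ≤ n * Lam := by
  have h : ∀ i : Fin n, ∑ k, ⟪v k, EuclideanSpace.single i (1 : ℝ)⟫ ^ 2 ≤ Lam := fun i => by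
    simpa using (hv (EuclideanSpace.single i 1)).2
  calc ∑ k, ‖v k‖ ^ 2 = ∑ i : Fin n, ∑ k, ⟪v k, EuclideanSpace.single i (1 : ℝ)⟫ ^ 2 := by
        rw [Finset.sum_comm]; simp only [sum_sq_inner_single]
    _ ≤ ∑ _i : Fin n, Lam := Finset.sum_le_sum fun i _ => h i
    _ = n * Lam := by simp

theorem hess_isHermitian {φ : EuclideanSpace ℝ (Fin n) → ℝ} {x : EuclideanSpace ℝ (Fin n)}
    (h : ContDiffAt ℝ 2 φ x) : (hess φ x).IsHermitian := by
  ext i j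
  simp only [hess, Matrix.conjTranspose_apply, iteratedFDeriv_two_apply, star_trivial]
  exact (h.isSymmSndFDerivAt (by simp)) _ _

theorem d2_eq_sum_eigenvalues {φ : EuclideanSpace ℝ (Fin n) → ℝ} {x : EuclideanSpace ℝ (Fin n)}
    (h : ContDiffAt ℝ 2 φ x) (v : EuclideanSpace ℝ (Fin n)) :
    d2 φ x v = ∑ j, (hess_isHermitian h).eigenvalues j *
      ⟪(hess_isHermitian h).eigenvectorBasis j, v⟫ ^ 2 := by
  set H := hess_isHermitian h
  have hB : ∀ w w' : EuclideanSpace ℝ (Fin n),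
      fderiv ℝ (fderiv ℝ φ) x w w' = w.ofLp ⬝ᵥ (hess φ x).mulVec w'.ofLp := fun w w' => by
    have hw : ∀ w : EuclideanSpace ℝ (Fin n), w = ∑ i, w i • EuclideanSpace.single i (1 : ℝ) :=
      fun w => by
        have := (EuclideanSpace.basisFun (Fin n) ℝ).sum_repr w
        simpa using this.symm
    conv_lhs => rw [hw w, hw w']
    simp only [map_sum, map_smul, sum_apply, smul_apply,
      smul_eq_mul, dotProduct, Matrix.mulVec, hess, iteratedFDeriv_two_apply, Finset.mul_sum]
    rw [Finset.sum_comm]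
    simp
    refine Finset.sum_congr rfl fun i _ => Finset.sum_congr rfl fun j _ => by ring
  have hv := H.eigenvectorBasis.sum_repr' v
  rw [d2_eq_fderiv h]
  have h1 : ∀ w : EuclideanSpace ℝ (Fin n), fderiv ℝ (fderiv ℝ φ) x w v
      = ∑ j, H.eigenvalues j * ⟪H.eigenvectorBasis j, v⟫ * ⟪H.eigenvectorBasis j, w⟫ := fun w => by
    conv_lhs => rw [← hv]
    simp only [map_sum, map_smul]
    simp only [hB, H.mulVec_eigenvectorBasis, dotProduct_smul, smul_eq_mul]
    refine Finset.sum_congr rfl fun j _ => ?_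
    have : w.ofLp ⬝ᵥ (H.eigenvectorBasis j).ofLp = ⟪H.eigenvectorBasis j, w⟫ := by
      simp [EuclideanSpace.inner_eq_star_dotProduct]
    rw [this]; ring
  rw [h1]
  exact Finset.sum_congr rfl fun j _ => by ring

theorem sum_d2_le_pucciMax {φ : EuclideanSpace ℝ (Fin n) → ℝ} {x : EuclideanSpace ℝ (Fin n)}
    (h : ContDiffAt ℝ 2 φ x) {v : ι → EuclideanSpace ℝ (Fin n)} (hv : IsFrame lam Lam v) :
    ∑ k, d2 φ x (v k) ≤ pucciMax lam Lam (hess φ x) := by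
  have H := hess_isHermitian h
  rw [pucciMax, dif_pos H]
  simp only [d2_eq_sum_eigenvalues h]
  rw [Finset.sum_comm]
  refine Finset.sum_le_sum fun j _ => ?_
  rw [← Finset.mul_sum]
  obtain ⟨h1, h2⟩ := hv (H.eigenvectorBasis j)
  simp only [real_inner_comm (H.eigenvectorBasis j)] at h1 h2 ⊢
  rw [H.eigenvectorBasis.orthonormal.1 j] at h1 h2
  rcases le_total 0 (H.eigenvalues j) with h0 | h0
  · rw [max_eq_left h0, min_eq_right h0]; nlinarith
  · rw [max_eq_right h0, min_eq_left h0]; nlinarith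

theorem exists_frame_pucciMax_eq (hlam : 0 ≤ lam) (hLam : lam ≤ Lam)
    {φ : EuclideanSpace ℝ (Fin n) → ℝ} {x : EuclideanSpace ℝ (Fin n)} (h : ContDiffAt ℝ 2 φ x) :
    ∃ v : Fin n → EuclideanSpace ℝ (Fin n), IsFrame lam Lam v ∧
      pucciMax lam Lam (hess φ x) = ∑ k, d2 φ x (v k) := by
  have H := hess_isHermitian h
  set a : Fin n → ℝ := fun j => if 0 ≤ H.eigenvalues j then Lam else lam with ha
  have ha1 : ∀ j, lam ≤ a j := fun j => by simp only [ha]; split_ifs <;> linarith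
  have ha2 : ∀ j, a j ≤ Lam := fun j => by simp only [ha]; split_ifs <;> linarith
  have hs : ∀ j, √(a j) ^ 2 = a j := fun j => Real.sq_sqrt (hlam.trans (ha1 j))
  refine ⟨fun j => √(a j) • H.eigenvectorBasis j, fun ξ => ?_, ?_⟩
  · have hξ := H.eigenvectorBasis.sum_sq_norm_inner_right ξ
    simp only [Real.norm_eq_abs, sq_abs] at hξ
    simp only [real_inner_smul_left, mul_pow, hs]
    rw [← hξ, Finset.mul_sum, Finset.mul_sum]
    exact ⟨Finset.sum_le_sum fun j _ => mul_le_mul_of_nonneg_right (ha1 j) (sq_nonneg _),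
      Finset.sum_le_sum fun j _ => mul_le_mul_of_nonneg_right (ha2 j) (sq_nonneg _)⟩
  · rw [pucciMax, dif_pos H]
    refine Finset.sum_congr rfl fun j _ => ?_
    rw [d2_smul h, hs, d2_eq_sum_eigenvalues h, Finset.sum_eq_single j]
    · rw [real_inner_self_eq_norm_sq, H.eigenvectorBasis.orthonormal.1 j]
      simp only [ha]
      split_ifs with h0
      · rw [max_eq_left h0, min_eq_right h0]; ring
      · rw [max_eq_right (by linarith), min_eq_left (by linarith)]; ring
    · intro i _ hij
      rw [H.eigenvectorBasis.orthonormal.2 hij]; ring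
    · simp

theorem sum_d2_le_sum_d2_add_eventually {φ : EuclideanSpace ℝ (Fin n) → ℝ}
    {x : EuclideanSpace ℝ (Fin n)} (hφ : ContDiff ℝ 2 φ) (lam Lam : ℝ) {ε : ℝ} (hε : 0 < ε) :
    ∀ᶠ y in 𝓝 x, ∀ v : Fin n → EuclideanSpace ℝ (Fin n), IsFrame lam Lam v →
      |∑ k, d2 φ y (v k) - ∑ k, d2 φ x (v k)| ≤ ε := by
  have hε' : 0 < ε / (n * |Lam| + 1) := by positivity
  filter_upwards [eventually_abs_d2_sub_le hφ x hε'] with y hy v hv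
  have hk := fun k => hy (v k)
  rw [← Finset.sum_sub_distrib]
  calc |∑ k, (d2 φ y (v k) - d2 φ x (v k))| ≤ ∑ k, ε / (n * |Lam| + 1) * ‖v k‖ ^ 2 :=
        (Finset.abs_sum_le_sum_abs _ _).trans (Finset.sum_le_sum fun k _ => hk k)
    _ = ε / (n * |Lam| + 1) * ∑ k, ‖v k‖ ^ 2 := by rw [Finset.mul_sum]
    _ ≤ ε / (n * |Lam| + 1) * (n * |Lam| + 1) := by
        have h1 := hv.sum_norm_sq_le
        have h2 : (n : ℝ) * Lam ≤ n * |Lam| := by gcongr; exact le_abs_self _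
        gcongr; linarith
    _ = ε := by field_simp

end Frames

/-- One step of the explicit finite difference scheme for the operator `f ↦ ∑ₖ D²f(vₖ, vₖ)`. -/
noncomputable def diffStep {ι F : Type*} [Fintype ι] [AddCommGroup F] [Module ℝ F]
    (θ h : ℝ) (v : ι → F) (f : F → ℝ) : F → ℝ :=
  fun x => f x + θ * ∑ k, (f (x + h • v k) + f (x - h • v k) - 2 * f x)

section DiffStep

variable {ι F : Type*} [Fintype ι] [NormedAddCommGroup F] [NormedSpace ℝ F]
  {θ h : ℝ} {v : ι → F}

theorem diffStep_mono (hθ : 0 ≤ θ) (hθ' : 2 * Fintype.card ι * θ ≤ 1) :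
    Monotone (diffStep θ h v) := by
  intro f g hfg x
  have e : ∀ f : F → ℝ, diffStep θ h v f x =
      (1 - 2 * Fintype.card ι * θ) * f x + θ * ∑ k, (f (x + h • v k) + f (x - h • v k)) := by
    intro f
    simp only [diffStep, Finset.sum_sub_distrib]
    simp
    ring
  rw [e, e]
  have h1 : 0 ≤ 1 - 2 * Fintype.card ι * θ := by linarith
  have h2 : ∑ k, (f (x + h • v k) + f (x - h • v k)) ≤ ∑ k, (g (x + h • v k) + g (x - h • v k)) :=
    Finset.sum_le_sum fun k _ => add_le_add (hfg _) (hfg _)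
  exact add_le_add (mul_le_mul_of_nonneg_left (hfg x) h1) (mul_le_mul_of_nonneg_left h2 hθ)

theorem diffStep_add_const (f : F → ℝ) (c : ℝ) :
    diffStep θ h v (fun x => f x + c) = fun x => diffStep θ h v f x + c := by
  funext x
  simp only [diffStep]
  have : ∀ k, f (x + h • v k) + c + (f (x - h • v k) + c) - 2 * (f x + c) =
    f (x + h • v k) + f (x - h • v k) - 2 * f x := fun k => by ring
  simp only [this]; ring

theorem diffStep_add (f g : F → ℝ) :
    diffStep θ h v (fun x => f x + g x) = fun x => diffStep θ h v f x + diffStep θ h v g x := by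
  funext x
  simp only [diffStep]
  have : ∀ k, f (x + h • v k) + g (x + h • v k) + (f (x - h • v k) + g (x - h • v k))
      - 2 * (f x + g x) = (f (x + h • v k) + f (x - h • v k) - 2 * f x) +
        (g (x + h • v k) + g (x - h • v k) - 2 * g x) := fun k => by ring
  simp only [this, Finset.sum_add_distrib]; ring

theorem diffStep_const_mul (c : ℝ) (f : F → ℝ) :
    diffStep θ h v (fun x => c * f x) = fun x => c * diffStep θ h v f x := by
  funext x
  simp only [diffStep]
  have : ∀ k, c * f (x + h • v k) + c * f (x - h • v k) - 2 * (c * f x) =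
    c * (f (x + h • v k) + f (x - h • v k) - 2 * f x) := fun k => by ring
  simp only [this, ← Finset.mul_sum]; ring

theorem diffStep_comp_add (f : F → ℝ) (a : F) :
    diffStep θ h v (fun x => f (x + a)) = fun x => diffStep θ h v f (x + a) := by
  funext x
  simp only [diffStep]
  have : ∀ k, f (x + h • v k + a) + f (x - h • v k + a) - 2 * f (x + a) =
      f (x + a + h • v k) + f (x + a - h • v k) - 2 * f (x + a) := fun k => by
    rw [show x + h • v k + a = x + a + h • v k by abel,
      show x - h • v k + a = x + a - h • v k by abel]
  simp only [this]

theorem diffStep_secondDiff (f : F → ℝ) (a : F) :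
    diffStep θ h v (fun x => f (x + a) + f (x - a) - 2 * f x) =
      fun x => diffStep θ h v f (x + a) + diffStep θ h v f (x - a) - 2 * diffStep θ h v f x := by
  have e : (fun x => f (x + a) + f (x - a) - 2 * f x) =
      fun x => (f (x + a) + f (x + -a)) + (-2) * f x := by
    funext x; rw [sub_eq_add_neg x a]; ring
  rw [e, diffStep_add (fun x => f (x + a) + f (x + -a)) (fun x => (-2) * f x),
    diffStep_add (fun x => f (x + a)) (fun x => f (x + -a)), diffStep_const_mul,
    diffStep_comp_add, diffStep_comp_add]
  funext x
  rw [sub_eq_add_neg x a]; ring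

theorem diffStep_iterate_mono (hθ : 0 ≤ θ) (hθ' : 2 * Fintype.card ι * θ ≤ 1) (j : ℕ) :
    Monotone (diffStep θ h v)^[j] := (diffStep_mono hθ hθ').iterate j

theorem diffStep_iterate_add_const (f : F → ℝ) (c : ℝ) (j : ℕ) :
    (diffStep θ h v)^[j] (fun x => f x + c) = fun x => (diffStep θ h v)^[j] f x + c := by
  induction j with
  | zero => rfl
  | succ j ih => simp only [Function.iterate_succ_apply', ih, diffStep_add_const]

theorem ContDiff.diffStep {m : WithTop ℕ∞} {f : F → ℝ} (hf : ContDiff ℝ m f) :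
    ContDiff ℝ m (diffStep θ h v f) := by
  unfold _root_.diffStep
  refine hf.add (contDiff_const.mul (ContDiff.sum fun k _ => ?_))
  exact ((hf.comp (contDiff_id.add contDiff_const)).add
    (hf.comp (contDiff_id.sub contDiff_const))).sub (contDiff_const.mul hf)

theorem HasCompactSupport.diffStep {f : F → ℝ} (hf : HasCompactSupport f) :
    HasCompactSupport (diffStep θ h v f) := by
  have h1 : ∀ a : F, HasCompactSupport fun x => f (x + a) := fun a =>
    hf.comp_homeomorph (Homeomorph.addRight a)
  have h2 : ∀ s : Finset ι, HasCompactSupport fun x =>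
      ∑ k ∈ s, (f (x + h • v k) + f (x - h • v k) - 2 * f x) := fun s => by
    classical
    induction s using Finset.induction_on with
    | empty =>
      simp only [Finset.sum_empty]
      exact HasCompactSupport.zero
    | insert a s ha ih =>
      simp only [Finset.sum_insert ha]
      refine HasCompactSupport.add ?_ ih
      have h3 := h1 (-(h • v a))
      simp only [← sub_eq_add_neg] at h3
      exact ((h1 _).add h3).sub (hf.mul_left (f := fun _ => (2 : ℝ)))
  exact hf.add ((h2 Finset.univ).mul_left (f := fun _ => θ))

theorem d2_comp_add (f : F → ℝ) (a x w : F) : d2 (fun y => f (y + a)) x w = d2 f (x + a) w := by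
  simp only [d2, add_right_comm]

theorem d2_diffStep {f : F → ℝ} (hf : ContDiff ℝ 2 f) (x w : F) :
    d2 (diffStep θ h v f) x w = diffStep θ h v (fun y => d2 f y w) x := by
  have h1 : ∀ a : F, ContDiff ℝ 2 fun x => f (x + a) := fun a =>
    hf.comp (contDiff_id.add contDiff_const)
  have h3 : ∀ k, ContDiff ℝ 2 fun x => f (x + h • v k) + f (x + -(h • v k)) + (-2) * f x := fun k =>
    ((h1 _).add (h1 _)).add (contDiff_const.mul hf)
  have hs : ∀ s : Finset ι, ContDiff ℝ 2 fun x =>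
      ∑ k ∈ s, (f (x + h • v k) + f (x + -(h • v k)) + (-2) * f x) := fun s =>
    ContDiff.sum fun k _ => h3 k
  have h2 : ∀ s : Finset ι, d2 (fun x =>
      ∑ k ∈ s, (f (x + h • v k) + f (x + -(h • v k)) + (-2) * f x)) x w =
      ∑ k ∈ s, (d2 f (x + h • v k) w + d2 f (x + -(h • v k)) w + (-2) * d2 f x w) := fun s => by
    classical
    induction s using Finset.induction_on with
    | empty => simp [d2]
    | insert a s ha ih =>
      simp only [Finset.sum_insert ha]
      rw [d2_add (h3 a).contDiffAt (hs s).contDiffAt, ih,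
        d2_add ((h1 _).add (h1 _)).contDiffAt (contDiff_const.mul hf).contDiffAt,
        d2_add (h1 _).contDiffAt (h1 _).contDiffAt, d2_comp_add, d2_comp_add, d2_const_mul]
  have e : diffStep θ h v f = fun x => f x + θ *
      ∑ k, (f (x + h • v k) + f (x + -(h • v k)) + (-2) * f x) := by
    funext x
    simp only [diffStep, sub_eq_add_neg, neg_mul]
  rw [e, d2_add hf.contDiffAt (contDiff_const.mul (hs _)).contDiffAt, d2_const_mul, h2]
  simp only [diffStep, sub_eq_add_neg, neg_mul]

theorem contDiff_line {m : WithTop ℕ∞} {f : F → ℝ} (hf : ContDiff ℝ m f) (x w : F) :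
    ContDiff ℝ m fun t : ℝ => f (x + t • w) := by
  refine hf.comp ?_
  exact contDiff_const.add (contDiff_id.smul contDiff_const)

theorem secondDiff_le {f : F → ℝ} (hf : ContDiff ℝ 2 f) {x w : F} {h c : ℝ} (hh : 0 ≤ h)
    (hc : ∀ t, |t| ≤ h → d2 f (x + t • w) w ≤ c) :
    f (x + h • w) + f (x - h • w) - 2 * f x ≤ h ^ 2 * c := by
  set g : ℝ → ℝ := fun t => f (x + t • w) with hg
  have hgC : ContDiff ℝ 2 g := contDiff_line hf x w
  have hg2 : ∀ t, deriv (deriv g) t = d2 f (x + t • w) w := fun t => by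
    have : (fun s : ℝ => f (x + t • w + s • w)) = fun s => g (s + t) := by
      funext s; simp only [hg, add_smul]; congr 1; abel
    rw [d2, this]
    have h2 : (deriv fun s => g (s + t)) = fun s => deriv g (s + t) := by
      funext s; exact deriv_comp_add_const g t s
    rw [h2, deriv_comp_add_const, zero_add]
  have hg1 : Differentiable ℝ g := hgC.differentiable (by simp)
  have hg1' : Differentiable ℝ (deriv g) :=
    ((contDiff_succ_iff_deriv (n := 1)).1 (by simpa [one_add_one_eq_two] using hgC)).2.2.differentiable
      (by simp)
  set G : ℝ → ℝ := fun t => g t - c / 2 * t ^ 2 with hG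
  have hGd : deriv G = fun t => deriv g t - c * t := by
    funext t
    have := (hg1 t).hasDerivAt.sub (((hasDerivAt_id t).pow 2).const_mul (c / 2))
    refine (this.deriv).trans ?_
    simp; ring
  have hconc : ConcaveOn ℝ (Icc (-h) h) G := by
    refine concaveOn_of_deriv2_nonpos (convex_Icc _ _) ?_ ?_ ?_ ?_
    · have := hg1.continuous; fun_prop
    · fun_prop
    · rw [hGd]; fun_prop
    · intro t ht
      rw [interior_Icc] at ht
      have : deriv^[2] G t = deriv (deriv g) t - c := by
        simp only [Function.iterate_succ, Function.iterate_zero, Function.comp_apply, id, hGd]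
        have := (hg1' t).hasDerivAt.sub ((hasDerivAt_id t).const_mul c)
        refine (this.deriv).trans ?_
        simp
      rw [this, hg2]
      linarith [hc t (abs_le.2 ⟨ht.1.le, ht.2.le⟩)]
  have key := hconc.2 (show h ∈ Icc (-h) h from ⟨by linarith, le_rfl⟩)
    (show -h ∈ Icc (-h) h from ⟨le_rfl, by linarith⟩) (show (0 : ℝ) ≤ 1 / 2 by norm_num)
    (show (0 : ℝ) ≤ 1 / 2 by norm_num) (by norm_num)
  simp only [hG, hg, smul_eq_mul] at key
  have e : (1 / 2 * h + 1 / 2 * -h : ℝ) = 0 := by ring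
  rw [e] at key
  simp only [zero_smul, add_zero, neg_smul, ← sub_eq_add_neg] at key
  nlinarith

theorem abs_secondDiff_sub_le {f : F → ℝ} (hf : ContDiff ℝ 2 f) {x w : F} {h κ : ℝ} (hh : 0 ≤ h)
    (hc : ∀ t, |t| ≤ h → |d2 f (x + t • w) w - d2 f x w| ≤ κ) :
    |f (x + h • w) + f (x - h • w) - 2 * f x - h ^ 2 * d2 f x w| ≤ h ^ 2 * κ := by
  have h1 := secondDiff_le hf (x := x) (w := w) (c := d2 f x w + κ) hh fun t ht => by
    linarith [(abs_le.1 (hc t ht)).2]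
  have h2 := secondDiff_le hf.neg (x := x) (w := w) (c := -d2 f x w + κ) hh fun t ht => by
    rw [d2_neg]; linarith [(abs_le.1 (hc t ht)).1]
  rw [abs_le]
  constructor <;> nlinarith

theorem contDiff_d2 {m : ℕ} {f : F → ℝ} (hf : ContDiff ℝ (m + 2 : ℕ) f) (w : F) :
    ContDiff ℝ m fun x => d2 f x w := by
  have h2 : ContDiff ℝ 2 f := hf.of_le (by exact_mod_cast (Nat.le_add_left 2 m))
  have e : (fun x => d2 f x w) = fun x => fderiv ℝ (fderiv ℝ f) x w w := by
    funext x; exact d2_eq_fderiv h2.contDiffAt w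
  rw [e]
  have h1 : ContDiff ℝ m (fderiv ℝ (fderiv ℝ f)) :=
    (hf.fderiv_right (m := (m + 1 : ℕ)) (by norm_cast)).fderiv_right (by norm_cast)
  exact (h1.clm_apply contDiff_const).clm_apply contDiff_const

theorem HasCompactSupport.d2 {f : F → ℝ} (hf : HasCompactSupport f) (w : F) :
    HasCompactSupport fun x => d2 f x w := by
  refine hf.mono' fun x hx => ?_
  by_contra hx'
  have := notMem_tsupport_iff_eventuallyEq.1 hx'
  refine hx ?_
  show _root_.d2 f x w = 0
  rw [d2_congr this]; simp [_root_.d2]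

end DiffStep

section Smoothing

variable {ι F : Type*} [Fintype ι] [NormedAddCommGroup F] [NormedSpace ℝ F]
  {θ h : ℝ} {v : ι → F}

theorem le_add_of_resolvent_le {w ψ : F → ℝ} {G s c : ℝ} (hwc : Continuous w)
    (hws : HasCompactSupport w)
    (hw : ∀ x φ, ContDiff ℝ 2 φ → IsLocalMin (fun y => w y - φ y) x → ∑ k, d2 φ x (v k) ≤ G)
    (hψ : ContDiff ℝ 2 ψ) (hψs : HasCompactSupport ψ) (hs : 0 ≤ s)
    (H : ∀ x, ψ x - s * ∑ k, d2 ψ x (v k) + s * G ≤ w x + c) (x : F) : ψ x ≤ w x + c := by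
  obtain ⟨x₀, hx₀⟩ := (hψ.continuous.sub hwc).exists_forall_ge_of_hasCompactSupport (hψs.sub hws)
  have h1 : IsLocalMin (fun y => w y - ψ y) x₀ :=
    Eventually.of_forall fun y => by have := hx₀ y; simp only [Pi.sub_apply] at this; linarith
  have h2 := mul_le_mul_of_nonneg_left (hw x₀ ψ hψ h1) hs
  have h3 := H x₀
  have h4 := hx₀ x
  simp only [Pi.sub_apply] at h4
  linarith

theorem diffStep_const (c : ℝ) : diffStep θ h v (fun _ => c) = fun _ => c := by
  funext x
  simp only [diffStep]
  have : c + c - 2 * c = 0 := by ring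
  simp [this]

theorem diffStep_iterate_le_add {w f : F → ℝ} {G κ c : ℝ} (hθ : 0 ≤ θ)
    (hθ' : 2 * Fintype.card ι * θ ≤ 1) (hwc : Continuous w) (hws : HasCompactSupport w)
    (hw : ∀ x φ, ContDiff ℝ 2 φ → IsLocalMin (fun y => w y - φ y) x → ∑ k, d2 φ x (v k) ≤ G)
    (hf : ContDiff ℝ 2 f) (hfs : HasCompactSupport f)
    (hr : ∀ k x, f (x + h • v k) + f (x - h • v k) - 2 * f x -
      h ^ 2 * diffStep θ h v (fun y => d2 f y (v k)) x ≤ h ^ 2 * κ)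
    (hfw : ∀ x, f x ≤ w x + c) (j : ℕ) :
    ContDiff ℝ 2 ((diffStep θ h v)^[j] f) ∧ HasCompactSupport ((diffStep θ h v)^[j] f) ∧
    (∀ k x, (diffStep θ h v)^[j] f (x + h • v k) + (diffStep θ h v)^[j] f (x - h • v k) -
      2 * (diffStep θ h v)^[j] f x -
      h ^ 2 * diffStep θ h v (fun y => d2 ((diffStep θ h v)^[j] f) y (v k)) x ≤ h ^ 2 * κ) ∧
    ∀ x, (diffStep θ h v)^[j] f x ≤
      w x + (c + j * (θ * h ^ 2 * (G + Fintype.card ι * κ))) := by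
  induction j with
  | zero => exact ⟨hf, hfs, hr, by simpa using hfw⟩
  | succ j ih =>
    simp only [Function.iterate_succ_apply']
    set g := (diffStep θ h v)^[j] f with hg
    obtain ⟨h1, h2, h3, h4⟩ := ih
    refine ⟨h1.diffStep, h2.diffStep, fun k => ?_, fun x => ?_⟩
    · have e : (fun x => diffStep θ h v g (x + h • v k) + diffStep θ h v g (x - h • v k) -
          2 * diffStep θ h v g x - h ^ 2 * diffStep θ h v
            (fun y => d2 (diffStep θ h v g) y (v k)) x) =
          diffStep θ h v (fun x => (g (x + h • v k) + g (x - h • v k) - 2 * g x) +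
            (-h ^ 2) * diffStep θ h v (fun y => d2 g y (v k)) x) := by
        rw [diffStep_add (fun x => g (x + h • v k) + g (x - h • v k) - 2 * g x)
          (fun x => (-h ^ 2) * diffStep θ h v (fun y => d2 g y (v k)) x),
          diffStep_secondDiff, diffStep_const_mul]
        have : (fun y => d2 (diffStep θ h v g) y (v k)) =
            diffStep θ h v (fun y => d2 g y (v k)) := by
          funext y; exact d2_diffStep h1 y (v k)
        rw [this]
        funext x
        ring
      intro x
      have e' := congrFun e x
      refine (le_of_eq e').trans ?_
      have := diffStep_mono (v := v) (h := h) hθ hθ'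
        (show (fun x => (g (x + h • v k) + g (x - h • v k) - 2 * g x) +
            (-h ^ 2) * diffStep θ h v (fun y => d2 g y (v k)) x) ≤ fun _ => h ^ 2 * κ from
          fun x => by have := h3 k x; simp only; linarith) x
      rwa [diffStep_const] at this
    · refine le_add_of_resolvent_le (s := θ * h ^ 2) hwc hws hw h1.diffStep h2.diffStep
        (by positivity) (fun x => ?_) x
      have e : ∑ k, d2 (diffStep θ h v g) x (v k) =
          ∑ k, diffStep θ h v (fun y => d2 g y (v k)) x :=
        Finset.sum_congr rfl fun k _ => d2_diffStep h1 x (v k)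
      have h5 : ∑ k, (g (x + h • v k) + g (x - h • v k) - 2 * g x -
          h ^ 2 * diffStep θ h v (fun y => d2 g y (v k)) x) ≤ Fintype.card ι * (h ^ 2 * κ) := by
        calc _ ≤ ∑ _k : ι, h ^ 2 * κ := Finset.sum_le_sum fun k _ => h3 k x
          _ = _ := by simp
      rw [Finset.sum_sub_distrib, ← Finset.mul_sum] at h5
      have h6 := mul_le_mul_of_nonneg_left h5 hθ
      rw [e]
      have h7 := h4 x
      have h8 : diffStep θ h v g x =
        g x + θ * ∑ k, (g (x + h • v k) + g (x - h • v k) - 2 * g x) := rfl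
      rw [h8]
      push_cast
      nlinarith

theorem exists_modulus {f : F → ℝ} (hf : ContDiff ℝ 2 f) (hfs : HasCompactSupport f)
    (v : ι → F) {κ : ℝ} (hκ : 0 < κ) :
    ∃ h₀ > 0, ∀ t : ℝ, |t| ≤ h₀ → ∀ k l x, |d2 f (x + t • v l) (v k) - d2 f x (v k)| ≤ κ := by
  have h1 : ∀ k l, ∃ h₀ > 0, ∀ t : ℝ, |t| ≤ h₀ → ∀ x,
      |d2 f (x + t • v l) (v k) - d2 f x (v k)| ≤ κ := by
    intro k l
    have hc : Continuous fun x => d2 f x (v k) :=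
      (contDiff_d2 (m := 0) (by exact_mod_cast hf) (v k)).continuous
    have hu := (hfs.d2 (v k)).uniformContinuous_of_continuous hc
    obtain ⟨δ, hδ, H⟩ := Metric.uniformContinuous_iff.1 hu κ hκ
    refine ⟨δ / (2 * (‖v l‖ + 1)), by positivity, fun t ht x => ?_⟩
    rw [← Real.dist_eq]
    refine (H ?_).le
    rw [dist_eq_norm, add_sub_cancel_left, norm_smul, Real.norm_eq_abs]
    have h3 : |t| * ‖v l‖ ≤ δ / (2 * (‖v l‖ + 1)) * (‖v l‖ + 1) := by
      refine mul_le_mul ht (by linarith) (norm_nonneg _) (by positivity)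
    have h4 : δ / (2 * (‖v l‖ + 1)) * (‖v l‖ + 1) = δ / 2 := by
      have : ‖v l‖ + 1 ≠ 0 := by positivity
      field_simp
    linarith
  choose H hH0 hH using h1
  have h2 : ∀ᶠ t in 𝓝[>] (0 : ℝ), ∀ k l, t ≤ H k l := by
    rw [Filter.eventually_all]; intro k
    rw [Filter.eventually_all]; intro l
    filter_upwards [Ioo_mem_nhdsGT (hH0 k l)] with t ht using ht.2.le
  obtain ⟨t, ht, ht0⟩ := (h2.and self_mem_nhdsWithin).exists
  exact ⟨t, ht0, fun s hs k l x => hH k l s (hs.trans (ht k l)) x⟩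

theorem le_add_iterate_diffStep {f : F → ℝ} {κ C : ℝ} (hθ : 0 ≤ θ) (hh : 0 ≤ h)
    (hC : 0 ≤ C)
    (hθ' : 2 * Fintype.card ι * θ ≤ 1) (hf : ContDiff ℝ 4 f)
    (hκ : ∀ t, |t| ≤ h → ∀ k x, |d2 f (x + t • v k) (v k) - d2 f x (v k)| ≤ κ)
    (hC' : ∀ k x, -C ≤ d2 (fun y => ∑ l, d2 f y (v l)) x (v k)) (j : ℕ) (x : F) :
    f x + j * (θ * h ^ 2) * (∑ k, d2 f x (v k) - Fintype.card ι * κ -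
      j * (θ * h ^ 2) * (Fintype.card ι * C)) ≤ (diffStep θ h v)^[j] f x := by
  have hf2 : ContDiff ℝ 2 f := hf.of_le (by norm_num)
  set Y : F → ℝ := fun y => ∑ l, d2 f y (v l) with hY
  have hYc : ContDiff ℝ 2 Y := ContDiff.sum fun l _ => contDiff_d2 (m := 2) (by exact_mod_cast hf) _
  have hTY : ∀ j : ℕ, ∀ x, Y x + (-(j * (θ * h ^ 2) * (Fintype.card ι * C))) ≤
      (diffStep θ h v)^[j] Y x := by
    intro j
    induction j with
    | zero => intro x; simp
    | succ j ih =>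
      intro x
      rw [Function.iterate_succ_apply']
      have h1 := diffStep_mono (v := v) (h := h) hθ hθ' (show
        (fun x => Y x + (-(j * (θ * h ^ 2) * (Fintype.card ι * C)))) ≤ _ from ih) x
      rw [diffStep_add_const] at h1
      refine le_trans ?_ h1
      have h2 : ∑ k : ι, -(h ^ 2 * C) ≤ ∑ k, (Y (x + h • v k) + Y (x - h • v k) - 2 * Y x) := by
        refine Finset.sum_le_sum fun k _ => ?_
        have := secondDiff_le hYc.neg (x := x) (w := v k) (c := C) hh fun t ht => by
          rw [d2_neg]; linarith [hC' k (x + t • v k)]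
        linarith
      simp only [Finset.sum_const, Finset.card_univ, nsmul_eq_mul] at h2
      have h3 := mul_le_mul_of_nonneg_left h2 hθ
      simp only [diffStep]
      push_cast
      linarith
  have hT1 : (fun x => f x + (θ * h ^ 2) * (Y x + (-(Fintype.card ι * κ)))) ≤ diffStep θ h v f := by
    intro x
    have h2 : ∑ k : ι, (h ^ 2 * d2 f x (v k) - h ^ 2 * κ) ≤
        ∑ k, (f (x + h • v k) + f (x - h • v k) - 2 * f x) := by
      refine Finset.sum_le_sum fun k _ => ?_
      have := abs_secondDiff_sub_le hf2 (x := x) (w := v k) (κ := κ) hh fun t ht => hκ t ht k x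
      linarith [(abs_le.1 this).1]
    rw [Finset.sum_sub_distrib, ← Finset.mul_sum] at h2
    simp only [Finset.sum_const, Finset.card_univ, nsmul_eq_mul] at h2
    have h3 := mul_le_mul_of_nonneg_left h2 hθ
    simp only [diffStep, hY]
    linarith
  have hlin : ∀ (j : ℕ) (a : ℝ) (c : ℝ) (p q : F → ℝ),
      (diffStep θ h v)^[j] (fun x => p x + a * (q x + c)) =
      fun x => (diffStep θ h v)^[j] p x + a * ((diffStep θ h v)^[j] q x + c) := by
    intro j a c p q
    induction j with
    | zero => rfl
    | succ j ih =>
      rw [Function.iterate_succ_apply', ih, diffStep_add ((diffStep θ h v)^[j] p)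
        (fun x => a * ((diffStep θ h v)^[j] q x + c)), diffStep_const_mul, diffStep_add_const]
      simp only [Function.iterate_succ_apply']
  induction j generalizing x with
  | zero => simp
  | succ j ih =>
    have h1 := diffStep_iterate_mono (v := v) (h := h) hθ hθ' j hT1 x
    rw [hlin, ← Function.iterate_succ_apply] at h1
    refine le_trans ?_ h1
    simp only
    have h2 := ih x
    have h3 := mul_le_mul_of_nonneg_left (hTY j x) (by positivity : 0 ≤ θ * h ^ 2)
    have h4 : 0 ≤ (θ * h ^ 2) * (θ * h ^ 2) * (Fintype.card ι * C) * (j + 1) := by positivity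
    have e : ∑ k, d2 f x (v k) = Y x := rfl
    rw [e] at h2 ⊢
    push_cast
    nlinarith

end Smoothing

section Mollify

open MeasureTheory

variable {n : ℕ}

theorem exists_mollifier {w : EuclideanSpace ℝ (Fin n) → ℝ} (hwc : Continuous w)
    (hws : HasCompactSupport w) {δ : ℝ} (hδ : 0 < δ) :
    ∃ χ : EuclideanSpace ℝ (Fin n) → ℝ, Continuous χ ∧ HasCompactSupport χ ∧ (∀ t, 0 ≤ χ t) ∧
      ∫ t, χ t = 1 ∧ (∀ m : ℕ, ContDiff ℝ m fun x => ∫ t, χ t * w (x - t)) ∧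
      HasCompactSupport (fun x => ∫ t, χ t * w (x - t)) ∧
      ∀ x, |(∫ t, χ t * w (x - t)) - w x| ≤ δ := by
  obtain ⟨ε, hε, H⟩ := Metric.uniformContinuous_iff.1 (hws.uniformContinuous_of_continuous hwc) δ hδ
  let φ : ContDiffBump (0 : EuclideanSpace ℝ (Fin n)) := ⟨ε / 2, ε, by linarith, by linarith⟩
  have e : (fun x => ∫ t, φ.normed volume t * w (x - t)) =
      convolution (φ.normed volume) w (ContinuousLinearMap.lsmul ℝ ℝ) volume := by
    funext x; rw [convolution_lsmul]; simp
  refine ⟨φ.normed volume, φ.continuous_normed, φ.hasCompactSupport_normed,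
    fun t => φ.nonneg_normed t, φ.integral_normed, fun m => ?_, ?_, fun x => ?_⟩
  · rw [e]
    exact φ.hasCompactSupport_normed.contDiff_convolution_left (n := (m : ℕ∞)) _
      φ.contDiff_normed hwc.locallyIntegrable
  · rw [e]
    exact φ.hasCompactSupport_normed.convolution _ hws
  · have e' := congrFun e x
    have := ContDiffBump.dist_normed_convolution_le (φ := φ) (μ := volume) (x₀ := x) (ε := δ)
      hwc.aestronglyMeasurable fun y hy => (H hy).le
    rw [← e', Real.dist_eq] at this
    exact this

theorem integrable_mul_comp_sub {χ f : EuclideanSpace ℝ (Fin n) → ℝ} (hχ : Continuous χ)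
    (hχs : HasCompactSupport χ) (hf : Continuous f) (x : EuclideanSpace ℝ (Fin n)) :
    Integrable fun t => χ t * f (x - t) :=
  (hχ.mul (hf.comp (continuous_const.sub continuous_id))).integrable_of_hasCompactSupport
    (hχs.mul_right)

variable {ι : Type*} [Fintype ι] {θ h : ℝ} {v : ι → EuclideanSpace ℝ (Fin n)}

theorem Continuous.diffStep {f : EuclideanSpace ℝ (Fin n) → ℝ} (hf : Continuous f) :
    Continuous (diffStep θ h v f) := by
  unfold _root_.diffStep
  fun_prop

theorem diffStep_integral {χ f : EuclideanSpace ℝ (Fin n) → ℝ} (hχ : Continuous χ)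
    (hχs : HasCompactSupport χ) (hf : Continuous f) :
    diffStep θ h v (fun x => ∫ t, χ t * f (x - t)) =
      fun x => ∫ t, χ t * diffStep θ h v f (x - t) := by
  funext x
  have hi := fun y => integrable_mul_comp_sub hχ hχs hf y
  simp only [diffStep]
  have e : ∀ t, χ t * (f (x - t) + θ * ∑ k, (f (x - t + h • v k) + f (x - t - h • v k) -
      2 * f (x - t))) = χ t * f (x - t) + θ * ∑ k, (χ t * f (x + h • v k - t) +
      χ t * f (x - h • v k - t) - 2 * (χ t * f (x - t))) := by
    intro t
    have : ∀ k, χ t * f (x + h • v k - t) +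
      χ t * f (x - h • v k - t) - 2 * (χ t * f (x - t)) =
      χ t * (f (x - t + h • v k) + f (x - t - h • v k) - 2 * f (x - t)) := fun k => by
      rw [show x + h • v k - t = x - t + h • v k by abel,
        show x - h • v k - t = x - t - h • v k by abel]
      ring
    simp only [this, ← Finset.mul_sum]
    ring
  simp only [e]
  have hk : ∀ k, Integrable fun t => χ t * f (x + h • v k - t) +
      χ t * f (x - h • v k - t) - 2 * (χ t * f (x - t)) := fun k =>
    ((hi _).add (hi _)).sub ((hi _).const_mul 2)
  rw [integral_add (hi x) ((integrable_finsetSum _ fun k _ => hk k).const_mul θ),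
    integral_const_mul, integral_finsetSum _ fun k _ => hk k]
  congr 2
  refine Finset.sum_congr rfl fun k _ => ?_
  have h1 : Integrable fun t => χ t * f (x + h • v k - t) + χ t * f (x - h • v k - t) :=
    (hi _).add (hi _)
  rw [integral_sub h1 ((hi _).const_mul 2), integral_add (hi _) (hi _), integral_const_mul]

theorem diffStep_iterate_integral {χ f : EuclideanSpace ℝ (Fin n) → ℝ} (hχ : Continuous χ)
    (hχs : HasCompactSupport χ) (hf : Continuous f) (j : ℕ) :
    Continuous ((diffStep θ h v)^[j] f) ∧ (diffStep θ h v)^[j] (fun x => ∫ t, χ t * f (x - t)) =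
      fun x => ∫ t, χ t * (diffStep θ h v)^[j] f (x - t) := by
  induction j with
  | zero => exact ⟨hf, rfl⟩
  | succ j ih =>
    simp only [Function.iterate_succ_apply']
    exact ⟨ih.1.diffStep, by rw [ih.2, diffStep_integral hχ hχs ih.1]⟩

/-- Mollification preserves the viscosity inequality `∑ₖ D²w(vₖ, vₖ) ≤ G`. -/
theorem exists_smooth_approx {w : EuclideanSpace ℝ (Fin n) → ℝ} (hwc : Continuous w)
    (hws : HasCompactSupport w) {δ : ℝ} (hδ : 0 < δ) :
    ∃ W : EuclideanSpace ℝ (Fin n) → ℝ, ContDiff ℝ 2 W ∧ (∀ x, |W x - w x| ≤ δ) ∧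
      ∀ (v : Fin n → EuclideanSpace ℝ (Fin n)) (G : ℝ), 0 ≤ G →
        (∀ x φ, ContDiff ℝ 2 φ → IsLocalMin (fun y => w y - φ y) x →
          ∑ k, d2 φ x (v k) ≤ G) → ∀ x, ∑ k, d2 W x (v k) ≤ G := by
  obtain ⟨χ, hχ, hχs, hχ0, hχ1, hWc, hWs, hWw⟩ := exists_mollifier hwc hws hδ
  refine ⟨fun x => ∫ t, χ t * w (x - t), hWc 2, hWw, fun v G hG hv x => ?_⟩
  set W := fun x => ∫ t, χ t * w (x - t) with hW
  refine le_of_forall_pos_le_add fun ε hε => ?_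
  have hYc : ContDiff ℝ 2 fun y => ∑ l, d2 W y (v l) :=
    ContDiff.sum fun l _ => contDiff_d2 (m := 2) (hWc 4) _
  have hYs : HasCompactSupport fun y => ∑ l, d2 W y (v l) := by
    have : ∀ s : Finset (Fin n), HasCompactSupport fun y => ∑ l ∈ s, d2 W y (v l) := by
      intro s
      classical
      induction s using Finset.induction_on with
      | empty => simp only [Finset.sum_empty]; exact HasCompactSupport.zero
      | insert a s ha ih =>
        simp only [Finset.sum_insert ha]
        exact (hWs.d2 (v a)).add ih
    exact this _
  have hC1 : ∀ k, ∃ C, ∀ x, ‖d2 (fun y => ∑ l, d2 W y (v l)) x (v k)‖ ≤ C := fun k =>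
    (contDiff_d2 (m := 0) (by exact_mod_cast hYc) (v k)).continuous.bounded_above_of_compact_support
      (hYs.d2 _)
  choose C₁ hC₁ using hC1
  set C := ∑ k, |C₁ k| with hC
  have hC0 : 0 ≤ C := Finset.sum_nonneg fun _ _ => abs_nonneg _
  have hC' : ∀ k x, -C ≤ d2 (fun y => ∑ l, d2 W y (v l)) x (v k) := by
    intro k x
    have h1 := (abs_le.1 (hC₁ k x)).1
    have h2 : |C₁ k| ≤ C := Finset.single_le_sum (f := fun k => |C₁ k|)
      (fun _ _ => abs_nonneg _) (Finset.mem_univ k)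
    linarith [le_abs_self (C₁ k)]
  set m : ℝ := (Fintype.card (Fin n) : ℝ) with hm
  have hm0 : 0 ≤ m := Nat.cast_nonneg _
  set θ : ℝ := 1 / (2 * m + 1) with hθ
  have hθ0 : 0 < θ := by positivity
  have hθ1 : 2 * m * θ ≤ 1 := by
    rw [hθ, mul_one_div, div_le_one (by positivity)]; linarith
  set t : ℝ := ε / (4 * (m * C + 1)) with ht
  have ht0 : 0 < t := by positivity
  have htC : t * (m * C) ≤ ε / 4 := by
    have : t * (m * C + 1) = ε / 4 := by rw [ht]; field_simp
    nlinarith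
  set δ' : ℝ := t * ε / 8 with hδ'
  have hδ'0 : 0 < δ' := by positivity
  obtain ⟨η, -, -, -, -, hfc, hfs, hfw⟩ := exists_mollifier hwc hws hδ'0
  set f := fun x => ∫ t, η t * w (x - t) with hf
  set κ : ℝ := ε / (16 * (m + 1)) with hκ
  have hκ0 : 0 < κ := by positivity
  have hmκ : m * κ ≤ ε / 16 := by
    have : (m + 1) * κ = ε / 16 := by rw [hκ]; field_simp
    nlinarith
  obtain ⟨h₁, hh₁, H₁⟩ := exists_modulus (hfc 2) hfs v hκ0
  obtain ⟨h₂, hh₂, H₂⟩ := exists_modulus (hWc 2) hWs v hκ0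
  set h₀ := min h₁ h₂ with hh₀
  have hh₀0 : 0 < h₀ := lt_min hh₁ hh₂
  obtain ⟨j, hj⟩ := exists_nat_gt (t / (θ * h₀ ^ 2))
  have hj0 : (0 : ℝ) < j := lt_trans (by positivity) hj
  set h : ℝ := √(t / (θ * j)) with hh
  have hh0 : 0 ≤ h := Real.sqrt_nonneg _
  have hhsq : h ^ 2 = t / (θ * j) := Real.sq_sqrt (by positivity)
  have hjs : j * (θ * h ^ 2) = t := by rw [hhsq]; field_simp
  have hhh : h ≤ h₀ := by
    refine Real.sqrt_le_iff.2 ⟨hh₀0.le, ?_⟩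
    rw [div_lt_iff₀ (by positivity)] at hj
    rw [div_le_iff₀ (by positivity)]
    nlinarith
  have hr : ∀ k x, f (x + h • v k) + f (x - h • v k) - 2 * f x -
      h ^ 2 * diffStep θ h v (fun y => d2 f y (v k)) x ≤ h ^ 2 * (2 * κ) := by
    intro k x
    have h1 := abs_secondDiff_sub_le (hfc 2) (x := x) (w := v k) (κ := κ) hh0 fun t ht =>
      H₁ t (ht.trans (hhh.trans (min_le_left _ _))) k k x
    have h2 : ∑ l : Fin n, -(2 * κ) ≤ ∑ l, (d2 f (x + h • v l) (v k) + d2 f (x - h • v l) (v k) -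
        2 * d2 f x (v k)) := by
      refine Finset.sum_le_sum fun l _ => ?_
      have a1 := H₁ h (by rw [abs_of_nonneg hh0]; exact hhh.trans (min_le_left _ _)) k l x
      have a2 := H₁ (-h) (by rw [abs_neg, abs_of_nonneg hh0]; exact hhh.trans (min_le_left _ _))
        k l x
      rw [neg_smul, ← sub_eq_add_neg] at a2
      linarith [(abs_le.1 a1).1, (abs_le.1 a2).1]
    simp only [Finset.sum_const, Finset.card_univ, nsmul_eq_mul] at h2
    have h3 := mul_le_mul_of_nonneg_left h2 hθ0.le
    have h4 : d2 f x (v k) - κ ≤ diffStep θ h v (fun y => d2 f y (v k)) x := by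
      simp only [diffStep]
      nlinarith
    have h5 := mul_le_mul_of_nonneg_left h4 (sq_nonneg h)
    linarith [(abs_le.1 h1).2]
  have hup := (diffStep_iterate_le_add (c := δ') hθ0.le hθ1 hwc hws hv (hfc 2) hfs hr
    (fun x => by have := (abs_le.1 (hfw x)).2; simp only [hf]; linarith) j).2.2.2
  have hup' : ∀ x, (diffStep θ h v)^[j] w x ≤ w x + (2 * δ' + t * (G + m * (2 * κ))) := by
    intro x
    have h1 := diffStep_iterate_mono (v := v) (h := h) hθ0.le hθ1 j
      (show w ≤ fun x => f x + δ' from fun x => by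
        have := (abs_le.1 (hfw x)).1; simp only [hf]; linarith) x
    rw [diffStep_iterate_add_const] at h1
    have h2 := hup x
    have h3 : (j : ℝ) * (θ * h ^ 2 * (G + m * (2 * κ))) = t * (G + m * (2 * κ)) := by
      rw [← mul_assoc, hjs]
    rw [h3] at h2
    linarith
  have hupW : (diffStep θ h v)^[j] W x ≤ W x + (2 * δ' + t * (G + m * (2 * κ))) := by
    obtain ⟨hcj, hej⟩ := diffStep_iterate_integral (θ := θ) (h := h) (v := v) hχ hχs hwc j
    rw [congrFun hej x]
    have h1 : W x + (2 * δ' + t * (G + m * (2 * κ))) =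
        ∫ s, (χ s * w (x - s) + χ s * (2 * δ' + t * (G + m * (2 * κ)))) := by
      rw [integral_add (integrable_mul_comp_sub hχ hχs hwc x)
        ((hχ.integrable_of_hasCompactSupport hχs).mul_const _), integral_mul_const, hχ1, one_mul]
    rw [h1]
    refine integral_mono (integrable_mul_comp_sub hχ hχs hcj x)
      ((integrable_mul_comp_sub hχ hχs hwc x).add
        ((hχ.integrable_of_hasCompactSupport hχs).mul_const _)) fun s => ?_
    simp only
    rw [← mul_add]
    exact mul_le_mul_of_nonneg_left (hup' _) (hχ0 s)
  have hlow := le_add_iterate_diffStep (v := v) hθ0.le hh0 hC0 hθ1 (hWc 4)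
    (fun s hs k x => H₂ s (hs.trans (hhh.trans (min_le_right _ _))) k k x) hC' j x
  rw [hjs] at hlow
  have key := hlow.trans hupW
  have h8 : t * (∑ k, d2 W x (v k) - m * κ - t * (m * C)) ≤
      t * (ε / 4 + (G + m * (2 * κ))) := by
    have : 2 * δ' = t * (ε / 4) := by rw [hδ']; ring
    linarith
  have h9 := le_of_mul_le_mul_left h8 ht0
  linarith

end Mollify

section Calculus

variable {F : Type*} [NormedAddCommGroup F] [NormedSpace ℝ F]

theorem d2_comp {H H' : ℝ → ℝ} {H'' b c : ℝ} {q : F → ℝ} {x v : F}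
    (hH : ∀ᶠ s in 𝓝 (q x), HasDerivAt H (H' s) s) (hH' : HasDerivAt H' H'' (q x))
    (hq : ∀ s : ℝ, q (x + s • v) = q x + b * s + c * s ^ 2) :
    d2 (fun y => H (q y)) x v = H'' * b ^ 2 + 2 * c * H' (q x) := by
  have hl : ∀ s : ℝ, HasDerivAt (fun s => q x + b * s + c * s ^ 2) (b + 2 * c * s) s := fun s => by
    have := (((hasDerivAt_id s).const_mul b).const_add (q x)).add
      (((hasDerivAt_id s).pow 2).const_mul c)
    refine this.congr_deriv ?_
    norm_num; ring
  have h0 : q x + b * 0 + c * 0 ^ 2 = q x := by ring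
  refine d2_eq_of_hasDerivAt
    (g := fun s => H' (q x + b * s + c * s ^ 2) * (b + 2 * c * s)) ?_ ?_
  · have hc : Tendsto (fun s => q x + b * s + c * s ^ 2) (𝓝 0) (𝓝 (q x)) := by
      have := (hl 0).continuousAt.tendsto
      simpa using this
    filter_upwards [hc.eventually hH] with s hs
    simp only [hq]
    exact hs.comp s (hl s)
  · have h1 : HasDerivAt (fun s => H' (q x + b * s + c * s ^ 2)) (H'' * (b + 2 * c * 0)) 0 := by
      have := hl 0
      refine HasDerivAt.comp (h₂ := H') (0 : ℝ) ?_ this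
      simpa using hH'
    have h2 : HasDerivAt (fun s : ℝ => b + 2 * c * s) (2 * c) 0 := by
      simpa using ((hasDerivAt_id (0 : ℝ)).const_mul (2 * c)).const_add b
    refine (h1.mul h2).congr_deriv ?_
    norm_num; ring

theorem d2_quadratic {φ : F → ℝ} {x v : F} {b c : ℝ}
    (hq : ∀ s : ℝ, φ (x + s • v) = φ x + b * s + c * s ^ 2) : d2 φ x v = 2 * c := by
  have := d2_comp (H := fun s => s) (H' := fun _ => 1) (H'' := 0) (q := φ) (x := x) (v := v)
    (Eventually.of_forall fun s => hasDerivAt_id s) (hasDerivAt_const _ _) hq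
  simpa using this

theorem exists_contDiff_eventuallyEq [HasContDiffBump F] [FiniteDimensional ℝ F]
    {φ : F → ℝ} {x : F} (h : ContDiffAt ℝ 2 φ x) :
    ∃ ψ : F → ℝ, ContDiff ℝ 2 ψ ∧ ψ =ᶠ[𝓝 x] φ := by
  obtain ⟨r, hr, H⟩ := Metric.eventually_nhds_iff_ball.1 (h.eventually (by simp))
  let χ : ContDiffBump x := ⟨r / 4, r / 2, by linarith, by linarith⟩
  refine ⟨fun y => χ y * φ y, contDiff_iff_contDiffAt.2 fun y => ?_, ?_⟩
  · by_cases hy : y ∈ ball x r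
    · exact χ.contDiff.contDiffAt.mul (H y hy)
    · have hy' : y ∉ tsupport χ := by
        rw [χ.tsupport_eq]
        intro h'
        exact hy (closedBall_subset_ball (by show r / 2 < r; linarith) h')
      have := notMem_tsupport_iff_eventuallyEq.1 hy'
      refine contDiffAt_const (c := (0 : ℝ)) |>.congr_of_eventuallyEq ?_
      filter_upwards [this] with z hz
      simp [hz]
  · filter_upwards [χ.eventuallyEq_one] with y hy
    simp [hy]

end Calculus

section Viscosity

variable {n : ℕ} {lam Lam : ℝ}

local notation "E" => EuclideanSpace ℝ (Fin n)

theorem d2_norm_sub_sq (x₀ x v : E) : d2 (fun y => ‖y - x₀‖ ^ 2) x v = 2 * ‖v‖ ^ 2 := by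
  refine d2_quadratic (b := 2 * ⟪x - x₀, v⟫) fun s => ?_
  rw [show x + s • v - x₀ = (x - x₀) + s • v by abel, norm_add_sq_real, inner_smul_right,
    norm_smul, mul_pow, Real.norm_eq_abs, sq_abs]
  ring

theorem contDiff_norm_sub_sq {m : WithTop ℕ∞} (x₀ : E) : ContDiff ℝ m fun y : E => ‖y - x₀‖ ^ 2 :=
  (contDiff_id.sub contDiff_const).norm_sq ℝ

theorem PucciSubsol.exists_frame {Ω : Set E} {u f φ : E → ℝ} {x : E} (h : PucciSubsol lam Lam Ω u f)
    (hlam : 0 ≤ lam) (hLam : lam ≤ Lam) (hx : x ∈ Ω) (hφ : ContDiffAt ℝ 2 φ x)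
    (hmax : IsLocalMax (fun y => u y - φ y) x) :
    ∃ v : Fin n → E, IsFrame lam Lam v ∧ 0 ≤ ∑ k, d2 φ x (v k) + f x := by
  obtain ⟨ψ, hψ, e⟩ := exists_contDiff_eventuallyEq hφ
  have h1 : IsLocalMax (fun y => u y - ψ y) x := by
    refine hmax.congr ?_
    filter_upwards [e] with y hy
    rw [hy]
  have h2 := h x hx ψ hψ h1
  obtain ⟨v, hv, hv'⟩ := exists_frame_pucciMax_eq hlam hLam hψ.contDiffAt (x := x)
  refine ⟨v, hv, ?_⟩
  rw [hv'] at h2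
  simpa only [d2_congr e] using h2

theorem PucciSupersol.sum_le {ι : Type*} [Fintype ι] {Ω : Set E} {u f φ : E → ℝ} {x : E}
    (h : PucciSupersol lam Lam Ω u f) (hx : x ∈ Ω) (hφ : ContDiffAt ℝ 2 φ x)
    (hmin : IsLocalMin (fun y => u y - φ y) x) {v : ι → E} (hv : IsFrame lam Lam v) :
    ∑ k, d2 φ x (v k) + f x ≤ 0 := by
  obtain ⟨ψ, hψ, e⟩ := exists_contDiff_eventuallyEq hφ
  have h1 : IsLocalMin (fun y => u y - ψ y) x := by
    refine hmin.congr ?_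
    filter_upwards [e] with y hy
    rw [hy]
  have h2 := h x hx ψ hψ h1
  have h3 := sum_d2_le_pucciMax hψ.contDiffAt hv (x := x)
  simp only [d2_congr e] at h3
  linarith

theorem exists_isLocalMax_perturb {z z' : E → ℝ} {x₀ : E} {ρ η δ : ℝ} (hρ : 0 < ρ)
    (hz' : ContinuousOn z' (closedBall x₀ ρ)) (hz : ∀ y ∈ closedBall x₀ ρ, z y ≤ z x₀)
    (hzz' : ∀ y ∈ closedBall x₀ ρ, |z' y - z y| ≤ δ) (hδ : 2 * δ < η * ρ ^ 2) :
    ∃ x₁ ∈ ball x₀ ρ, IsLocalMax (fun y => z' y - η * ‖y - x₀‖ ^ 2) x₁ := by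
  obtain ⟨x₁, hx₁, hmax⟩ := (isCompact_closedBall x₀ ρ).exists_isMaxOn
    (nonempty_closedBall.2 hρ.le) (hz'.sub (f := z') (g := fun y => η * ‖y - x₀‖ ^ 2)
      (by fun_prop))
  have hlt : x₁ ∈ ball x₀ ρ := by
    by_contra hx
    have h1 : ‖x₁ - x₀‖ = ρ := by
      rw [← dist_eq_norm]
      exact le_antisymm (mem_closedBall.1 hx₁) (not_lt.1 fun h => hx (mem_ball.2 h))
    have h2 : z' x₀ - η * ‖x₀ - x₀‖ ^ 2 ≤ z' x₁ - η * ‖x₁ - x₀‖ ^ 2 :=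
      hmax (mem_closedBall_self hρ.le)
    rw [h1, sub_self, norm_zero] at h2
    have h3 := (abs_le.1 (hzz' x₁ hx₁)).2
    have h4 := (abs_le.1 (hzz' x₀ (mem_closedBall_self hρ.le))).1
    have h5 := hz x₁ hx₁
    nlinarith
  exact ⟨x₁, hlt, hmax.isLocalMax (mem_of_superset (isOpen_ball.mem_nhds hlt) ball_subset_closedBall)⟩

theorem IsFrame.le_sum_norm_sq {v : Fin n → E} (hv : IsFrame lam Lam v) (hn : 0 < n) :
    lam ≤ ∑ k, ‖v k‖ ^ 2 := by
  have h := (hv (EuclideanSpace.single ⟨0, hn⟩ 1)).1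
  simp only [PiLp.norm_single, norm_one, one_pow, mul_one] at h
  refine h.trans (Finset.sum_le_sum fun k _ => ?_)
  have := abs_real_inner_le_norm (v k) (EuclideanSpace.single (⟨0, hn⟩ : Fin n) (1 : ℝ))
  rw [PiLp.norm_single, norm_one, mul_one] at this
  exact sq_le_sq' (by linarith [(abs_le.1 this).1]) (abs_le.1 this).2

/-- Local approximation of supersolutions by smooth supersolutions. -/
theorem PucciSupersol.exists_smooth {Ω : Set E} {v g : E → ℝ} (h : PucciSupersol lam Lam Ω v g)
    (hn : 0 < n) (hlam : 0 < lam) {x₀ : E} {r g₀ δ : ℝ} (hr : 0 < r)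
    (hΩ : ball x₀ (3 * r) ⊆ Ω)
    (hv : ContinuousOn v (ball x₀ (3 * r))) (hg : ∀ x ∈ ball x₀ (3 * r), g₀ ≤ g x) (hδ : 0 < δ) :
    ∃ V : E → ℝ, ContDiff ℝ 2 V ∧ (∀ x ∈ closedBall x₀ r, |V x - v x| ≤ δ) ∧
      ∀ x, ∀ w : Fin n → E, IsFrame lam Lam w → ∑ k, d2 V x (w k) + g₀ ≤ 0 := by
  have hsub : closedBall x₀ (2 * r) ⊆ ball x₀ (3 * r) := closedBall_subset_ball (by linarith)
  obtain ⟨M, hM⟩ := (isCompact_closedBall x₀ (2 * r)).exists_bound_of_continuousOn (hv.mono hsub)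
  simp only [Real.norm_eq_abs] at hM
  have hM0 : 0 ≤ M := (abs_nonneg _).trans (hM x₀ (mem_closedBall_self (by linarith)))
  set K : ℝ := (2 * M + 1) / r ^ 2 + |g₀| / (2 * lam) with hK
  have hK0 : 0 ≤ K := by positivity
  have hK1 : 2 * M + 1 ≤ K * r ^ 2 := by
    have : (2 * M + 1) / r ^ 2 * r ^ 2 = 2 * M + 1 := by field_simp
    have : 0 ≤ |g₀| / (2 * lam) * r ^ 2 := by positivity
    rw [hK]; nlinarith
  have hK2 : |g₀| ≤ 2 * K * lam := by
    have h1 : |g₀| / (2 * lam) * (2 * lam) = |g₀| := by field_simp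
    have : 0 ≤ (2 * M + 1) / r ^ 2 * (2 * lam) := by positivity
    rw [hK]; nlinarith
  set Q : E → ℝ := fun x => M + 1 + K * r ^ 2 + -K * ‖x - x₀‖ ^ 2 with hQ
  have hQC : ContDiff ℝ 2 Q := contDiff_const.add (contDiff_const.mul (contDiff_norm_sub_sq x₀))
  have hQd : ∀ x w, d2 Q x w = -2 * K * ‖w‖ ^ 2 := fun x w => by
    have : Q = fun x => -K * ‖x - x₀‖ ^ 2 + (M + 1 + K * r ^ 2) := by funext x; simp only [hQ]; ring
    rw [this, d2_add_const, d2_const_mul, d2_norm_sub_sq]; ring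
  classical
  set w : E → ℝ := fun x => if x ∈ ball x₀ (2 * r) then min (v x - Q x) 0 else 0 with hw
  have hw0 : ∀ x, w x ≤ 0 := fun x => by
    simp only [hw]; split_ifs <;> simp
  have hwout : ∀ x, 3 / 2 * r ≤ ‖x - x₀‖ → w x = 0 := by
    intro x hx
    simp only [hw]
    split_ifs with hx'
    · refine min_eq_right ?_
      have h1 := (abs_le.1 (hM x (ball_subset_closedBall hx'))).1
      have h2 : (3 / 2 * r) ^ 2 ≤ ‖x - x₀‖ ^ 2 := by gcongr
      have h3 := mul_le_mul_of_nonneg_left h2 hK0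
      simp only [hQ]
      nlinarith
    · rfl
  have hwc : Continuous w := by
    rw [continuous_iff_continuousAt]
    intro x
    by_cases hx : x ∈ ball x₀ (2 * r)
    · have h1 : ContinuousAt (fun x => min (v x - Q x) 0) x := by
        refine ContinuousAt.inf (ContinuousAt.sub ?_ hQC.continuous.continuousAt) continuousAt_const
        exact hv.continuousAt (isOpen_ball.mem_nhds (hsub (ball_subset_closedBall hx)))
      refine h1.congr ?_
      filter_upwards [isOpen_ball.mem_nhds hx] with y hy
      simp only [hw, if_pos hy]
    · have h1 : 3 / 2 * r < ‖x - x₀‖ := by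
        rw [mem_ball, dist_eq_norm] at hx; linarith
      have h2 : ∀ᶠ y in 𝓝 x, 3 / 2 * r < ‖y - x₀‖ :=
        (continuous_id.sub continuous_const).norm.continuousAt.eventually (lt_mem_nhds h1)
      refine (continuousAt_const (y := (0 : ℝ))).congr ?_
      filter_upwards [h2] with y hy
      exact (hwout y hy.le).symm
  have hws : HasCompactSupport w := by
    refine HasCompactSupport.intro (isCompact_closedBall x₀ (3 / 2 * r)) fun x hx => hwout x ?_
    rw [mem_closedBall, dist_eq_norm] at hx
    linarith
  obtain ⟨W, hWC, hWw, hWL⟩ := exists_smooth_approx hwc hws hδ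
  refine ⟨fun x => Q x + W x, hQC.add hWC, fun x hx => ?_, fun x f hf => ?_⟩
  · have hx1 : x ∈ ball x₀ (2 * r) := closedBall_subset_ball (by linarith) hx
    have h1 : w x = v x - Q x := by
      simp only [hw, if_pos hx1]
      refine min_eq_left ?_
      have h1 := (abs_le.1 (hM x (ball_subset_closedBall hx1))).2
      have h2 : ‖x - x₀‖ ^ 2 ≤ r ^ 2 := by
        rw [mem_closedBall, dist_eq_norm] at hx; gcongr
      have h3 := mul_le_mul_of_nonneg_left h2 hK0
      simp only [hQ]
      nlinarith
    have h2 := hWw x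
    rw [h1] at h2
    rw [show Q x + W x - v x = W x - (v x - Q x) by ring]
    exact h2
  · have hfs := hf.le_sum_norm_sq hn
    have hsum : ∀ x, ∑ k, d2 Q x (f k) = -2 * K * ∑ k, ‖f k‖ ^ 2 := fun x => by
      rw [Finset.mul_sum]; exact Finset.sum_congr rfl fun k _ => hQd x _
    have hG : 0 ≤ 2 * K * ∑ k, ‖f k‖ ^ 2 - g₀ := by
      have := mul_le_mul_of_nonneg_left hfs (by linarith : 0 ≤ 2 * K)
      linarith [le_abs_self g₀]
    have key := hWL f _ hG (fun y φ hφ hmin => ?_) x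
    · have : ∑ k, d2 (fun x => Q x + W x) x (f k) = ∑ k, d2 Q x (f k) + ∑ k, d2 W x (f k) := by
        rw [← Finset.sum_add_distrib]
        exact Finset.sum_congr rfl fun k _ => d2_add hQC.contDiffAt hWC.contDiffAt _
      rw [this, hsum]
      linarith
    · rcases (hw0 y).lt_or_eq with hy | hy
      · have hyb : y ∈ ball x₀ (2 * r) := by
          by_contra h'
          simp only [hw, if_neg h'] at hy
          exact lt_irrefl _ hy
        have hyΩ := hsub (ball_subset_closedBall hyb)
        have hev : ∀ᶠ z in 𝓝 y, w z = v z - Q z := by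
          filter_upwards [isOpen_ball.mem_nhds hyb, hwc.continuousAt.eventually (gt_mem_nhds hy)]
            with z hz hz'
          simp only [hw, if_pos hz] at hz' ⊢
          refine min_eq_left ?_
          by_contra h'
          rw [min_eq_right (not_le.1 h').le] at hz'
          exact lt_irrefl _ hz'
        have h1 : IsLocalMin (fun z => v z - (Q z + φ z)) y := by
          refine hmin.congr ?_
          filter_upwards [hev] with z hz
          rw [hz]; ring
        have h2 := h.sum_le (hΩ hyΩ) (hQC.add hφ).contDiffAt h1 hf
        have : ∑ k, d2 (fun z => Q z + φ z) y (f k) = ∑ k, d2 Q y (f k) + ∑ k, d2 φ y (f k) := by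
          rw [← Finset.sum_add_distrib]
          exact Finset.sum_congr rfl fun k _ => d2_add hQC.contDiffAt hφ.contDiffAt _
        rw [this, hsum] at h2
        have := hg y hyΩ
        linarith
      · refine le_trans (Finset.sum_nonpos fun k _ => ?_) hG
        refine d2_nonpos_of_isLocalMax hφ.contDiffAt ?_ _
        filter_upwards [hmin] with z hz
        rw [hy] at hz
        linarith [hw0 z]

theorem PucciSubsol.sub {Ω : Set E} {u v f g : E → ℝ} (hu : PucciSubsol lam Lam Ω u f)
    (hv : PucciSupersol lam Lam Ω v g) (hn : 0 < n) (hlam : 0 < lam) (hLam : lam ≤ Lam)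
    (hΩ : IsOpen Ω) (huc : ContinuousOn u Ω) (hvc : ContinuousOn v Ω) (hf : ContinuousOn f Ω)
    (hg : ContinuousOn g Ω) :
    PucciSubsol lam Lam Ω (fun x => u x - v x) (fun x => f x - g x) := by
  intro x₀ hx₀ φ hφ hmax
  by_contra hneg
  set P := pucciMax lam Lam (hess φ x₀) with hP
  set ε : ℝ := -(P + (f x₀ - g x₀)) / 5 with hε
  have hε0 : 0 < ε := by rw [not_le] at hneg; rw [hε]; linarith
  have h1 : ∀ᶠ y in 𝓝 x₀, y ∈ Ω ∧ u y - v y - φ y ≤ u x₀ - v x₀ - φ x₀ ∧ f y ≤ f x₀ + ε ∧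
      g x₀ - ε ≤ g y ∧ ∀ w : Fin n → E, IsFrame lam Lam w →
        |∑ k, d2 φ y (w k) - ∑ k, d2 φ x₀ (w k)| ≤ ε := by
    filter_upwards [hΩ.mem_nhds hx₀, hmax, sum_d2_le_sum_d2_add_eventually hφ lam Lam hε0,
      (hf.continuousAt (hΩ.mem_nhds hx₀)).eventually (gt_mem_nhds (lt_add_of_pos_right _ hε0)),
      (hg.continuousAt (hΩ.mem_nhds hx₀)).eventually (lt_mem_nhds (sub_lt_self _ hε0))]
      with y h1 h2 h3 h4 h5
    exact ⟨h1, h2, h4.le, h5.le, h3⟩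
  obtain ⟨R, hR, H⟩ := Metric.eventually_nhds_iff_ball.1 h1
  set r := R / 3 with hr
  have hr0 : 0 < r := by positivity
  have hRr : 3 * r = R := by rw [hr]; ring
  have hLam0 : 0 < Lam := hlam.trans_le hLam
  have hn' : (0 : ℝ) < n := Nat.cast_pos.2 hn
  set η : ℝ := ε / (2 * (n * Lam)) with hη
  have hη0 : 0 < η := by positivity
  have hη1 : 2 * η * (n * Lam) = ε := by rw [hη]; field_simp
  set δ : ℝ := η * r ^ 2 / 4 with hδ
  have hδ0 : 0 < δ := by positivity
  have hsub : ball x₀ (3 * r) ⊆ Ω := by rw [hRr]; exact fun y hy => (H y hy).1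
  obtain ⟨V, hVC, hVv, hVL⟩ := hv.exists_smooth hn hlam hr0 hsub (hvc.mono hsub)
    (g₀ := g x₀ - ε) (fun y hy => (H y (by rwa [hRr] at hy)).2.2.2.1) hδ0
  have hcb : closedBall x₀ r ⊆ ball x₀ R := closedBall_subset_ball (by rw [hr]; linarith)
  obtain ⟨x₁, hx₁, hm⟩ := exists_isLocalMax_perturb (z := fun y => u y - v y - φ y)
    (z' := fun y => u y - V y - φ y) (η := η) (δ := δ) hr0
    (((huc.mono (hcb.trans (by rwa [hRr] at hsub))).sub hVC.continuous.continuousOn).sub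
      hφ.continuous.continuousOn) (fun y hy => (H y (hcb hy)).2.1)
    (fun y hy => by
      rw [show u y - V y - φ y - (u y - v y - φ y) = -(V y - v y) by ring, abs_neg]
      exact hVv y hy) (by rw [hδ]; nlinarith [pow_pos hr0 2])
  have hm' : IsLocalMax (fun y => u y - ((V y + φ y) + η * ‖y - x₀‖ ^ 2)) x₁ := by
    refine hm.congr (Eventually.of_forall fun y => ?_)
    simp only; ring
  have hx₁' := H x₁ (hcb (ball_subset_closedBall hx₁))
  have hqC : ContDiff ℝ 2 fun y : E => η * ‖y - x₀‖ ^ 2 :=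
    contDiff_const.mul (contDiff_norm_sub_sq x₀)
  obtain ⟨w, hw, hw'⟩ := hu.exists_frame hlam.le hLam hx₁'.1 ((hVC.add hφ).add hqC).contDiffAt hm'
  have e : ∑ k, d2 (fun y => (V y + φ y) + η * ‖y - x₀‖ ^ 2) x₁ (w k) =
      ∑ k, d2 V x₁ (w k) + ∑ k, d2 φ x₁ (w k) + 2 * η * ∑ k, ‖w k‖ ^ 2 := by
    rw [Finset.mul_sum, ← Finset.sum_add_distrib, ← Finset.sum_add_distrib]
    refine Finset.sum_congr rfl fun k _ => ?_
    rw [d2_add (hVC.add hφ).contDiffAt hqC.contDiffAt, d2_add hVC.contDiffAt hφ.contDiffAt,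
      d2_const_mul, d2_norm_sub_sq]
    ring
  rw [e] at hw'
  have k1 := hVL x₁ w hw
  have k2 := (abs_le.1 (hx₁'.2.2.2.2 w hw)).2
  have k3 := sum_d2_le_pucciMax hφ.contDiffAt hw (x := x₀)
  have k4 := mul_le_mul_of_nonneg_left hw.sum_norm_sq_le (by linarith : 0 ≤ 2 * η)
  rw [hη1] at k4
  have k5 := hx₁'.2.2.1
  rw [← hP] at k3
  have k6 : 5 * ε = -(P + (f x₀ - g x₀)) := by rw [hε]; ring
  linarith

end Viscosity

section Comparison

variable {n : ℕ} {lam Lam : ℝ}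

local notation "E" => EuclideanSpace ℝ (Fin n)

theorem PucciSupersol.neg {Ω : Set E} {u g : E → ℝ} (h : PucciSupersol lam Lam Ω u g)
    (hlam : 0 ≤ lam) (hLam : lam ≤ Lam) :
    PucciSubsol lam Lam Ω (fun x => -u x) (fun x => -g x) := by
  intro x hx φ hφ hmax
  obtain ⟨w, hw, e⟩ := exists_frame_pucciMax_eq hlam hLam hφ.contDiffAt (x := x)
  have hmin : IsLocalMin (fun y => u y - -φ y) x := by
    filter_upwards [hmax] with y hy
    linarith
  have h1 := h.sum_le hx hφ.neg.contDiffAt hmin hw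
  simp only [d2_neg, Finset.sum_neg_distrib] at h1
  rw [e]
  linarith

theorem PucciSubsol.mono {Ω Ω' : Set E} {u f f' : E → ℝ} (h : PucciSubsol lam Lam Ω u f)
    (hΩ : Ω' ⊆ Ω) (hf : ∀ x ∈ Ω', f x ≤ f' x) : PucciSubsol lam Lam Ω' u f' :=
  fun x hx φ hφ hm => by linarith [h x (hΩ hx) φ hφ hm, hf x hx]

theorem PucciSupersol.mono {Ω Ω' : Set E} {u f f' : E → ℝ} (h : PucciSupersol lam Lam Ω u f)
    (hΩ : Ω' ⊆ Ω) (hf : ∀ x ∈ Ω', f' x ≤ f x) : PucciSupersol lam Lam Ω' u f' :=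
  fun x hx φ hφ hm => by linarith [h x (hΩ hx) φ hφ hm, hf x hx]

theorem PucciSupersol.comp_isometry {Ω : Set E} {u g : E → ℝ} (h : PucciSupersol lam Lam Ω u g)
    (hlam : 0 ≤ lam) (hLam : lam ≤ Lam) (L : E ≃ₗᵢ[ℝ] E) (b : E) :
    PucciSupersol lam Lam {x | L x + b ∈ Ω} (fun x => u (L x + b)) (fun x => g (L x + b)) := by
  intro x hx φ hφ hmin
  obtain ⟨w, hw, e⟩ := exists_frame_pucciMax_eq hlam hLam hφ.contDiffAt (x := x)
  have hC : ContDiff ℝ 2 fun y : E => φ (L.symm (y - b)) :=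
    hφ.comp (L.symm.contDiff.comp (contDiff_id.sub contDiff_const))
  have hw' : IsFrame lam Lam fun k => L (w k) := by
    intro ξ
    have h1 : ∀ k, ⟪L (w k), ξ⟫ = ⟪w k, L.symm ξ⟫ := fun k => by
      rw [← L.inner_map_map (w k) (L.symm ξ), L.apply_symm_apply]
    simp only [h1]
    have := hw (L.symm ξ)
    rwa [L.symm.norm_map] at this
  have hmin' : IsLocalMin (fun y => u y - φ (L.symm (y - b))) (L x + b) := by
    have hc : Tendsto (fun y => L.symm (y - b)) (𝓝 (L x + b)) (𝓝 x) := by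
      have h2 : Continuous fun y => L.symm (y - b) := by fun_prop
      simpa using h2.tendsto (L x + b)
    filter_upwards [hc.eventually hmin] with y hy
    simpa using hy
  have key := h.sum_le hx hC.contDiffAt hmin' hw'
  have hd : ∀ v, d2 (fun y => φ (L.symm (y - b))) (L x + b) (L v) = d2 φ x v := by
    intro v
    simp only [d2]
    congr 2
    funext t
    congr 1
    have : L x + b + t • L v - b = L (x + t • v) := by rw [map_add, map_smul]; abel
    rw [this, L.symm_apply_apply]
  simp only [hd] at key
  rw [e]
  exact key

theorem PucciSubsol.le_of_frontier {D : Set E} {z ψ h : E → ℝ} (hz : PucciSubsol lam Lam D z h)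
    (hlam : 0 ≤ lam) (hLam : lam ≤ Lam) (hD : IsOpen D) (hzc : ContinuousOn z (closure D))
    (hψ : ContDiff ℝ 2 ψ) {C : ℝ} (hC : ∀ x ∈ D, z x - ψ x ≤ C)
    (hfr : ∀ x ∈ frontier D, z x ≤ ψ x) {δ : ℝ} (hδ : 0 < δ)
    (hs : ∀ x ∈ D, ψ x < z x → ∀ w : Fin n → E, IsFrame lam Lam w →
      ∑ k, d2 ψ x (w k) + h x ≤ -δ) : ∀ x ∈ D, z x ≤ ψ x := by
  intro y hy
  by_contra hlt
  rw [not_le] at hlt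
  have hLam0 : 0 ≤ Lam := hlam.trans hLam
  set ε : ℝ := δ / (4 * (n * Lam + 1)) with hε
  have hε0 : 0 < ε := by positivity
  have hε1 : 2 * ε * (n * Lam) < δ := by
    have : ε * (4 * (n * Lam + 1)) = δ := by rw [hε]; field_simp
    have : 0 ≤ n * Lam := by positivity
    nlinarith
  set R : ℝ := √((|C| + 1) / ε) with hR
  have hR2 : ε * R ^ 2 = |C| + 1 := by
    rw [hR, Real.sq_sqrt (by positivity)]; field_simp
  have hR0 : 0 < R := Real.sqrt_pos.2 (by positivity)
  have hK : IsCompact (closure D ∩ closedBall y R) :=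
    (isCompact_closedBall y R).inter_left isClosed_closure
  have hcont : ContinuousOn (fun x => z x - ψ x - ε * ‖x - y‖ ^ 2) (closure D) :=
    (hzc.sub hψ.continuous.continuousOn).sub (by fun_prop)
  obtain ⟨x, hx, hmax⟩ := hK.exists_isMaxOn ⟨y, subset_closure hy, mem_closedBall_self hR0.le⟩
    (hcont.mono inter_subset_left)
  have hpos : 0 < z x - ψ x - ε * ‖x - y‖ ^ 2 := by
    have : z y - ψ y - ε * ‖y - y‖ ^ 2 ≤ z x - ψ x - ε * ‖x - y‖ ^ 2 :=
      hmax ⟨subset_closure hy, mem_closedBall_self hR0.le⟩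
    simp only [sub_self, norm_zero] at this
    linarith
  have hq : 0 ≤ ε * ‖x - y‖ ^ 2 := by positivity
  have hxD : x ∈ D := by
    by_contra hxD
    have := hfr x ⟨hx.1, fun h' => hxD (interior_subset h')⟩
    linarith
  have hxb : x ∈ ball y R := by
    by_contra hxb
    have h1 : R ≤ ‖x - y‖ := by rw [← dist_eq_norm]; exact not_lt.1 fun h => hxb (mem_ball.2 h)
    have h2 : R ^ 2 ≤ ‖x - y‖ ^ 2 := by gcongr
    have h3 := hC x hxD
    nlinarith [le_abs_self C]
  have hloc : IsLocalMax (fun x => z x - (ψ x + ε * ‖x - y‖ ^ 2)) x := by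
    have h1 := hmax.isLocalMax (mem_of_superset ((hD.inter isOpen_ball).mem_nhds ⟨hxD, hxb⟩)
      (inter_subset_inter subset_closure ball_subset_closedBall))
    refine h1.congr (Eventually.of_forall fun t => ?_)
    simp only; ring
  have hqC : ContDiff ℝ 2 fun x : E => ε * ‖x - y‖ ^ 2 :=
    contDiff_const.mul (contDiff_norm_sub_sq y)
  obtain ⟨w, hw, hw'⟩ := hz.exists_frame hlam hLam hxD (hψ.add hqC).contDiffAt hloc
  have e : ∑ k, d2 (fun x => ψ x + ε * ‖x - y‖ ^ 2) x (w k) =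
      ∑ k, d2 ψ x (w k) + 2 * ε * ∑ k, ‖w k‖ ^ 2 := by
    rw [Finset.mul_sum, ← Finset.sum_add_distrib]
    refine Finset.sum_congr rfl fun k _ => ?_
    rw [d2_add hψ.contDiffAt hqC.contDiffAt, d2_const_mul, d2_norm_sub_sq]
    ring
  rw [e] at hw'
  have k1 := hs x hxD (by linarith) w hw
  have k2 := mul_le_mul_of_nonneg_left hw.sum_norm_sq_le (by linarith : 0 ≤ 2 * ε)
  linarith

theorem PucciSupersol.le_of_frontier {ι : Type*} [Fintype ι] {D : Set E} {v φ g : E → ℝ}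
    (hv : PucciSupersol lam Lam D v g)
    (hlam : 0 ≤ lam) (hLam : lam ≤ Lam) (hD : IsOpen D) (hvc : ContinuousOn v (closure D))
    (hφc : ContinuousOn φ (closure D)) (hφ : ∀ x ∈ D, ContDiffAt ℝ 2 φ x)
    {C : ℝ} (hC : ∀ x ∈ D, φ x - v x ≤ C)
    (hfr : ∀ x ∈ frontier D, φ x ≤ v x) {δ : ℝ} (hδ : 0 < δ)
    (hs : ∀ x ∈ D, v x < φ x → ∃ w : ι → E, IsFrame lam Lam w ∧
      δ ≤ ∑ k, d2 φ x (w k) + g x) : ∀ x ∈ D, φ x ≤ v x := by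
  intro y hy
  by_contra hlt
  rw [not_le] at hlt
  have hLam0 : 0 ≤ Lam := hlam.trans hLam
  set ε : ℝ := δ / (4 * (n * Lam + 1)) with hε
  have hε0 : 0 < ε := by positivity
  have hε1 : 2 * ε * (n * Lam) < δ := by
    have : ε * (4 * (n * Lam + 1)) = δ := by rw [hε]; field_simp
    have : 0 ≤ n * Lam := by positivity
    nlinarith
  set R : ℝ := √((|C| + 1) / ε) with hR
  have hR2 : ε * R ^ 2 = |C| + 1 := by
    rw [hR, Real.sq_sqrt (by positivity)]; field_simp
  have hR0 : 0 < R := Real.sqrt_pos.2 (by positivity)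
  have hK : IsCompact (closure D ∩ closedBall y R) :=
    (isCompact_closedBall y R).inter_left isClosed_closure
  have hcont : ContinuousOn (fun x => φ x - v x - ε * ‖x - y‖ ^ 2) (closure D) :=
    (hφc.sub hvc).sub (by fun_prop)
  obtain ⟨x, hx, hmax⟩ := hK.exists_isMaxOn ⟨y, subset_closure hy, mem_closedBall_self hR0.le⟩
    (hcont.mono inter_subset_left)
  have hpos : 0 < φ x - v x - ε * ‖x - y‖ ^ 2 := by
    have : φ y - v y - ε * ‖y - y‖ ^ 2 ≤ φ x - v x - ε * ‖x - y‖ ^ 2 :=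
      hmax ⟨subset_closure hy, mem_closedBall_self hR0.le⟩
    simp only [sub_self, norm_zero] at this
    linarith
  have hq : 0 ≤ ε * ‖x - y‖ ^ 2 := by positivity
  have hxD : x ∈ D := by
    by_contra hxD
    have := hfr x ⟨hx.1, fun h' => hxD (interior_subset h')⟩
    linarith
  have hxb : x ∈ ball y R := by
    by_contra hxb
    have h1 : R ≤ ‖x - y‖ := by rw [← dist_eq_norm]; exact not_lt.1 fun h => hxb (mem_ball.2 h)
    have h2 : R ^ 2 ≤ ‖x - y‖ ^ 2 := by gcongr
    have h3 := hC x hxD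
    nlinarith [le_abs_self C]
  have hqC : ContDiff ℝ 2 fun x : E => -ε * ‖x - y‖ ^ 2 :=
    contDiff_const.mul (contDiff_norm_sub_sq y)
  have hloc : IsLocalMin (fun x => v x - (φ x + -ε * ‖x - y‖ ^ 2)) x := by
    have h1 := hmax.isLocalMax (mem_of_superset ((hD.inter isOpen_ball).mem_nhds ⟨hxD, hxb⟩)
      (inter_subset_inter subset_closure ball_subset_closedBall))
    filter_upwards [h1] with t ht
    linarith
  obtain ⟨w, hw, hw'⟩ := hs x hxD (by linarith)
  have k1 := hv.sum_le hxD ((hφ x hxD).add hqC.contDiffAt) hloc hw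
  have e : ∑ k, d2 (fun x => φ x + -ε * ‖x - y‖ ^ 2) x (w k) =
      ∑ k, d2 φ x (w k) - 2 * ε * ∑ k, ‖w k‖ ^ 2 := by
    rw [Finset.mul_sum, ← Finset.sum_sub_distrib]
    refine Finset.sum_congr rfl fun k _ => ?_
    rw [d2_add (hφ x hxD) hqC.contDiffAt, d2_const_mul, d2_norm_sub_sq]
    ring
  rw [e] at k1
  have k2 := mul_le_mul_of_nonneg_left hw.sum_norm_sq_le (by linarith : 0 ≤ 2 * ε)
  linarith

/-- Reflection across the hyperplane `⟪x, ν⟫ = c`, for a unit vector `ν`. -/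
noncomputable def planeReflection (ν : E) (c : ℝ) (x : E) : E := x - (2 * (⟪x, ν⟫ - c)) • ν

theorem continuous_planeReflection (ν : E) (c : ℝ) : Continuous (planeReflection ν c) := by
  unfold planeReflection; fun_prop

theorem exists_planeReflection_eq {ν : E} (hν : ‖ν‖ = 1) (c : ℝ) :
    ∃ (L : E ≃ₗᵢ[ℝ] E) (b : E), ∀ x, planeReflection ν c x = L x + b := by
  refine ⟨(ℝ ∙ ν)ᗮ.reflection, (2 * c) • ν, fun x => ?_⟩
  rw [Submodule.reflection_orthogonal_apply, Submodule.reflection_singleton_apply,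
    planeReflection, hν, real_inner_comm]
  simp only [RCLike.ofReal_real_eq_id, id]
  module

theorem PucciSupersol.comp_planeReflection {Ω : Set E} {u g : E → ℝ}
    (h : PucciSupersol lam Lam Ω u g) (hlam : 0 ≤ lam) (hLam : lam ≤ Lam) {ν : E} (hν : ‖ν‖ = 1)
    (c : ℝ) : PucciSupersol lam Lam {x | planeReflection ν c x ∈ Ω}
      (fun x => u (planeReflection ν c x)) (fun x => g (planeReflection ν c x)) := by
  obtain ⟨L, b, e⟩ := exists_planeReflection_eq hν c
  simp only [e]
  exact h.comp_isometry hlam hLam L b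

theorem PucciSupersol.comp_add_right {Ω : Set E} {u g : E → ℝ}
    (h : PucciSupersol lam Lam Ω u g) (hlam : 0 ≤ lam) (hLam : lam ≤ Lam) (b : E) :
    PucciSupersol lam Lam {x | x + b ∈ Ω} (fun x => u (x + b)) (fun x => g (x + b)) :=
  h.comp_isometry hlam hLam (LinearIsometryEquiv.refl ℝ E) b

end Comparison

section Spread

variable {n : ℕ} {lam Lam : ℝ}

local notation "E" => EuclideanSpace ℝ (Fin n)

variable (n) in
/-- Expansion of positivity for nonnegative functions `w` with `M⁻(D²w) ≤ 0`. -/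
theorem exists_spread (hlam : 0 < lam) (hLam : lam ≤ Lam) :
    ∃ κ : ℝ, 0 < κ ∧ κ ≤ 1 ∧ ∀ (y : E) (r a : ℝ) (w : E → ℝ), 0 < r → 0 ≤ a →
      ContinuousOn w (closedBall y (2 * r)) → (∀ x ∈ closedBall y (2 * r), 0 ≤ w x) →
      PucciSubsol lam Lam (ball y (2 * r)) (fun x => -w x) (fun _ => 0) →
      (∀ x ∈ closedBall y (r / 2), a ≤ w x) → ∀ x ∈ closedBall y (3 / 2 * r), κ * a ≤ w x := by
  have hLam0 : 0 < Lam := hlam.trans_le hLam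
  set β : ℝ := (2 * (n * Lam) + 1) / lam with hβ
  have hβ0 : 0 < β := by positivity
  have hβ1 : β * lam = 2 * (n * Lam) + 1 := by rw [hβ]; field_simp
  set κ : ℝ := Real.exp (-β * (9 / 4)) - Real.exp (-β * 4) with hκ
  have hκ0 : 0 < κ := sub_pos.2 (Real.exp_lt_exp.2 (by nlinarith))
  have hκ1 : κ ≤ 1 := by
    have : Real.exp (-β * (9 / 4)) ≤ 1 := Real.exp_le_one_iff.2 (by nlinarith)
    linarith [Real.exp_pos (-β * 4)]
  refine ⟨κ, hκ0, hκ1, fun y r a w hr ha hwc hw0 hws hwa x hx => ?_⟩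
  have hxr : ‖x - y‖ ≤ 3 / 2 * r := by rwa [mem_closedBall, dist_eq_norm] at hx
  rcases ha.eq_or_lt with rfl | ha
  · rw [mul_zero]; exact hw0 x (closedBall_subset_closedBall (by linarith) hx)
  by_cases hx2 : x ∈ closedBall y (r / 2)
  · exact (mul_le_of_le_one_left ha.le hκ1).trans (hwa x hx2)
  set q : E → ℝ := fun x => (1 / r ^ 2) * ‖x - y‖ ^ 2 with hq
  have hqC : ContDiff ℝ 2 q := contDiff_const.mul (contDiff_norm_sub_sq y)
  set D : Set E := ball y (2 * r) \ closedBall y (r / 2) with hD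
  have hDo : IsOpen D := isOpen_ball.sdiff isClosed_closedBall
  set ψ : E → ℝ := fun x => -a * Real.exp (-β * q x) + a * Real.exp (-β * 4) with hψ
  have hψC : ContDiff ℝ 2 ψ :=
    (contDiff_const.mul (Real.contDiff_exp.comp (contDiff_const.mul hqC))).add contDiff_const
  have hcl : closure D ⊆ closedBall y (2 * r) :=
    closure_minimal (sdiff_subset.trans ball_subset_closedBall) isClosed_closedBall
  have hq4 : ∀ x ∈ closedBall y (2 * r), q x ≤ 4 := by
    intro x hx
    rw [mem_closedBall, dist_eq_norm] at hx
    have : ‖x - y‖ ^ 2 ≤ (2 * r) ^ 2 := by gcongr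
    simp only [hq]
    rw [one_div_mul_eq_div, div_le_iff₀ (by positivity)]
    linarith
  have hmain := hws.mono (Ω' := D) (f' := fun _ => 0) sdiff_subset fun _ _ => le_rfl
  have key := hmain.le_of_frontier hlam.le hLam hDo (hwc.mono hcl).neg hψC (C := a)
    (δ := a * (Real.exp (-β * 4) * (β / r ^ 2))) ?_ ?_ (by positivity) ?_ x ?_
  · simp only [hψ] at key
    have h1 : q x ≤ 9 / 4 := by
      have : ‖x - y‖ ^ 2 ≤ (3 / 2 * r) ^ 2 := by gcongr
      simp only [hq]
      rw [one_div_mul_eq_div, div_le_iff₀ (by positivity)]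
      linarith
    have h2 : Real.exp (-β * (9 / 4)) ≤ Real.exp (-β * q x) :=
      Real.exp_le_exp.2 (by nlinarith)
    have h3 := mul_le_mul_of_nonneg_left h2 ha.le
    rw [hκ]
    linarith
  · intro z hz
    have h1 := hw0 z (ball_subset_closedBall hz.1)
    have h2 : Real.exp (-β * q z) ≤ 1 := Real.exp_le_one_iff.2 (by
      have : 0 ≤ q z := by simp only [hq]; positivity
      nlinarith)
    have h3 := mul_le_mul_of_nonneg_left h2 ha.le
    simp only [hψ]
    have : 0 ≤ a * Real.exp (-β * 4) := by positivity
    linarith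
  · intro z hz
    rw [hDo.frontier_eq] at hz
    have hz1 := hcl hz.1
    by_cases hz2 : z ∈ closedBall y (r / 2)
    · have h1 := hwa z hz2
      have h2 : Real.exp (-β * q z) ≤ 1 := Real.exp_le_one_iff.2 (by
        have : 0 ≤ q z := by simp only [hq]; positivity
        nlinarith)
      have h3 := mul_le_mul_of_nonneg_left h2 ha.le
      have : 0 ≤ a * Real.exp (-β * 4) := by positivity
      simp only [hψ]
      linarith
    · have hz3 : z ∉ ball y (2 * r) := fun h => hz.2 ⟨h, hz2⟩
      have h4 : ‖z - y‖ = 2 * r := by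
        rw [← dist_eq_norm]
        exact le_antisymm (mem_closedBall.1 hz1) (not_lt.1 fun h => hz3 (mem_ball.2 h))
      have h5 : q z = 4 := by
        simp only [hq, h4]; field_simp; ring
      simp only [hψ, h5]
      linarith [hw0 z hz1]
  · intro z hz _ v hv
    have hz1 := hq4 z (ball_subset_closedBall hz.1)
    have hz2 : 1 / 4 ≤ q z := by
      have h1 : r / 2 < ‖z - y‖ := by
        rw [← dist_eq_norm]; exact not_le.1 hz.2
      have : (r / 2) ^ 2 ≤ ‖z - y‖ ^ 2 := by gcongr
      simp only [hq]
      rw [one_div_mul_eq_div, le_div_iff₀ (by positivity)]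
      linarith
    have hd : ∀ u : E, d2 ψ z u = -a * (Real.exp (-β * q z) * (β / r ^ 2 *
        ((4 * β / r ^ 2) * ⟪u, z - y⟫ ^ 2 - 2 * ‖u‖ ^ 2))) := by
      intro u
      have e1 : ∀ s : ℝ, q (z + s • u) = q z + (2 * ⟪u, z - y⟫ / r ^ 2) * s +
          (‖u‖ ^ 2 / r ^ 2) * s ^ 2 := by
        intro s
        simp only [hq]
        rw [show z + s • u - y = (z - y) + s • u by abel, norm_add_sq_real, inner_smul_right,
          norm_smul, mul_pow, Real.norm_eq_abs, sq_abs, real_inner_comm]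
        ring
      have hE : ∀ s : ℝ, HasDerivAt (fun s => Real.exp (-β * s)) (-β * Real.exp (-β * s)) s := by
        intro s
        have := (((hasDerivAt_id s).const_mul (-β)).exp)
        refine this.congr_deriv ?_
        simp; ring
      have h1 := d2_comp (H := fun s => Real.exp (-β * s)) (H' := fun s => -β * Real.exp (-β * s))
        (H'' := -β * (-β * Real.exp (-β * q z))) (Eventually.of_forall hE)
        ((hE (q z)).const_mul (-β)) e1
      rw [hψ, d2_add_const, d2_const_mul, h1]
      field_simp
      ring
    simp only [hd]
    rw [← Finset.mul_sum, ← Finset.mul_sum, ← Finset.mul_sum, Finset.sum_sub_distrib,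
      ← Finset.mul_sum, ← Finset.mul_sum]
    have h2 := (hv (z - y)).1
    have h3 := hv.sum_norm_sq_le
    have h4 : 4 * β / r ^ 2 * (lam * ‖z - y‖ ^ 2) = 4 * (β * lam) * q z := by
      simp only [hq]; field_simp
    have h5 := mul_le_mul_of_nonneg_left h2 (show 0 ≤ 4 * β / r ^ 2 by positivity)
    rw [h4, hβ1] at h5
    have h6 : 1 ≤ 4 * β / r ^ 2 * ∑ k, ⟪v k, z - y⟫ ^ 2 - 2 * ∑ k, ‖v k‖ ^ 2 := by
      have : 0 ≤ n * Lam := by positivity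
      nlinarith
    have h7 : Real.exp (-β * 4) ≤ Real.exp (-β * q z) := Real.exp_le_exp.2 (by nlinarith)
    have h8 : Real.exp (-β * 4) * (β / r ^ 2) ≤ Real.exp (-β * q z) * (β / r ^ 2 *
        (4 * β / r ^ 2 * ∑ k, ⟪v k, z - y⟫ ^ 2 - 2 * ∑ k, ‖v k‖ ^ 2)) := by
      refine mul_le_mul h7 ?_ (by positivity) (by positivity)
      exact le_mul_of_one_le_right (by positivity) h6
    have h9 := mul_le_mul_of_nonneg_left h8 ha.le
    linarith
  · exact ⟨mem_ball.2 (by rw [dist_eq_norm]; linarith), hx2⟩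

variable (n) in
theorem exists_chain (hlam : 0 < lam) (hLam : lam ≤ Lam) :
    ∃ κ : ℝ, 0 < κ ∧ ∀ (Ω : Set E) (w : E → ℝ) (y z : E) (r a : ℝ) (m : ℕ), 0 < r → 0 ≤ a →
      ContinuousOn w Ω → (∀ x ∈ Ω, 0 ≤ w x) → PucciSubsol lam Lam Ω (fun x => -w x) (fun _ => 0) →
      (∀ t ∈ Icc (0 : ℝ) 1, closedBall (y + t • (z - y)) (2 * r) ⊆ Ω) → ‖z - y‖ ≤ m * r →
      (∀ x ∈ closedBall y (r / 2), a ≤ w x) → κ ^ m * a ≤ w z := by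
  obtain ⟨κ, hκ0, hκ1, H⟩ := exists_spread n hlam hLam
  refine ⟨κ, hκ0, fun Ω w y z r a m hr ha hwc hw0 hws hΩ hm hwa => ?_⟩
  rcases Nat.eq_zero_or_pos m with rfl | hm0
  · have : z = y := by
      rw [Nat.cast_zero, zero_mul] at hm
      exact sub_eq_zero.1 (norm_eq_zero.1 (le_antisymm hm (norm_nonneg _)))
    rw [this, pow_zero, one_mul]
    exact hwa y (mem_closedBall_self (by linarith))
  have hmp : (0 : ℝ) < m := Nat.cast_pos.2 hm0
  have step : ∀ i : ℕ, i ≤ m → ∀ x ∈ closedBall (y + ((i : ℝ) / m) • (z - y)) (r / 2),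
      κ ^ i * a ≤ w x := by
    intro i
    induction i with
    | zero => intro _ x hx; simpa using hwa x (by simpa using hx)
    | succ i ih =>
      intro hi x hx
      have hi' : ((i : ℝ) / m) ∈ Icc (0 : ℝ) 1 :=
        ⟨by positivity, (div_le_one hmp).2 (by exact_mod_cast (Nat.le_of_succ_le hi))⟩
      have h1 := hΩ _ hi'
      have h2 := H (y + ((i : ℝ) / m) • (z - y)) r (κ ^ i * a) w hr (by positivity) (hwc.mono h1)
        (fun x hx => hw0 x (h1 hx))
        (hws.mono (ball_subset_closedBall.trans h1) fun _ _ => le_rfl)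
        (ih (Nat.le_of_succ_le hi)) x ?_
      · rw [pow_succ']; linarith
      · rw [mem_closedBall, dist_eq_norm] at hx ⊢
        have e : x - (y + ((i : ℝ) / m) • (z - y)) =
            (x - (y + (((i + 1 : ℕ) : ℝ) / m) • (z - y))) + (1 / (m : ℝ)) • (z - y) := by
          push_cast; module
        rw [e]
        refine (norm_add_le _ _).trans ?_
        rw [norm_smul, Real.norm_of_nonneg (by positivity : 0 ≤ 1 / (m : ℝ))]
        have : 1 / (m : ℝ) * ‖z - y‖ ≤ r := by
          rw [one_div_mul_eq_div, div_le_iff₀ hmp]; linarith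
        linarith
  have := step m le_rfl z (by
    rw [div_self hmp.ne', one_smul, add_sub_cancel]
    exact mem_closedBall_self (by linarith))
  exact this

end Spread

section Lipschitz

variable {n : ℕ} {lam Lam : ℝ}

local notation "E" => EuclideanSpace ℝ (Fin n)

/-- `U` is a nonnegative viscosity solution bounded by `M` in the half space `{0 < ⟪x, e⟫}`,
extended continuously by zero to the whole space. -/
structure IsHalfSpaceSol (lam Lam p M : ℝ) (e : E) (U : E → ℝ) : Prop where
  dim_pos : 0 < n
  lam_pos : 0 < lam
  lam_le : lam ≤ Lam
  one_lt : 1 < p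
  norm_e : ‖e‖ = 1
  one_le : 1 ≤ M
  cont : Continuous U
  nonneg : ∀ x, 0 ≤ U x
  le : ∀ x, U x ≤ M
  zero : ∀ x, ⟪x, e⟫ ≤ 0 → U x = 0
  supersol : PucciSupersol lam Lam {x | 0 < ⟪x, e⟫} U (fun x => U x ^ p)
  subsol : PucciSubsol lam Lam {x | 0 < ⟪x, e⟫} U (fun x => U x ^ p)

theorem inner_planeReflection (ν : E) (c : ℝ) (x w : E) :
    ⟪planeReflection ν c x, w⟫ = ⟪x, w⟫ - 2 * (⟪x, ν⟫ - c) * ⟪ν, w⟫ := by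
  rw [planeReflection, inner_sub_left, inner_smul_left]; rfl

theorem PucciSubsol.le_of_slab {D : Set E} {z h : E → ℝ} (hz : PucciSubsol lam Lam D z h)
    (hlam : 0 < lam) (hLam : lam ≤ Lam) (hD : IsOpen D) (hzc : Continuous z) {ν : E}
    (hν : ‖ν‖ = 1) {c C C₁ K : ℝ} (hDs : ∀ x ∈ D, 0 < ⟪x, ν⟫ - c ∧ ⟪x, ν⟫ - c < 1)
    (hC : 0 ≤ C) (hh : ∀ x ∈ D, 0 < z x → h x ≤ C) (hK : 0 ≤ K) (hz1 : ∀ x ∈ D, z x ≤ C₁)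
    (hfr : ∀ x ∈ frontier D, z x ≤ K * (⟪x, ν⟫ - c)) :
    ∀ x ∈ D, z x ≤ (K + (C + 1) / (2 * lam)) * (⟪x, ν⟫ - c) := by
  set B : ℝ := (C + 1) / (2 * lam) with hB
  have hB0 : 0 < B := by positivity
  have hB1 : 2 * B * lam = C + 1 := by rw [hB]; field_simp
  have hℓ : Continuous fun x : E => ⟪x, ν⟫ - c := by fun_prop
  have hcl : ∀ x ∈ closure D, 0 ≤ ⟪x, ν⟫ - c ∧ ⟪x, ν⟫ - c ≤ 1 := by
    refine closure_minimal (t := {x | 0 ≤ ⟪x, ν⟫ - c ∧ ⟪x, ν⟫ - c ≤ 1})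
      (fun x hx => ⟨(hDs x hx).1.le, (hDs x hx).2.le⟩) ?_
    exact (isClosed_le continuous_const hℓ).inter (isClosed_le hℓ continuous_const)
  set ψ : E → ℝ := fun x => (K + B) * (⟪x, ν⟫ - c) + -B * (⟪x, ν⟫ - c) ^ 2 with hψ
  have hψC : ContDiff ℝ 2 ψ := by
    have h1 : ContDiff ℝ 2 fun x : E => ⟪x, ν⟫ - c :=
      (contDiff_id.inner ℝ contDiff_const).sub contDiff_const
    exact (contDiff_const.mul h1).add (contDiff_const.mul (h1.pow 2))
  have key := hz.le_of_frontier hlam.le hLam hD hzc.continuousOn hψC (C := C₁) (δ := 1) ?_ ?_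
    one_pos ?_
  · intro x hx
    have := key x hx
    simp only [hψ] at this
    nlinarith [sq_nonneg (⟪x, ν⟫ - c)]
  · intro x hx
    obtain ⟨h1, h2⟩ := hDs x hx
    have : 0 ≤ ψ x := by
      simp only [hψ]
      nlinarith [mul_nonneg hK h1.le, mul_nonneg hB0.le (mul_nonneg h1.le (sub_nonneg.2 h2.le))]
    linarith [hz1 x hx]
  · intro x hx
    obtain ⟨h1, h2⟩ := hcl x (frontier_subset_closure hx)
    simp only [hψ]
    nlinarith [hfr x hx, mul_nonneg hB0.le (mul_nonneg h1 (sub_nonneg.2 h2))]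
  · intro x hx hlt w hw
    obtain ⟨h1, h2⟩ := hDs x hx
    have hψ0 : 0 ≤ ψ x := by
      simp only [hψ]
      nlinarith [mul_nonneg hK h1.le, mul_nonneg hB0.le (mul_nonneg h1.le (sub_nonneg.2 h2.le))]
    have hd : ∀ v : E, d2 ψ x v = -(2 * B) * ⟪v, ν⟫ ^ 2 := by
      intro v
      rw [d2_quadratic (b := (K + B) * ⟪v, ν⟫ - 2 * B * (⟪x, ν⟫ - c) * ⟪v, ν⟫)
        (c := -B * ⟪v, ν⟫ ^ 2)]
      · ring
      · intro s
        simp only [hψ, inner_add_left, inner_smul_left]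
        simp only [conj_trivial]
        ring
    simp only [hd, ← Finset.mul_sum]
    have h3 := (hw ν).1
    rw [hν] at h3
    have h4 := hh x hx (hψ0.trans_lt hlt)
    nlinarith

variable {p M : ℝ} {e : EuclideanSpace ℝ (Fin n)} {U : EuclideanSpace ℝ (Fin n) → ℝ}

namespace IsHalfSpaceSol

theorem isOpen_halfSpace (e : E) : IsOpen {x : E | 0 < ⟪x, e⟫} :=
  isOpen_lt continuous_const (by fun_prop)

theorem continuous_rpow (hU : IsHalfSpaceSol lam Lam p M e U) : Continuous fun x => U x ^ p :=
  hU.cont.rpow_const fun _ => Or.inr (by linarith [hU.one_lt])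

theorem rpow_nonneg (hU : IsHalfSpaceSol lam Lam p M e U) (x : E) : 0 ≤ U x ^ p :=
  Real.rpow_nonneg (hU.nonneg x) p

theorem rpow_le (hU : IsHalfSpaceSol lam Lam p M e U) (x : E) : U x ^ p ≤ M ^ p :=
  Real.rpow_le_rpow (hU.nonneg x) (hU.le x) (by linarith [hU.one_lt])

theorem exists_le_mul_inner (hU : IsHalfSpaceSol lam Lam p M e U) :
    ∃ K : ℝ, M ≤ K ∧ ∀ x, 0 ≤ ⟪x, e⟫ → U x ≤ K * ⟪x, e⟫ := by
  have hlam := hU.lam_pos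
  have hM := hU.one_le
  have hMp : 0 ≤ M ^ p := Real.rpow_nonneg (by linarith) p
  have hB : 0 < (M ^ p + 1) / (2 * lam) := by positivity
  refine ⟨M + (M ^ p + 1) / (2 * lam), by linarith, fun x hx => ?_⟩
  have hDo : IsOpen {x : E | 0 < ⟪x, e⟫ ∧ ⟪x, e⟫ < 1} :=
    (isOpen_halfSpace e).inter
      (isOpen_lt (f := fun x : E => ⟪x, e⟫) (by fun_prop) continuous_const)
  have hz := hU.subsol.mono (Ω' := {x : E | 0 < ⟪x, e⟫ ∧ ⟪x, e⟫ < 1}) (fun x hx => hx.1)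
    fun x _ => le_rfl
  have key := hz.le_of_slab hlam hU.lam_le hDo hU.cont hU.norm_e (c := 0) (C := M ^ p) (C₁ := M)
    (K := M) (fun x hx => by simpa using hx) hMp (fun x _ _ => hU.rpow_le x) (by linarith)
    (fun x _ => hU.le x) ?_
  · simp only [sub_zero] at key
    rcases hx.eq_or_lt with h0 | h0
    · rw [← h0, hU.zero x h0.ge, mul_zero]
    · by_cases h1 : ⟪x, e⟫ < 1
      · exact key x ⟨h0, h1⟩
      · nlinarith [hU.le x]
  · intro x hx
    rw [sub_zero]
    rw [hDo.frontier_eq] at hx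
    have hcl : 0 ≤ ⟪x, e⟫ := by
      refine closure_minimal (t := {x : E | 0 ≤ ⟪x, e⟫}) (fun x hx => hx.1.le)
        (isClosed_le continuous_const (by fun_prop)) hx.1
    rcases hcl.eq_or_lt with h0 | h0
    · rw [← h0, hU.zero x h0.ge, mul_zero]
    · have h1 : ¬ ⟪x, e⟫ < 1 := fun h => hx.2 ⟨h0, h⟩
      nlinarith [hU.le x]

/-- The difference of a solution and its reflection in the plane `{⟪x, ν⟫ = c}`. -/
theorem subsol_sub_reflection (hU : IsHalfSpaceSol lam Lam p M e U) {ν : E} (hν : ‖ν‖ = 1)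
    (c : ℝ) {D : Set E} (hD : IsOpen D) (h1 : ∀ x ∈ D, 0 < ⟪x, e⟫)
    (h2 : ∀ x ∈ D, 0 < ⟪planeReflection ν c x, e⟫) :
    PucciSubsol lam Lam D (fun x => U x - U (planeReflection ν c x))
      (fun x => U x ^ p - U (planeReflection ν c x) ^ p) := by
  have hR := continuous_planeReflection ν c
  exact (hU.subsol.mono (Ω' := D) h1 fun _ _ => le_rfl).sub
    ((hU.supersol.comp_planeReflection hU.lam_pos.le hU.lam_le hν c).mono h2 fun _ _ => le_rfl)
    hU.dim_pos hU.lam_pos hU.lam_le hD hU.cont.continuousOn (hU.cont.comp hR).continuousOn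
    hU.continuous_rpow.continuousOn (hU.continuous_rpow.comp hR).continuousOn

theorem exists_lipschitz (hU : IsHalfSpaceSol lam Lam p M e U) :
    ∃ L : ℝ, 0 < L ∧ ∀ x y, U x - U y ≤ L * ‖x - y‖ := by
  obtain ⟨K, hMK, hK⟩ := hU.exists_le_mul_inner
  have hlam := hU.lam_pos
  have hM := hU.one_le
  have hMp : 0 ≤ M ^ p := Real.rpow_nonneg (by linarith) p
  set L : ℝ := 2 * K + (M ^ p + 1) / (2 * lam) with hL
  have hB : 0 < (M ^ p + 1) / (2 * lam) := by positivity
  have hinner : ∀ {ν : E}, ‖ν‖ = 1 → ⟪ν, e⟫ ≤ 1 := fun {ν} hν => by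
    simpa [hν, hU.norm_e] using real_inner_le_norm ν e
  have hrefl : ∀ (ν : E), ‖ν‖ = 1 → ∀ c x, 0 ≤ ⟪x, ν⟫ - c →
      U x - U (planeReflection ν c x) ≤ L * (⟪x, ν⟫ - c) := by
    intro ν hν c
    have hR := continuous_planeReflection ν c
    have hzero : ∀ x, 0 ≤ ⟪x, ν⟫ - c → ⟪planeReflection ν c x, e⟫ ≤ 0 →
        U x ≤ 2 * K * (⟪x, ν⟫ - c) := by
      intro x hx h
      rw [inner_planeReflection] at h
      rcases le_or_gt ⟪x, e⟫ 0 with h0 | h0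
      · rw [hU.zero x h0]; nlinarith
      · have h3 : ⟪x, e⟫ ≤ 2 * (⟪x, ν⟫ - c) := by nlinarith [hinner hν]
        nlinarith [hK x h0.le]
    have hDo : IsOpen {x : E | (0 < ⟪x, ν⟫ - c ∧ ⟪x, ν⟫ - c < 1) ∧
        (0 < ⟪x, e⟫ ∧ 0 < ⟪planeReflection ν c x, e⟫)} := by
      have hℓ : Continuous fun x : E => ⟪x, ν⟫ - c := by fun_prop
      exact ((isOpen_lt continuous_const hℓ).inter (isOpen_lt hℓ continuous_const)).inter
        ((isOpen_halfSpace e).inter ((isOpen_halfSpace e).preimage hR))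
    have key := (hU.subsol_sub_reflection hν c hDo (fun x hx => hx.2.1)
      fun x hx => hx.2.2).le_of_slab hlam hU.lam_le hDo (hU.cont.sub (hU.cont.comp hR)) hν
      (c := c) (C := M ^ p) (C₁ := M) (K := 2 * K) (fun x hx => hx.1) hMp
      (fun x _ _ => by linarith [hU.rpow_le x, hU.rpow_nonneg (planeReflection ν c x)])
      (by linarith) (fun x _ => by linarith [hU.le x, hU.nonneg (planeReflection ν c x)]) ?_
    · intro x hx
      rcases hx.eq_or_lt with h0 | h0
      · rw [planeReflection, ← h0]; simp
      have hpos := hU.nonneg (planeReflection ν c x)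
      by_cases h1 : ⟪x, ν⟫ - c < 1
      · by_cases h2 : 0 < ⟪x, e⟫
        · by_cases h3 : 0 < ⟪planeReflection ν c x, e⟫
          · exact key x ⟨⟨h0, h1⟩, h2, h3⟩
          · have := hzero x hx (not_lt.1 h3)
            nlinarith
        · rw [hU.zero x (not_lt.1 h2)]; nlinarith
      · nlinarith [hU.le x]
    · intro x hx
      have hpos := hU.nonneg (planeReflection ν c x)
      rw [hDo.frontier_eq] at hx
      have hcl : 0 ≤ ⟪x, ν⟫ - c := by
        refine closure_minimal (t := {x : E | 0 ≤ ⟪x, ν⟫ - c}) (fun x hx => hx.1.1.le)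
          (isClosed_le continuous_const (by fun_prop)) hx.1
      rcases hcl.eq_or_lt with h0 | h0
      · rw [planeReflection, ← h0]; simp
      by_cases h1 : ⟪x, ν⟫ - c < 1
      · by_cases h2 : 0 < ⟪x, e⟫
        · by_cases h3 : 0 < ⟪planeReflection ν c x, e⟫
          · exact absurd ⟨⟨h0, h1⟩, h2, h3⟩ hx.2
          · linarith [hzero x hcl (not_lt.1 h3)]
        · rw [hU.zero x (not_lt.1 h2)]; nlinarith
      · nlinarith [hU.le x]
  refine ⟨L, by linarith, fun x y => ?_⟩
  rcases eq_or_ne x y with rfl | hxy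
  · simp
  have hd : 0 < ‖x - y‖ := norm_pos_iff.2 (sub_ne_zero.2 hxy)
  set ν : E := (1 / ‖x - y‖) • (x - y) with hν
  have hν1 : ‖ν‖ = 1 := by
    rw [hν, norm_smul, Real.norm_of_nonneg (by positivity)]; field_simp
  have hxy' : x - y = ‖x - y‖ • ν := by
    rw [hν, smul_smul, mul_one_div_cancel hd.ne', one_smul]
  have hℓ : ⟪x, ν⟫ - (⟪x, ν⟫ - ‖x - y‖ / 2) = ‖x - y‖ / 2 := by ring
  have hRx : planeReflection ν (⟪x, ν⟫ - ‖x - y‖ / 2) x = y := by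
    rw [planeReflection, hℓ, mul_div_cancel₀ _ two_ne_zero, ← hxy']
    abel
  have := hrefl ν hν1 (⟪x, ν⟫ - ‖x - y‖ / 2) x (by rw [hℓ]; positivity)
  rw [hRx, hℓ] at this
  nlinarith

end IsHalfSpaceSol

end Lipschitz

theorem rpow_sub_rpow_le {a b p : ℝ} (hb : 0 ≤ b) (hab : b ≤ a) (hp : 1 ≤ p) :
    a ^ p - b ^ p ≤ p * a ^ (p - 1) * (a - b) := by
  rcases (hb.trans hab).eq_or_lt with rfl | ha
  · rw [le_antisymm hab hb]; simp
  have h1 := one_add_mul_self_le_rpow_one_add (s := b / a - 1) (by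
    have : 0 ≤ b / a := by positivity
    linarith) hp
  rw [add_sub_cancel, Real.div_rpow hb ha.le, le_div_iff₀ (Real.rpow_pos_of_pos ha p)] at h1
  have h2 : a ^ p = a ^ (p - 1) * a := by
    rw [← Real.rpow_add_one ha.ne', sub_add_cancel]
  have h3 : (1 + p * (b / a - 1)) * a ^ p = a ^ p + p * a ^ (p - 1) * (b - a) := by
    rw [h2]; field_simp
  linarith

section MovingPlanes

variable {n : ℕ} {lam Lam : ℝ}

local notation "E" => EuclideanSpace ℝ (Fin n)

variable {p M : ℝ} {e : EuclideanSpace ℝ (Fin n)} {U : EuclideanSpace ℝ (Fin n) → ℝ}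

/-- The solution increases under reflection of `{0 < ⟪x, e⟫ < μ}` in the plane `{⟪x, e⟫ = μ}`. -/
def IncreasesUnderReflection (e : E) (U : E → ℝ) (μ : ℝ) : Prop :=
  ∀ x, 0 < ⟪x, e⟫ → ⟪x, e⟫ < μ → U x ≤ U (planeReflection e μ x)

namespace IsHalfSpaceSol

/-- The comparison function for the reflected difference in a slab. -/
theorem sub_reflection_le_weight (hU : IsHalfSpaceSol lam Lam p M e U) {μ A ε k η m : ℝ}
    (hμA : μ ≤ A) (hε : 0 < ε) (hεA : ε * A ^ 2 ≤ 1) (hk : 0 < k)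
    (hkM : 4 * (p * M ^ (p - 1)) ≤ lam * (k ^ 2 * Real.exp (-1)))
    (hηε : 3 * (p * η ^ (p - 1)) ≤ lam * ε)
    (hcase : ∀ x, 0 < ⟪x, e⟫ → ⟪x, e⟫ < μ → U (planeReflection e μ x) < U x →
      U x < η ∨ μ - 1 / k < ⟪x, e⟫) (hm : 0 < m)
    (hle : ∀ x, 0 < ⟪x, e⟫ → ⟪x, e⟫ < μ → U x - U (planeReflection e μ x) ≤
      m * (3 - Real.exp (-k * (μ - ⟪x, e⟫)) - ε * (μ - ⟪x, e⟫) ^ 2)) :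
    ∀ x, 0 < ⟪x, e⟫ → ⟪x, e⟫ < μ → U x - U (planeReflection e μ x) ≤
      (3 / 4 * m) * (3 - Real.exp (-k * (μ - ⟪x, e⟫)) - ε * (μ - ⟪x, e⟫) ^ 2) := by
  have hlam := hU.lam_pos
  have hp := hU.one_lt
  have hM := hU.one_le
  have he := hU.norm_e
  have hee : ⟪e, e⟫ = (1 : ℝ) := by rw [real_inner_self_eq_norm_sq, he, one_pow]
  set R : E → E := planeReflection e μ with hR
  have hRc : Continuous R := continuous_planeReflection e μ
  have hRe : ∀ x, ⟪R x, e⟫ = 2 * μ - ⟪x, e⟫ := fun x => by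
    rw [hR, inner_planeReflection, hee]; ring
  set D : Set E := {x | 0 < ⟪x, e⟫ ∧ ⟪x, e⟫ < μ} with hD
  have hℓ : Continuous fun x : E => ⟪x, e⟫ := by fun_prop
  have hDo : IsOpen D := (isOpen_halfSpace e).inter (isOpen_lt hℓ continuous_const)
  set G : ℝ → ℝ := fun s => 3 - Real.exp (-k * (μ - s)) - ε * (μ - s) ^ 2 with hG
  have hG1 : ∀ s, 0 ≤ s → s ≤ μ → 1 ≤ G s := by
    intro s h0 h1
    have h2 : Real.exp (-k * (μ - s)) ≤ 1 := Real.exp_le_one_iff.2 (by nlinarith)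
    have h3 : (μ - s) ^ 2 ≤ A ^ 2 := by
      have : 0 ≤ μ - s := by linarith
      gcongr
      linarith
    have h4 := mul_le_mul_of_nonneg_left h3 hε.le
    simp only [hG]
    linarith
  have hG3 : ∀ s, G s ≤ 3 := by
    intro s
    have := Real.exp_pos (-k * (μ - s))
    simp only [hG]
    nlinarith [sq_nonneg (μ - s)]
  have hz := hU.subsol_sub_reflection he μ hDo (fun x hx => hx.1) (fun x hx => by
    rw [← hR, hRe]; linarith [hx.1, hx.2])
  set ψ : E → ℝ := fun x => (3 / 4 * m) * G ⟪x, e⟫ with hψ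
  have hψC : ContDiff ℝ 2 ψ := by
    have h1 : ContDiff ℝ 2 fun x : E => ⟪x, e⟫ := contDiff_id.inner ℝ contDiff_const
    have h2 : ContDiff ℝ 2 fun x : E => μ - ⟪x, e⟫ := contDiff_const.sub h1
    exact contDiff_const.mul ((contDiff_const.sub (Real.contDiff_exp.comp
      (contDiff_const.mul h2))).sub (contDiff_const.mul (h2.pow 2)))
  have key := hz.le_of_frontier hlam.le hU.lam_le hDo (hU.cont.sub (hU.cont.comp hRc)).continuousOn
    hψC (C := M) (δ := 1 / 2 * (ε * lam * m)) ?_ ?_ (by positivity) ?_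
  · exact fun x h0 h1 => key x ⟨h0, h1⟩
  · intro x hx
    have h1 := hG1 ⟪x, e⟫ hx.1.le hx.2.le
    have : 0 ≤ ψ x := by simp only [hψ]; positivity
    linarith [hU.le x, hU.nonneg (R x)]
  · intro x hx
    rw [hDo.frontier_eq] at hx
    have hcl : 0 ≤ ⟪x, e⟫ ∧ ⟪x, e⟫ ≤ μ := by
      refine closure_minimal (t := {x : E | 0 ≤ ⟪x, e⟫ ∧ ⟪x, e⟫ ≤ μ})
        (fun x hx => ⟨hx.1.le, hx.2.le⟩) ?_ hx.1
      exact (isClosed_le continuous_const hℓ).inter (isClosed_le hℓ continuous_const)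
    have h1 := hG1 ⟪x, e⟫ hcl.1 hcl.2
    have hψ0 : 0 ≤ ψ x := by simp only [hψ]; positivity
    rcases hcl.1.eq_or_lt with h0 | h0
    · have := hU.zero x h0.ge
      linarith [hU.nonneg (R x)]
    · have h2 : ⟪x, e⟫ = μ := le_antisymm hcl.2 (not_lt.1 fun h => hx.2 ⟨h0, h⟩)
      have h3 : R x = x := by rw [hR, planeReflection, h2]; simp
      simp only [← hR, h3]
      linarith
  · intro x hx hlt w hw
    have hGx := hG1 ⟪x, e⟫ hx.1.le hx.2.le
    have hψ0 : 0 < ψ x := by simp only [hψ]; positivity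
    set τ : ℝ := μ - ⟪x, e⟫ with hτ
    have hτ0 : 0 < τ := by rw [hτ]; linarith [hx.2]
    have hd : ∀ v : E, d2 ψ x v = (3 / 4 * m) *
        (-(k ^ 2 * Real.exp (-k * τ) + 2 * ε) * ⟪v, e⟫ ^ 2) := by
      intro v
      have e1 : ∀ s : ℝ, ⟪x + s • v, e⟫ = ⟪x, e⟫ + ⟪v, e⟫ * s + 0 * s ^ 2 := by
        intro s
        rw [inner_add_left, inner_smul_left, conj_trivial]; ring
      have hi : ∀ s : ℝ, HasDerivAt (fun s : ℝ => μ - s) (-1) s := fun s => by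
        simpa using (hasDerivAt_id s).const_sub μ
      have hE : ∀ s : ℝ, HasDerivAt (fun s => Real.exp (-k * (μ - s)))
          (k * Real.exp (-k * (μ - s))) s := by
        intro s
        refine (((hi s).const_mul (-k)).exp).congr_deriv ?_
        ring
      have hG' : ∀ s : ℝ, HasDerivAt G (-(k * Real.exp (-k * (μ - s))) + ε * (2 * (μ - s))) s := by
        intro s
        refine (((hE s).const_sub 3).sub (((hi s).pow 2).const_mul ε)).congr_deriv ?_
        norm_num
      have hG'' : HasDerivAt (fun s => -(k * Real.exp (-k * (μ - s))) + ε * (2 * (μ - s)))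
          (-(k * (k * Real.exp (-k * τ))) + ε * (2 * -1)) ⟪x, e⟫ :=
        ((hE _).const_mul k).neg.add (((hi _).const_mul 2).const_mul ε)
      rw [hψ, d2_const_mul, d2_comp (q := fun x : E => ⟪x, e⟫) (Eventually.of_forall hG') hG'' e1]
      ring
    simp only [hd]
    rw [← Finset.mul_sum, ← Finset.mul_sum]
    have hS := (hw e).1
    rw [he, one_pow, mul_one] at hS
    set S := ∑ k, ⟪w k, e⟫ ^ 2
    have hzx : U (R x) < U x := by linarith
    have hzm := hle x hx.1 hx.2
    have hzm3 : U x - U (R x) ≤ 3 * m := hzm.trans (by nlinarith [hG3 ⟪x, e⟫])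
    have hpow := rpow_sub_rpow_le (hU.nonneg (R x)) hzx.le hp.le
    have hUp : 0 ≤ U x ^ (p - 1) := Real.rpow_nonneg (hU.nonneg x) _
    have hh : U x ^ p - U (R x) ^ p ≤ p * U x ^ (p - 1) * (3 * m) :=
      hpow.trans (by gcongr)
    have hexp := Real.exp_pos (-k * τ)
    have hSm : (3 / 4 * m) * (-(k ^ 2 * Real.exp (-k * τ) + 2 * ε) * S) ≤
        -((3 / 4 * m) * ((k ^ 2 * Real.exp (-k * τ) + 2 * ε) * lam)) := by
      have : (3 / 4 * m) * ((k ^ 2 * Real.exp (-k * τ) + 2 * ε) * lam) ≤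
        (3 / 4 * m) * ((k ^ 2 * Real.exp (-k * τ) + 2 * ε) * S) := by gcongr
      linarith
    have hke : 0 ≤ m * lam * (k ^ 2 * Real.exp (-k * τ)) := by positivity
    rcases hcase x hx.1 hx.2 hzx with h | h
    · have h2 : U x ^ (p - 1) ≤ η ^ (p - 1) :=
        Real.rpow_le_rpow (hU.nonneg x) h.le (by linarith)
      have h3 : p * U x ^ (p - 1) * (3 * m) ≤ m * (lam * ε) := by
        have : p * U x ^ (p - 1) ≤ p * η ^ (p - 1) := by gcongr
        nlinarith
      show _ + (U x ^ p - U (R x) ^ p) ≤ _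
      linarith
    · have h2 : U x ^ (p - 1) ≤ M ^ (p - 1) :=
        Real.rpow_le_rpow (hU.nonneg x) (hU.le x) (by linarith)
      have h3 : p * U x ^ (p - 1) * (3 * m) ≤ 3 / 4 * m * (lam * (k ^ 2 * Real.exp (-1))) := by
        have : p * U x ^ (p - 1) ≤ p * M ^ (p - 1) := by gcongr
        nlinarith
      have h4 : Real.exp (-1) ≤ Real.exp (-k * τ) := by
        refine Real.exp_le_exp.2 ?_
        have : τ * k ≤ 1 := by
          rw [← le_div_iff₀ hk, hτ]; linarith
        linarith
      have h5 : m * lam * (k ^ 2 * Real.exp (-1)) ≤ m * lam * (k ^ 2 * Real.exp (-k * τ)) := by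
        gcongr
      have h6 : 0 ≤ ε * lam * m := by positivity
      show _ + (U x ^ p - U (R x) ^ p) ≤ _
      linarith

theorem exists_of_not_increases (hU : IsHalfSpaceSol lam Lam p M e U) {A : ℝ} (hA : 0 < A) :
    ∃ η δ : ℝ, 0 < η ∧ 0 < δ ∧ ∀ μ ≤ A, ¬ IncreasesUnderReflection e U μ →
      ∃ x, 0 < ⟪x, e⟫ ∧ ⟪x, e⟫ ≤ μ - δ ∧ η ≤ U x ∧ U (planeReflection e μ x) < U x := by
  have hlam := hU.lam_pos
  have hp := hU.one_lt
  have hM := hU.one_le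
  set ε : ℝ := 1 / A ^ 2 with hε
  have hε0 : 0 < ε := by positivity
  have hεA : ε * A ^ 2 ≤ 1 := by rw [hε, one_div_mul_cancel (by positivity)]
  have hMp : 0 < p * M ^ (p - 1) := by
    have : 0 < M ^ (p - 1) := Real.rpow_pos_of_pos (by linarith) _
    positivity
  obtain ⟨k, hk, hkM⟩ : ∃ k : ℝ, 0 < k ∧
      4 * (p * M ^ (p - 1)) ≤ lam * (k ^ 2 * Real.exp (-1)) := by
    have he := Real.exp_pos (-1)
    refine ⟨Real.sqrt (4 * (p * M ^ (p - 1)) / (lam * Real.exp (-1))), by positivity, ?_⟩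
    rw [Real.sq_sqrt (by positivity)]
    exact le_of_eq (by field_simp)
  set η : ℝ := (lam * ε / (3 * p)) ^ (1 / (p - 1)) with hη
  have hη0 : 0 < η := Real.rpow_pos_of_pos (by positivity) _
  have hηp : 3 * (p * η ^ (p - 1)) ≤ lam * ε := by
    rw [hη, ← Real.rpow_mul (by positivity), one_div_mul_cancel (by linarith), Real.rpow_one]
    exact le_of_eq (by field_simp)
  refine ⟨η, 1 / k, hη0, by positivity, fun μ hμ hnot => ?_⟩
  by_contra hcon
  push Not at hcon
  refine hnot fun x hx0 hx1 => ?_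
  have hcase : ∀ x, 0 < ⟪x, e⟫ → ⟪x, e⟫ < μ → U (planeReflection e μ x) < U x →
      U x < η ∨ μ - 1 / k < ⟪x, e⟫ := by
    intro x h0 h1 h2
    by_contra h3
    push Not at h3
    exact absurd (hcon x h0 h3.2 h3.1) (not_le.2 h2)
  have hG1 : ∀ x : E, 0 < ⟪x, e⟫ → ⟪x, e⟫ < μ →
      1 ≤ 3 - Real.exp (-k * (μ - ⟪x, e⟫)) - ε * (μ - ⟪x, e⟫) ^ 2 := by
    intro s h0 h1
    have h2 : Real.exp (-k * (μ - ⟪s, e⟫)) ≤ 1 := Real.exp_le_one_iff.2 (by nlinarith)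
    have h3 : (μ - ⟪s, e⟫) ^ 2 ≤ A ^ 2 := by
      have : 0 ≤ μ - ⟪s, e⟫ := by linarith
      gcongr
      linarith
    have h4 := mul_le_mul_of_nonneg_left h3 hε0.le
    linarith
  have hiter : ∀ j : ℕ, ∀ x, 0 < ⟪x, e⟫ → ⟪x, e⟫ < μ → U x - U (planeReflection e μ x) ≤
      ((3 / 4) ^ j * M) * (3 - Real.exp (-k * (μ - ⟪x, e⟫)) - ε * (μ - ⟪x, e⟫) ^ 2) := by
    intro j
    induction j with
    | zero =>
      intro x h0 h1
      nlinarith [hG1 x h0 h1, hU.le x, hU.nonneg (planeReflection e μ x)]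
    | succ j ih =>
      intro x h0 h1
      refine (hU.sub_reflection_le_weight hμ hε0 hεA hk hkM hηp hcase (by positivity) ih
        x h0 h1).trans_eq ?_
      ring
  have hlim : Tendsto (fun j : ℕ => (((3 : ℝ) / 4) ^ j * M) *
      (3 - Real.exp (-k * (μ - ⟪x, e⟫)) - ε * (μ - ⟪x, e⟫) ^ 2)) atTop (𝓝 0) := by
    have := ((tendsto_pow_atTop_nhds_zero_of_lt_one (by norm_num : (0 : ℝ) ≤ 3 / 4)
      (by norm_num)).mul_const M).mul_const
      (3 - Real.exp (-k * (μ - ⟪x, e⟫)) - ε * (μ - ⟪x, e⟫) ^ 2)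
    simpa using this
  have := ge_of_tendsto' hlim fun j => hiter j x hx0 hx1
  linarith

end IsHalfSpaceSol

end MovingPlanes

section Monotonicity

variable {n : ℕ} {lam Lam : ℝ}

local notation "E" => EuclideanSpace ℝ (Fin n)

variable {p M : ℝ} {e : EuclideanSpace ℝ (Fin n)} {U : EuclideanSpace ℝ (Fin n) → ℝ}

namespace IsHalfSpaceSol

theorem closedBall_add_smul_subset (hU : IsHalfSpaceSol lam Lam p M e U) {x : E} {s r a b : ℝ}
    (ha : a < ⟪x, e⟫ + s - r) (hb : ⟪x, e⟫ + s + r < b) :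
    closedBall (x + s • e) r ⊆ {y | a < ⟪y, e⟫ ∧ ⟪y, e⟫ < b} := by
  intro y hy
  rw [mem_closedBall, dist_eq_norm] at hy
  have h1 := abs_le.1 ((abs_real_inner_le_norm (y - (x + s • e)) e).trans
    (by rwa [hU.norm_e, mul_one] : _ ≤ r))
  rw [inner_sub_left, inner_add_left, inner_smul_left, conj_trivial, real_inner_self_eq_norm_sq,
    hU.norm_e, one_pow, mul_one] at h1
  constructor <;> linarith [h1.1, h1.2]

theorem exists_increases_step (hU : IsHalfSpaceSol lam Lam p M e U) {A : ℝ} (hA : 0 < A) :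
    ∃ γ : ℝ, 0 < γ ∧ ∀ ν μ, ν ≤ μ → μ ≤ ν + γ → μ ≤ A → IncreasesUnderReflection e U ν →
      IncreasesUnderReflection e U μ := by
  have hlam := hU.lam_pos
  have he := hU.norm_e
  have hee : ⟪e, e⟫ = (1 : ℝ) := by rw [real_inner_self_eq_norm_sq, he, one_pow]
  obtain ⟨L, hL, hlip⟩ := hU.exists_lipschitz
  obtain ⟨η, δ, hη, hδ, H⟩ := hU.exists_of_not_increases hA
  obtain ⟨κ, hκ, hchain⟩ := exists_chain n hlam hU.lam_le
  set r : ℝ := η / (4 * L) with hr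
  have hr0 : 0 < r := by positivity
  have hrL : L * r = η / 4 := by rw [hr]; field_simp
  obtain ⟨m, hm⟩ := exists_nat_ge (2 * A / r)
  rw [div_le_iff₀ hr0] at hm
  set c : ℝ := κ ^ m * (η / 2) with hc
  have hc0 : 0 < c := by positivity
  set t : ℝ := min (c / (2 * L)) (η / L) with ht
  have ht0 : 0 < t := lt_min (by positivity) (by positivity)
  have htc : L * t ≤ c / 2 := by
    calc L * t ≤ L * (c / (2 * L)) := by gcongr; exact min_le_left _ _
      _ = c / 2 := by field_simp
  have htη : L * t ≤ η := by
    calc L * t ≤ L * (η / L) := by gcongr; exact min_le_right _ _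
      _ = η := by field_simp
  set r' : ℝ := min (c / (4 * L)) (min (t / 3) (δ / 6)) with hr'
  have hr'0 : 0 < r' := lt_min (by positivity) (lt_min (by positivity) (by positivity))
  have hr'c : L * r' ≤ c / 4 := by
    calc L * r' ≤ L * (c / (4 * L)) := by gcongr; exact min_le_left _ _
      _ = c / 4 := by field_simp
  have hr't : 3 * r' ≤ t := by
    have : r' ≤ t / 3 := (min_le_right _ _).trans (min_le_left _ _)
    linarith
  have hr'δ : 6 * r' ≤ δ := by
    have : r' ≤ δ / 6 := (min_le_right _ _).trans (min_le_right _ _)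
    linarith
  obtain ⟨m', hm'⟩ := exists_nat_ge (A / r')
  rw [div_le_iff₀ hr'0] at hm'
  set c' : ℝ := κ ^ m' * (c / 4) with hc'
  have hc'0 : 0 < c' := by positivity
  refine ⟨min (δ / 2) (c' / (2 * L)), lt_min (by positivity) (by positivity),
    fun ν μ hνμ hμν hμA hν => ?_⟩
  by_contra hnot
  obtain ⟨x, hx0, hxμ, hxη, hxR⟩ := H μ hμA hnot
  have hγδ : μ ≤ ν + δ / 2 := hμν.trans (by gcongr; exact min_le_left _ _)
  have hγc : L * (2 * (μ - ν)) ≤ c' := by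
    have h1 : μ - ν ≤ c' / (2 * L) := by linarith [min_le_right (δ / 2) (c' / (2 * L))]
    calc L * (2 * (μ - ν)) ≤ L * (2 * (c' / (2 * L))) := by gcongr
      _ = c' := by field_simp
  set s : ℝ := ⟪x, e⟫ with hs
  have hUs : ∀ y, 0 ≤ ⟪y, e⟫ → U y ≤ L * ⟪y, e⟫ := by
    intro y hy
    have h1 := hlip y (y - ⟪y, e⟫ • e)
    rw [hU.zero (y - ⟪y, e⟫ • e) (by rw [inner_sub_left, inner_smul_left, hee]; simp),
      sub_sub_cancel, norm_smul, he, mul_one, Real.norm_of_nonneg hy] at h1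
    linarith
  have hsη : η ≤ L * s := hxη.trans (hUs x hx0.le)
  have hts : t ≤ s := by
    have : L * t ≤ L * s := htη.trans hsη
    exact le_of_mul_le_mul_left this hL
  have hrs : 2 * r < s := by
    have : L * (2 * r) < L * s := by linarith
    exact lt_of_mul_lt_mul_left this hL.le
  set R : E → E := planeReflection e ν with hR
  have hRc : Continuous R := continuous_planeReflection e ν
  have hRe : ∀ y, R y = y + (2 * (ν - ⟪y, e⟫)) • e := fun y => by
    rw [hR, planeReflection]; module
  have hRin : ∀ y, ⟪R y, e⟫ = 2 * ν - ⟪y, e⟫ := fun y => by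
    rw [hR, inner_planeReflection, hee]; ring
  set y : E := x + (t - s) • e with hy
  have hye : ⟪y, e⟫ = t := by
    rw [hy, inner_add_left, inner_smul_left, hee, conj_trivial, ← hs]; ring
  have hz : R y = x + (2 * ν - t - s) • e := by
    rw [hRe, hye, hy]; module
  -- first chain: `U` is large at the reflection of `y`
  have hUz : c ≤ U (R y) := by
    refine hchain {x | 0 < ⟪x, e⟫} U x (R y) r (η / 2) m hr0 (by positivity)
      hU.cont.continuousOn (fun x _ => hU.nonneg x)
      ((hU.supersol.neg hlam.le hU.lam_le).mono subset_rfl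
        fun x _ => neg_nonpos.2 (hU.rpow_nonneg x)) ?_ ?_ ?_
    · intro τ hτ
      rw [hz, add_sub_cancel_left, smul_smul]
      refine (hU.closedBall_add_smul_subset (a := 0)
        (b := s + τ * (2 * ν - t - s) + 2 * r + 1) ?_ (by rw [← hs]; linarith)).trans
        fun y hy => hy.1
      have : 0 ≤ τ * (2 * ν - t - s) := mul_nonneg hτ.1 (by linarith)
      rw [← hs]
      linarith
    · rw [hz, add_sub_cancel_left, norm_smul, he, mul_one, Real.norm_of_nonneg (by linarith)]
      linarith
    · intro y hy
      rw [mem_closedBall, dist_eq_norm, norm_sub_rev] at hy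
      have := hlip x y
      nlinarith
  have hwlip : ∀ y y', (U (R y') - U y') - (U (R y) - U y) ≤ 2 * L * ‖y' - y‖ := by
    intro y y'
    have h1 := hlip (R y') (R y)
    have h2 := hlip y y'
    obtain ⟨T, b, hT⟩ := exists_planeReflection_eq he ν
    have h3 : ‖R y' - R y‖ = ‖y' - y‖ := by
      rw [hR, hT, hT, add_sub_add_right_eq_sub, ← map_sub, T.norm_map]
    rw [h3] at h1
    rw [norm_sub_rev] at h2
    linarith
  set D : Set E := {y | 0 < ⟪y, e⟫ ∧ ⟪y, e⟫ < ν} with hD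
  have hDo : IsOpen D := (isOpen_halfSpace e).inter
    (isOpen_lt (f := fun x : E => ⟪x, e⟫) (by fun_prop) continuous_const)
  have hwx : c' ≤ U (R x) - U x := by
    refine hchain D (fun y => U (R y) - U y) y x r' (c / 4) m' hr'0 (by positivity)
      ((hU.cont.comp hRc).sub hU.cont).continuousOn
      (fun y hy => sub_nonneg.2 (hν y hy.1 hy.2)) ?_ ?_ ?_ ?_
    · simp only [neg_sub]
      refine (hU.subsol_sub_reflection he ν hDo (fun x hx => hx.1) fun x hx => ?_).mono subset_rfl
        fun x hx => ?_
      · rw [← hR, hRin]; linarith [hx.1, hx.2]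
      · exact sub_nonpos.2 (Real.rpow_le_rpow (hU.nonneg x) (hν x hx.1 hx.2)
          (by linarith [hU.one_lt]))
    · intro τ hτ
      have h1 : x - y = (s - t) • e := by rw [hy]; module
      rw [h1, smul_smul]
      have h2 : 0 ≤ τ * (s - t) := mul_nonneg hτ.1 (by linarith)
      have h3 : τ * (s - t) ≤ s - t := mul_le_of_le_one_left (by linarith) hτ.2
      refine hU.closedBall_add_smul_subset ?_ ?_ <;> rw [hye] <;> linarith
    · have h1 : x - y = (s - t) • e := by rw [hy]; module
      rw [h1, norm_smul, he, mul_one, Real.norm_of_nonneg (by linarith)]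
      linarith
    · intro y' hy'
      rw [mem_closedBall, dist_eq_norm, norm_sub_rev] at hy'
      have h1 := hwlip y' y
      have h2 := hUs y (hye ▸ ht0.le)
      rw [hye] at h2
      nlinarith
  have h1 := hlip (R x) (planeReflection e μ x)
  have h2 : R x - planeReflection e μ x = (-(2 * (μ - ν))) • e := by
    rw [hR, planeReflection, planeReflection]; module
  rw [h2, norm_smul, he, mul_one, norm_neg, Real.norm_of_nonneg (by linarith)] at h1
  linarith

theorem increases (hU : IsHalfSpaceSol lam Lam p M e U) {A : ℝ} (hA : 0 < A) :
    IncreasesUnderReflection e U A := by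
  obtain ⟨γ, hγ, H⟩ := hU.exists_increases_step hA
  have key : ∀ j : ℕ, IncreasesUnderReflection e U (min (j * γ) A) := by
    intro j
    induction j with
    | zero =>
      intro x h0 h1
      have : min (((0 : ℕ) : ℝ) * γ) A ≤ 0 := (min_le_left _ _).trans (by simp)
      linarith
    | succ j ih =>
      refine H _ _ (min_le_min_right _ ?_) ?_ (min_le_right _ _) ih
      · push_cast; linarith
      · push_cast
        rcases le_total (j * γ) A with h | h
        · rw [min_eq_left h]
          exact (min_le_left _ _).trans (by linarith)
        · rw [min_eq_right h]
          exact (min_le_right _ _).trans (by linarith)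
  obtain ⟨j, hj⟩ := exists_nat_ge (A / γ)
  rw [div_le_iff₀ hγ] at hj
  have := key j
  rwa [min_eq_right hj] at this

theorem le_add_smul (hU : IsHalfSpaceSol lam Lam p M e U) (x : E) {t : ℝ} (ht : 0 ≤ t) :
    U x ≤ U (x + t • e) := by
  rcases le_or_gt ⟪x, e⟫ 0 with h0 | h0
  · rw [hU.zero x h0]; exact hU.nonneg _
  rcases ht.eq_or_lt with rfl | ht
  · simp
  have := hU.increases (A := ⟪x, e⟫ + t / 2) (by positivity) x h0 (by linarith)
  convert this using 2
  rw [planeReflection]; module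

end IsHalfSpaceSol

end Monotonicity

section Limit

variable {n : ℕ} {lam Lam : ℝ}

local notation "E" => EuclideanSpace ℝ (Fin n)

theorem PucciSupersol.of_monotone_limit {F : ℕ → E → ℝ} {v : E → ℝ} {p : ℝ} (hlam : 0 ≤ lam)
    (hLam : lam ≤ Lam) (hp : 0 < p) (hF : ∀ k, Continuous (F k)) (hmono : ∀ x, Monotone (F · x))
    (hF0 : ∀ k x, 0 ≤ F k x) (hv : Continuous v) (hlim : ∀ x, Tendsto (F · x) atTop (𝓝 (v x)))
    (hs : ∀ x, ∀ᶠ k in atTop, PucciSupersol lam Lam (ball x 1) (F k) (fun x => F k x ^ p)) :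
    PucciSupersol lam Lam univ v (fun x => v x ^ p) := by
  intro x₀ _ φ hφ hmin
  by_contra hneg
  rw [not_le] at hneg
  set P := pucciMax lam Lam (hess φ x₀) with hP
  set ε : ℝ := (P + v x₀ ^ p) / 4 with hε
  have hε0 : 0 < ε := by positivity
  obtain ⟨w, hw, hPw⟩ := exists_frame_pucciMax_eq hlam hLam hφ.contDiffAt (x := x₀)
  have hwn := hw.sum_norm_sq_le
  have hlimp : Tendsto (fun k => F k x₀ ^ p) atTop (𝓝 (v x₀ ^ p)) :=
    (hlim x₀).rpow_const (Or.inr hp.le)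
  obtain ⟨k₀, hk₀⟩ := (hlimp.eventually (lt_mem_nhds (sub_lt_self (v x₀ ^ p) hε0))).exists
  have hk₀c : Continuous fun y => F k₀ y ^ p := (hF k₀).rpow_const fun _ => Or.inr hp.le
  have hev := (hmin.and (sum_d2_le_sum_d2_add_eventually hφ lam Lam hε0 (x := x₀))).and
    (hk₀c.continuousAt.eventually (lt_mem_nhds hk₀))
  obtain ⟨ρ', hρ', hball⟩ := Metric.eventually_nhds_iff_ball.1 hev
  set ρ : ℝ := min (ρ' / 2) 1 with hρ
  have hρ0 : 0 < ρ := lt_min (by positivity) one_pos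
  have hsub : closedBall x₀ ρ ⊆ ball x₀ ρ' :=
    closedBall_subset_ball (by linarith [min_le_left (ρ' / 2) 1])
  have hLam0 : 0 ≤ Lam := hlam.trans hLam
  set η : ℝ := ε / (2 * (n * Lam) + 1) with hη
  have hη0 : 0 < η := by positivity
  have hηε : η * (2 * (n * Lam)) ≤ ε := by
    have : η * (2 * (n * Lam) + 1) = ε := by rw [hη]; field_simp
    linarith
  have hunif := Monotone.tendstoUniformlyOn_of_forall_tendsto (isCompact_closedBall x₀ ρ)
    (fun k => (hF k).continuousOn) (fun x _ => hmono x) hv.continuousOn fun x _ => hlim x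
  have hδ : 0 < η * ρ ^ 2 / 4 := by positivity
  obtain ⟨k, ⟨hk1, hk2⟩, hk3⟩ := (((Metric.tendstoUniformlyOn_iff.1 hunif _ hδ).and
    (eventually_ge_atTop k₀)).and (hs x₀)).exists
  obtain ⟨x₁, hx₁, hmax⟩ := exists_isLocalMax_perturb (z := fun y => φ y - v y)
    (z' := fun y => φ y - F k y) (x₀ := x₀) (η := η) (δ := η * ρ ^ 2 / 4) hρ0
    (hφ.continuous.sub (hF k)).continuousOn
    (fun y hy => by linarith [(hball y (hsub hy)).1.1]) (fun y hy => by
      have := hk1 y hy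
      rw [Real.dist_eq] at this
      rw [show φ y - F k y - (φ y - v y) = v y - F k y by ring]
      exact this.le) (by linarith)
  have hC2 : ContDiff ℝ 2 fun y => φ y + -η * ‖y - x₀‖ ^ 2 :=
    hφ.add (contDiff_const.mul (contDiff_norm_sub_sq x₀))
  have h1 := hk3.sum_le (ball_subset_ball (min_le_right _ _) hx₁) hC2.contDiffAt (v := w) (by
    filter_upwards [hmax] with y hy
    linarith) hw
  have hd : ∀ u : E, d2 (fun y => φ y + -η * ‖y - x₀‖ ^ 2) x₁ u =
      d2 φ x₁ u + -η * (2 * ‖u‖ ^ 2) := by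
    intro u
    rw [d2_add hφ.contDiffAt (contDiff_const.mul (contDiff_norm_sub_sq x₀)).contDiffAt,
      d2_const_mul, d2_norm_sub_sq]
  simp only [hd, Finset.sum_add_distrib, ← Finset.mul_sum] at h1
  obtain ⟨⟨-, h2⟩, h3⟩ := hball x₁ (hsub (ball_subset_closedBall hx₁))
  have h4 := (abs_le.1 (h2 w hw)).1
  have h5 : F k₀ x₁ ^ p ≤ F k x₁ ^ p :=
    Real.rpow_le_rpow (hF0 _ _) (hmono x₁ hk2) hp.le
  have h6 : η * (2 * ∑ k, ‖w k‖ ^ 2) ≤ η * (2 * (n * Lam)) := by gcongr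
  linarith

/-- A bounded nonnegative supersolution in the whole space, invariant in the direction `e`. -/
structure IsInvariantSupersol (lam Lam p M : ℝ) (e : E) (v : E → ℝ) : Prop where
  lam_pos : 0 < lam
  lam_le : lam ≤ Lam
  one_lt : 1 < p
  norm_e : ‖e‖ = 1
  cont : Continuous v
  nonneg : ∀ x, 0 ≤ v x
  le : ∀ x, v x ≤ M
  invariant : ∀ x (t : ℝ), v (x + t • e) = v x
  supersol : PucciSupersol lam Lam univ v (fun x => v x ^ p)

variable {p M : ℝ} {e : EuclideanSpace ℝ (Fin n)} {U : EuclideanSpace ℝ (Fin n) → ℝ}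

theorem IsHalfSpaceSol.exists_invariantSupersol (hU : IsHalfSpaceSol lam Lam p M e U) :
    ∃ v, IsInvariantSupersol lam Lam p M e v ∧ ∀ x, U x ≤ v x := by
  obtain ⟨L, hL, hlip⟩ := hU.exists_lipschitz
  have hee : ⟪e, e⟫ = (1 : ℝ) := by rw [real_inner_self_eq_norm_sq, hU.norm_e, one_pow]
  set F : ℕ → E → ℝ := fun k x => U (x + (k : ℝ) • e) with hF
  have hmono : ∀ x, Monotone (F · x) := fun x i j hij => by
    have := hU.le_add_smul (x + (i : ℝ) • e) (t := (j : ℝ) - i)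
      (sub_nonneg.2 (Nat.cast_le.2 hij))
    rwa [show x + (i : ℝ) • e + ((j : ℝ) - i) • e = x + (j : ℝ) • e by module] at this
  have hFc : ∀ k, Continuous (F k) := fun k => hU.cont.comp (by fun_prop)
  set v : E → ℝ := fun x => ⨆ k, F k x with hv
  have hbdd : ∀ x, BddAbove (range (F · x)) := fun x => ⟨M, by rintro _ ⟨k, rfl⟩; exact hU.le _⟩
  have hFv : ∀ k x, F k x ≤ v x := fun k x => le_ciSup (hbdd x) k
  have hUv : ∀ (x : E) (t : ℝ), U (x + t • e) ≤ v x := fun x t => by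
    obtain ⟨k, hk⟩ := exists_nat_ge t
    refine le_trans ?_ (hFv k x)
    have := hU.le_add_smul (x + t • e) (sub_nonneg.2 hk)
    rwa [show x + t • e + ((k : ℝ) - t) • e = x + (k : ℝ) • e by module] at this
  have hinv : ∀ x (t : ℝ), v (x + t • e) ≤ v x := fun x t => by
    refine ciSup_le fun k => ?_
    simp only [hF]
    rw [add_assoc, ← add_smul]
    exact hUv _ _
  have hlim : ∀ x, Tendsto (F · x) atTop (𝓝 (v x)) := fun x =>
    tendsto_atTop_ciSup (hmono x) (hbdd x)
  have hvlip : ∀ x y, v x ≤ v y + L * dist x y := fun x y => by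
    refine ciSup_le fun k => ?_
    have h1 := hlip (x + (k : ℝ) • e) (y + (k : ℝ) • e)
    rw [add_sub_add_right_eq_sub, ← dist_eq_norm] at h1
    have h2 := hFv k y
    simp only [hF] at h2 ⊢
    linarith
  have hvc : Continuous v := (LipschitzWith.of_le_add_mul ⟨L, hL.le⟩ hvlip).continuous
  refine ⟨v, ⟨hU.lam_pos, hU.lam_le, hU.one_lt, hU.norm_e, hvc, ?_, ?_, ?_, ?_⟩, ?_⟩
  · exact fun x => (hU.nonneg _).trans (hFv 0 x)
  · exact fun x => ciSup_le fun k => hU.le _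
  · intro x t
    refine le_antisymm (hinv x t) ?_
    have := hinv (x + t • e) (-t)
    rwa [neg_smul, add_neg_cancel_right] at this
  · refine PucciSupersol.of_monotone_limit hU.lam_pos.le hU.lam_le (by linarith [hU.one_lt]) hFc
      hmono (fun k x => hU.nonneg _) hvc hlim fun x => ?_
    obtain ⟨k₁, hk₁⟩ := exists_nat_ge (‖x‖ + 1)
    filter_upwards [eventually_ge_atTop k₁] with k hk
    refine (hU.supersol.comp_add_right hU.lam_pos.le hU.lam_le ((k : ℝ) • e)).mono ?_
      fun x _ => le_rfl
    intro y hy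
    rw [mem_ball, dist_eq_norm] at hy
    have h1 : (k₁ : ℝ) ≤ k := Nat.cast_le.2 hk
    have h2 : ‖y‖ ≤ ‖y - x‖ + ‖x‖ := by simpa using norm_add_le (y - x) x
    have h3 := (abs_le.1 (abs_real_inner_le_norm y e)).1
    rw [hU.norm_e, mul_one] at h3
    show 0 < ⟪y + (k : ℝ) • e, e⟫
    rw [inner_add_left, inner_smul_left, hee, conj_trivial, mul_one]
    linarith
  · intro x
    simpa using hUv x 0

end Limit

section Radial

variable {n : ℕ} {lam Lam : ℝ}

local notation "E" => EuclideanSpace ℝ (Fin n)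

/-- The squared distance of `x` to the line `x₁ + ℝ e`, for a unit vector `e`. -/
noncomputable def distLineSq (x₁ e x : E) : ℝ := ‖x - x₁‖ ^ 2 - ⟪x - x₁, e⟫ ^ 2

theorem contDiff_distLineSq (x₁ e : E) : ContDiff ℝ 2 (distLineSq x₁ e) := by
  have h1 : ContDiff ℝ 2 fun x : E => ⟪x - x₁, e⟫ :=
    (contDiff_id.sub contDiff_const).inner ℝ contDiff_const
  exact (contDiff_norm_sub_sq x₁).sub (h1.pow 2)

theorem distLineSq_add_smul (x₁ e x v : E) (s : ℝ) : distLineSq x₁ e (x + s • v) =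
    distLineSq x₁ e x + 2 * ⟪v, x - x₁ - ⟪x - x₁, e⟫ • e⟫ * s +
      (‖v‖ ^ 2 - ⟪v, e⟫ ^ 2) * s ^ 2 := by
  simp only [distLineSq]
  rw [show x + s • v - x₁ = (x - x₁) + s • v by abel, norm_add_sq_real, inner_add_left,
    inner_smul_left, inner_smul_right, norm_smul, mul_pow, Real.norm_eq_abs, sq_abs,
    inner_sub_right v, inner_smul_right, real_inner_comm v (x - x₁), conj_trivial]
  ring

theorem norm_sub_smul_sq {e : E} (he : ‖e‖ = 1) (x₁ x : E) :
    ‖x - x₁ - ⟪x - x₁, e⟫ • e‖ ^ 2 = distLineSq x₁ e x := by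
  rw [norm_sub_sq_real, inner_smul_right, norm_smul, he, distLineSq, mul_one, Real.norm_eq_abs,
    sq_abs]
  ring

theorem distLineSq_nonneg {e : E} (he : ‖e‖ = 1) (x₁ x : E) : 0 ≤ distLineSq x₁ e x := by
  rw [← norm_sub_smul_sq he]; positivity

theorem sum_sq_single_inner (w : E) :
    ∑ i : Fin n, ⟪(EuclideanSpace.single i (1 : ℝ) : E), w⟫ ^ 2 = ‖w‖ ^ 2 := by
  rw [← sum_sq_inner_single w]
  exact Finset.sum_congr rfl fun i _ => by rw [real_inner_comm]

theorem sum_norm_single_sq_sub (e : E) (he : ‖e‖ = 1) :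
    ∑ i : Fin n, (‖EuclideanSpace.single i (1 : ℝ)‖ ^ 2 - ⟪EuclideanSpace.single i (1 : ℝ), e⟫ ^ 2)
      = (n : ℝ) - 1 := by
  rw [Finset.sum_sub_distrib, sum_sq_single_inner, he]
  simp

theorem isFrame_single (hlam : 0 ≤ lam) (hLam : lam ≤ Lam) :
    IsFrame lam Lam fun i : Fin n => Real.sqrt lam • (EuclideanSpace.single i (1 : ℝ) : E) := by
  intro ξ
  have : ∑ i : Fin n, ⟪Real.sqrt lam • (EuclideanSpace.single i (1 : ℝ) : E), ξ⟫ ^ 2 =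
      lam * ‖ξ‖ ^ 2 := by
    simp only [inner_smul_left, conj_trivial, mul_pow, Real.sq_sqrt hlam]
    rw [← Finset.mul_sum, sum_sq_single_inner]
  rw [this]
  exact ⟨le_rfl, by gcongr⟩

/-- A frame realizing the largest second derivative in the radial direction. -/
theorem exists_radial_frame (hlam : 0 ≤ lam) (hLam : lam ≤ Lam) {e : E} (he : ‖e‖ = 1)
    {x₁ x : E} (hx : 0 < distLineSq x₁ e x) :
    ∃ w : Option (Fin n) → E, IsFrame lam Lam w ∧ ∀ (H H' : ℝ → ℝ) (H'' : ℝ),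
      (∀ᶠ s in 𝓝 (distLineSq x₁ e x), HasDerivAt H (H' s) s) →
      HasDerivAt H' H'' (distLineSq x₁ e x) →
      ∑ k, d2 (fun y => H (distLineSq x₁ e y)) x (w k) =
        4 * Lam * distLineSq x₁ e x * H'' +
          2 * (Lam + lam * (n - 2)) * H' (distLineSq x₁ e x) := by
  set Q := distLineSq x₁ e x with hQ
  set y : E := x - x₁ - ⟪x - x₁, e⟫ • e with hy
  have hyQ : ‖y‖ ^ 2 = Q := norm_sub_smul_sq he x₁ x
  have hye : ⟪y, e⟫ = (0 : ℝ) := by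
    rw [hy, inner_sub_left, inner_smul_left, real_inner_self_eq_norm_sq, he, conj_trivial]; ring
  have hd : 0 ≤ Lam - lam := sub_nonneg.2 hLam
  set w : Option (Fin n) → E := fun k => k.elim (Real.sqrt ((Lam - lam) / Q) • y)
    fun i => Real.sqrt lam • (EuclideanSpace.single i (1 : ℝ) : E) with hw
  have hsum : ∀ ξ, ∑ k, ⟪w k, ξ⟫ ^ 2 = (Lam - lam) / Q * ⟪y, ξ⟫ ^ 2 + lam * ‖ξ‖ ^ 2 := by
    intro ξ
    rw [Fintype.sum_option]
    simp only [hw, Option.elim, inner_smul_left, conj_trivial, mul_pow, Real.sq_sqrt hlam,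
      Real.sq_sqrt (div_nonneg hd hx.le)]
    rw [← Finset.mul_sum, sum_sq_single_inner]
  refine ⟨w, fun ξ => ?_, fun H H' H'' h1 h2 => ?_⟩
  · rw [hsum]
    have h1 : ⟪y, ξ⟫ ^ 2 ≤ Q * ‖ξ‖ ^ 2 := by
      rw [← hyQ, ← mul_pow, sq_le_sq, abs_of_nonneg (a := ‖y‖ * ‖ξ‖) (by positivity)]
      exact abs_real_inner_le_norm y ξ
    have h2 : (Lam - lam) / Q * ⟪y, ξ⟫ ^ 2 ≤ (Lam - lam) * ‖ξ‖ ^ 2 := by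
      calc (Lam - lam) / Q * ⟪y, ξ⟫ ^ 2 ≤ (Lam - lam) / Q * (Q * ‖ξ‖ ^ 2) := by gcongr
        _ = _ := by field_simp
    have h3 : 0 ≤ (Lam - lam) / Q * ⟪y, ξ⟫ ^ 2 := by positivity
    constructor <;> linarith
  · have h3 : ∀ k, d2 (fun y => H (distLineSq x₁ e y)) x (w k) =
        4 * H'' * ⟪w k, y⟫ ^ 2 + 2 * H' Q * (‖w k‖ ^ 2 - ⟪w k, e⟫ ^ 2) := by
      intro k
      rw [d2_comp (q := distLineSq x₁ e) h1 h2 (distLineSq_add_smul x₁ e x (w k)), ← hQ, ← hy]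
      ring
    simp only [h3]
    rw [Finset.sum_add_distrib, ← Finset.mul_sum, ← Finset.mul_sum, hsum, real_inner_self_eq_norm_sq,
      hyQ]
    have h4 : ∑ k, (‖w k‖ ^ 2 - ⟪w k, e⟫ ^ 2) = (Lam - lam) + lam * ((n : ℝ) - 1) := by
      rw [Fintype.sum_option]
      congr 1
      · simp only [hw, Option.elim]
        rw [inner_smul_left, hye, norm_smul, mul_pow, hyQ, Real.norm_eq_abs, sq_abs,
          Real.sq_sqrt (div_nonneg hd hx.le)]
        field_simp
        simp
      · rw [← sum_norm_single_sq_sub e he, Finset.mul_sum]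
        refine Finset.sum_congr rfl fun i _ => ?_
        simp only [hw, Option.elim]
        rw [inner_smul_left, conj_trivial, mul_pow, norm_smul, mul_pow, Real.norm_eq_abs, sq_abs,
          Real.sq_sqrt hlam]
        ring
    rw [h4]
    field_simp
    ring

variable {p M : ℝ} {e : EuclideanSpace ℝ (Fin n)} {v : EuclideanSpace ℝ (Fin n) → ℝ}

namespace IsInvariantSupersol

theorem radial_le (hv : IsInvariantSupersol lam Lam p M e v) {x₁ : E} {H H' H'' : ℝ → ℝ}
    (hH : ∀ s, 0 < s → ContDiffAt ℝ 2 H s) (hH1 : ∀ s, 0 < s → HasDerivAt H (H' s) s)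
    (hH2 : ∀ s, 0 < s → HasDerivAt H' (H'' s) s) {r R δ : ℝ} (hr : 0 < r)
    (hHr : ∀ x, distLineSq x₁ e x = r → H r ≤ v x) (hHR : H R ≤ 0) (hδ : 0 < δ)
    (hs : ∀ x, r < distLineSq x₁ e x → distLineSq x₁ e x < R →
      δ ≤ 4 * Lam * distLineSq x₁ e x * H'' (distLineSq x₁ e x) +
          2 * (Lam + lam * (n - 2)) * H' (distLineSq x₁ e x) + v x ^ p) :
    ∀ x, r < distLineSq x₁ e x → distLineSq x₁ e x < R → H (distLineSq x₁ e x) ≤ v x := by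
  set q : E → ℝ := distLineSq x₁ e with hq
  have hqC : ContDiff ℝ 2 q := contDiff_distLineSq x₁ e
  set D : Set E := {x | r < q x ∧ q x < R} with hD
  have hDo : IsOpen D := (isOpen_lt continuous_const hqC.continuous).inter
    (isOpen_lt hqC.continuous continuous_const)
  have hcl : closure D ⊆ {x | r ≤ q x ∧ q x ≤ R} :=
    closure_minimal (fun x hx => ⟨hx.1.le, hx.2.le⟩)
      ((isClosed_le continuous_const hqC.continuous).inter
        (isClosed_le hqC.continuous continuous_const))
  obtain ⟨C, hC⟩ : ∃ C, ∀ s ∈ Icc r R, H s ≤ C := by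
    obtain ⟨C, hC⟩ := (isCompact_Icc (a := r) (b := R)).bddAbove_image (f := H) fun s hs =>
      (hH s (hr.trans_le hs.1)).continuousAt.continuousWithinAt
    exact ⟨C, fun s hs => hC (mem_image_of_mem H hs)⟩
  have key := (hv.supersol.mono (subset_univ D) fun _ _ => le_rfl).le_of_frontier
    (ι := Option (Fin n)) (φ := fun x => H (q x)) (C := C) hv.lam_pos.le hv.lam_le hDo
    hv.cont.continuousOn
    (fun x hx => ((hH (q x) (hr.trans_le (hcl hx).1)).continuousAt.comp
      hqC.continuous.continuousAt).continuousWithinAt)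
    (fun x hx => (hH (q x) (hr.trans hx.1)).comp x hqC.contDiffAt)
    (fun x hx => by linarith [hC (q x) ⟨hx.1.le, hx.2.le⟩, hv.nonneg x]) ?_ hδ ?_
  · exact fun x h1 h2 => key x ⟨h1, h2⟩
  · intro x hx
    rw [hDo.frontier_eq] at hx
    obtain ⟨h1, h2⟩ := hcl hx.1
    rcases h1.eq_or_lt with h1 | h1
    · simp only [← h1]; exact hHr x h1.symm
    · have h3 : q x = R := le_antisymm h2 (not_lt.1 fun h => hx.2 ⟨h1, h⟩)
      simp only [h3]
      exact hHR.trans (hv.nonneg x)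
  · intro x hx _
    have hx0 : 0 < q x := hr.trans hx.1
    obtain ⟨w, hw, hval⟩ := exists_radial_frame hv.lam_pos.le hv.lam_le hv.norm_e hx0
    refine ⟨w, hw, ?_⟩
    rw [hval H H' (H'' (q x)) ?_ (hH2 _ hx0)]
    · exact hs x hx.1 hx.2
    · filter_upwards [lt_mem_nhds hx0] with s hs using hH1 s hs

theorem paraboloid_le (hv : IsInvariantSupersol lam Lam p M e v) {x₁ : E} {b κ R δ : ℝ}
    (hb : ∀ x, distLineSq x₁ e x = R → b ≤ v x) (hδ : 0 < δ)
    (hs : ∀ x, distLineSq x₁ e x < R → δ ≤ -(2 * κ * lam * (n - 1)) + v x ^ p) :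
    ∀ x, distLineSq x₁ e x < R → b + κ * (R - distLineSq x₁ e x) ≤ v x := by
  set q : E → ℝ := distLineSq x₁ e with hq
  have hqC : ContDiff ℝ 2 q := contDiff_distLineSq x₁ e
  set D : Set E := {x | q x < R} with hD
  have hDo : IsOpen D := isOpen_lt hqC.continuous continuous_const
  have hcl : closure D ⊆ {x | q x ≤ R} :=
    closure_minimal (fun x (hx : q x < R) => show q x ≤ R from hx.le) (isClosed_le hqC.continuous continuous_const)
  set φ : E → ℝ := fun x => b + κ * (R - q x) with hφ
  have hφC : ContDiff ℝ 2 φ := contDiff_const.add (contDiff_const.mul (contDiff_const.sub hqC))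
  refine (hv.supersol.mono (subset_univ D) fun _ _ => le_rfl).le_of_frontier
    (φ := φ) (C := b + |κ| * R) hv.lam_pos.le hv.lam_le hDo hv.cont.continuousOn
    hφC.continuous.continuousOn (fun x _ => hφC.contDiffAt) ?_ ?_ hδ
    fun x hx _ => ⟨_, isFrame_single hv.lam_pos.le hv.lam_le, ?_⟩
  · intro x hx
    have h0 := distLineSq_nonneg hv.norm_e x₁ x
    have h1 : 0 ≤ R - q x := sub_nonneg.2 (le_of_lt hx)
    have h2 : κ * (R - q x) ≤ |κ| * R := by
      calc κ * (R - q x) ≤ |κ| * (R - q x) := by gcongr; exact le_abs_self κ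
        _ ≤ |κ| * R := by gcongr; linarith
    simp only [hφ]
    linarith [hv.nonneg x]
  · intro x hx
    rw [hDo.frontier_eq] at hx
    have h3 : q x = R := le_antisymm (hcl hx.1) (not_lt.1 hx.2)
    simp only [hφ, h3, sub_self, mul_zero, add_zero]
    exact hb x h3
  · have hd : ∀ u : E, d2 φ x u = -(2 * κ) * (‖u‖ ^ 2 - ⟪u, e⟫ ^ 2) := by
      intro u
      rw [d2_quadratic (b := -κ * (2 * ⟪u, x - x₁ - ⟪x - x₁, e⟫ • e⟫))
        (c := -κ * (‖u‖ ^ 2 - ⟪u, e⟫ ^ 2))]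
      · ring
      · intro s
        simp only [hφ, hq, distLineSq_add_smul]
        ring
    simp only [hd]
    have : ∀ i : Fin n, ‖Real.sqrt lam • (EuclideanSpace.single i (1 : ℝ) : E)‖ ^ 2 -
        ⟪Real.sqrt lam • (EuclideanSpace.single i (1 : ℝ) : E), e⟫ ^ 2 =
        lam * (‖(EuclideanSpace.single i (1 : ℝ) : E)‖ ^ 2 -
          ⟪(EuclideanSpace.single i (1 : ℝ) : E), e⟫ ^ 2) := by
      intro i
      rw [inner_smul_left, conj_trivial, mul_pow, norm_smul, mul_pow, Real.norm_eq_abs, sq_abs,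
        Real.sq_sqrt hv.lam_pos.le]
      ring
    simp only [this]
    rw [← Finset.mul_sum, ← Finset.mul_sum, sum_norm_single_sq_sub e hv.norm_e]
    refine (hs x hx).trans_eq ?_
    ring

end IsInvariantSupersol

end Radial

section Liouville

variable {n : ℕ} {lam Lam : ℝ}

local notation "E" => EuclideanSpace ℝ (Fin n)

variable {p M : ℝ} {e : EuclideanSpace ℝ (Fin n)} {v : EuclideanSpace ℝ (Fin n) → ℝ}

theorem hasDerivAt_rpow_neg {s : ℝ} (hs : 0 < s) (b : ℝ) :
    HasDerivAt (fun s : ℝ => s ^ (-b)) (-b * s ^ (-(b + 1))) s := by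
  have := Real.hasDerivAt_rpow_const (p := -b) (Or.inl hs.ne')
  rwa [show -b - 1 = -(b + 1) by ring] at this

theorem mul_rpow_neg_add_one {s : ℝ} (hs : 0 < s) (b : ℝ) : s * s ^ (-(b + 1)) = s ^ (-b) := by
  rw [show -b = 1 + -(b + 1) by ring, Real.rpow_add hs, Real.rpow_one]

namespace IsInvariantSupersol

theorem exists_pos_le (hv : IsInvariantSupersol lam Lam p M e v) {x₁ : E} (hx : 0 < v x₁) :
    ∃ a r : ℝ, 0 < a ∧ 0 < r ∧ ∀ x, distLineSq x₁ e x ≤ r → a ≤ v x := by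
  obtain ⟨ρ, hρ, hball⟩ := Metric.eventually_nhds_iff.1
    (hv.cont.continuousAt.eventually (lt_mem_nhds (half_lt_self hx)))
  refine ⟨v x₁ / 2, (ρ / 2) ^ 2, by positivity, by positivity, fun x hq => ?_⟩
  have h1 : v (x + (-⟪x - x₁, e⟫) • e) = v x := hv.invariant _ _
  rw [← h1]
  refine (hball ?_).le
  rw [← norm_sub_smul_sq hv.norm_e] at hq
  have h2 := (pow_le_pow_iff_left₀ (norm_nonneg _) (by positivity) two_ne_zero).1 hq
  rw [dist_eq_norm, show x + (-⟪x - x₁, e⟫) • e - x₁ = x - x₁ - ⟪x - x₁, e⟫ • e by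
    rw [neg_smul]; abel]
  linarith

theorem rpow_neg_le (hv : IsInvariantSupersol lam Lam p M e v) {x₁ : E} {a b r : ℝ}
    (ha : 0 < a) (hr : 0 < r) (har : ∀ x, distLineSq x₁ e x = r → a ≤ v x) (hb : 0 < b)
    (hN : Lam + lam * (n - 2) < 2 * Lam * (b + 1)) {x : E} (hx : r < distLineSq x₁ e x) :
    a * r ^ b * distLineSq x₁ e x ^ (-b) ≤ v x := by
  set A : ℝ := a * r ^ b with hA
  have hA0 : 0 < A := by positivity
  have hArb : A * r ^ (-b) = a := by
    rw [hA, mul_assoc, ← Real.rpow_add hr, add_neg_cancel, Real.rpow_zero, mul_one]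
  have key : ∀ R, distLineSq x₁ e x < R →
      A * (distLineSq x₁ e x ^ (-b) - R ^ (-b)) ≤ v x := by
    intro R hR
    have hR0 : 0 < R := hr.trans (hx.trans hR)
    refine hv.radial_le (x₁ := x₁) (H := fun s => A * (s ^ (-b) - R ^ (-b)))
      (H' := fun s => A * (-b * s ^ (-(b + 1))))
      (H'' := fun s => A * (-b * (-(b + 1) * s ^ (-(b + 1 + 1))))) (r := r) (R := R)
      (δ := A * b * R ^ (-(b + 1)) * (4 * Lam * (b + 1) - 2 * (Lam + lam * (n - 2))))
      (fun s hs => ?_) (fun s hs => ?_) (fun s hs => ?_) hr ?_ (by simp) ?_ ?_ x hx hR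
    · exact contDiffAt_const.mul ((contDiffAt_id.rpow_const_of_ne hs.ne').sub contDiffAt_const)
    · exact ((hasDerivAt_rpow_neg hs b).sub_const _).const_mul _
    · exact ((hasDerivAt_rpow_neg hs (b + 1)).const_mul _).const_mul _
    · intro y hy
      refine le_trans ?_ (har y hy)
      rw [mul_sub, hArb]
      have : 0 < A * R ^ (-b) := by positivity
      linarith
    · have : 0 < R ^ (-(b + 1)) := by positivity
      exact mul_pos (by positivity) (by linarith)
    · intro y hy1 hy2
      have hq0 : 0 < distLineSq x₁ e y := hr.trans hy1
      have h1 := mul_rpow_neg_add_one hq0 (b + 1)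
      have h2 : R ^ (-(b + 1)) ≤ distLineSq x₁ e y ^ (-(b + 1)) :=
        Real.rpow_le_rpow_of_nonpos hq0 hy2.le (by linarith)
      have h3 : 0 ≤ v y ^ p := Real.rpow_nonneg (hv.nonneg y) p
      have h4 : 0 ≤ 4 * Lam * (b + 1) - 2 * (Lam + lam * (n - 2)) := by linarith
      calc _ ≤ A * b * distLineSq x₁ e y ^ (-(b + 1)) *
            (4 * Lam * (b + 1) - 2 * (Lam + lam * (n - 2))) := by gcongr
        _ = 4 * Lam * (A * (-b * (-(b + 1) *
              (distLineSq x₁ e y * distLineSq x₁ e y ^ (-(b + 1 + 1)))))) +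
            2 * (Lam + lam * (n - 2)) * (A * (-b * distLineSq x₁ e y ^ (-(b + 1)))) := by
          rw [h1]; ring
        _ ≤ _ := by linarith
  have hlim : Tendsto (fun R : ℝ => A * (distLineSq x₁ e x ^ (-b) - R ^ (-b))) atTop
      (𝓝 (A * (distLineSq x₁ e x ^ (-b) - 0))) :=
    (tendsto_const_nhds.sub (tendsto_rpow_neg_atTop hb)).const_mul _
  rw [sub_zero] at hlim
  exact le_of_tendsto hlim ((eventually_gt_atTop _).mono key)

theorem rpow_neg_le_of_le (hv : IsInvariantSupersol lam Lam p M e v) {x₁ : E} {a α r : ℝ}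
    (ha : 0 < a) (hr : 0 < r) (har : ∀ x, distLineSq x₁ e x = r → a ≤ v x) (hα : 0 < α)
    (hN : Lam + lam * (n - 2) ≤ 2 * Lam * (α + 1)) {x : E} (hx : r < distLineSq x₁ e x) :
    a * r ^ α * distLineSq x₁ e x ^ (-α) ≤ v x := by
  have hLam : 0 < Lam := hv.lam_pos.trans_le hv.lam_le
  have hq : 0 < distLineSq x₁ e x := hr.trans hx
  have hc : Continuous fun b : ℝ => a * r ^ b * distLineSq x₁ e x ^ (-b) :=
    (continuous_const.mul (Real.continuous_const_rpow hr.ne')).mul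
      ((Real.continuous_const_rpow hq.ne').comp continuous_neg)
  refine le_of_tendsto (hc.continuousAt.tendsto.mono_left nhdsWithin_le_nhds :
    Tendsto _ (𝓝[>] α) _) ?_
  filter_upwards [self_mem_nhdsWithin] with b hb
  have hb' : α < b := hb
  exact hv.rpow_neg_le ha hr har (hα.trans hb') (by nlinarith) hx

theorem rpow_neg_mul_log_le (hv : IsInvariantSupersol lam Lam p M e v) {x₁ : E} {α c r : ℝ}
    (hα : 0 < α) (hαp : α * p = α + 1) (hc : 0 < c) (hr : 0 < r)
    (hcr : ∀ x, r < distLineSq x₁ e x → c * distLineSq x₁ e x ^ (-α) ≤ v x)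
    (hN : Lam + lam * (n - 2) ≤ 2 * Lam * (α + 1)) (hn : 2 ≤ n) {x : E}
    (hx : r < distLineSq x₁ e x) :
    c ^ p / (8 * Lam * (2 * α + 1)) *
      (distLineSq x₁ e x ^ (-α) * Real.log (distLineSq x₁ e x / r)) ≤ v x := by
  have hLam : 0 < Lam := hv.lam_pos.trans_le hv.lam_le
  have hlam := hv.lam_pos
  set γ : ℝ := c ^ p / (8 * Lam * (2 * α + 1)) with hγ
  have hγ0 : 0 < γ := by positivity
  have hγc : γ * (4 * Lam * (2 * α + 1)) = c ^ p / 2 := by rw [hγ]; field_simp; norm_num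
  have hn' : (0 : ℝ) ≤ lam * (n - 2) := by
    have : (2 : ℝ) ≤ n := by exact_mod_cast hn
    exact mul_nonneg hlam.le (by linarith)
  have key : ∀ R, distLineSq x₁ e x < R →
      γ * (distLineSq x₁ e x ^ (-α) * Real.log (distLineSq x₁ e x / r) -
        R ^ (-α) * Real.log (R / r)) ≤ v x := by
    intro R hR
    have hrR : r < R := hx.trans hR
    have hR0 : 0 < R := hr.trans hrR
    have hlog : ∀ s, 0 < s → HasDerivAt (fun s => Real.log (s / r)) s⁻¹ s := by
      intro s hs
      have := ((hasDerivAt_id s).div_const r).log (div_pos hs hr).ne'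
      refine this.congr_deriv ?_
      simp only [id]
      field_simp
    have hprod : ∀ b s, 0 < s → HasDerivAt (fun s => s ^ (-b) * Real.log (s / r))
        (s ^ (-(b + 1)) - b * (s ^ (-(b + 1)) * Real.log (s / r))) s := by
      intro b s hs
      refine ((hasDerivAt_rpow_neg hs b).mul (hlog s hs)).congr_deriv ?_
      rw [← mul_rpow_neg_add_one hs b]
      field_simp
      ring
    refine hv.radial_le (x₁ := x₁)
      (H := fun s => γ * (s ^ (-α) * Real.log (s / r) - R ^ (-α) * Real.log (R / r)))
      (H' := fun s => γ * (s ^ (-(α + 1)) - α * (s ^ (-(α + 1)) * Real.log (s / r))))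
      (H'' := fun s => γ * (-(α + 1) * s ^ (-(α + 1 + 1)) - α * (s ^ (-(α + 1 + 1)) -
        (α + 1) * (s ^ (-(α + 1 + 1)) * Real.log (s / r))))) (r := r) (R := R)
      (δ := c ^ p / 2 * R ^ (-(α + 1)))
      (fun s hs => ?_) (fun s hs => ?_) (fun s hs => ?_) hr ?_ (by simp) (by positivity) ?_ x hx hR
    · exact contDiffAt_const.mul (((contDiffAt_id.rpow_const_of_ne hs.ne').mul
        ((contDiffAt_id.div_const r).log (div_pos hs hr).ne')).sub contDiffAt_const)
    · exact ((hprod α s hs).sub_const _).const_mul _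
    · exact ((hasDerivAt_rpow_neg hs (α + 1)).sub ((hprod (α + 1) s hs).const_mul _)).const_mul _
    · intro y _
      refine le_trans ?_ (hv.nonneg y)
      simp only [div_self hr.ne', Real.log_one, mul_zero, zero_sub]
      have : 0 < Real.log (R / r) := Real.log_pos ((one_lt_div hr).2 hrR)
      have : 0 < R ^ (-α) * Real.log (R / r) := by positivity
      nlinarith
    · intro y hy1 hy2
      set q := distLineSq x₁ e y with hq
      have hq0 : 0 < q := hr.trans hy1
      have h1 := mul_rpow_neg_add_one hq0 (α + 1)
      have h2 : R ^ (-(α + 1)) ≤ q ^ (-(α + 1)) :=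
        Real.rpow_le_rpow_of_nonpos hq0 hy2.le (by linarith)
      have h3 : c ^ p * q ^ (-(α + 1)) ≤ v y ^ p := by
        have := Real.rpow_le_rpow (by positivity) (hcr y hy1) (zero_lt_one.trans hv.one_lt).le
        rwa [Real.mul_rpow hc.le (by positivity), ← Real.rpow_mul hq0.le, neg_mul, hαp] at this
      have h4 : 0 ≤ Real.log (q / r) := (Real.log_pos ((one_lt_div hr).2 hy1)).le
      set S := q ^ (-(α + 1)) with hS
      have hS0 : 0 < S := by positivity
      have h5 : 0 ≤ γ * S * Real.log (q / r) * α *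
          (4 * Lam * (α + 1) - 2 * (Lam + lam * (n - 2))) :=
        mul_nonneg (by positivity) (by linarith)
      have h6 : 0 ≤ 2 * (Lam + lam * (n - 2)) * (γ * S) := by positivity
      calc c ^ p / 2 * R ^ (-(α + 1)) ≤ c ^ p / 2 * S := by gcongr
        _ = c ^ p * S - γ * (4 * Lam * (2 * α + 1)) * S := by rw [hγc]; ring
        _ ≤ v y ^ p - γ * (4 * Lam * (2 * α + 1)) * S + (γ * S * Real.log (q / r) * α *
          (4 * Lam * (α + 1) - 2 * (Lam + lam * (n - 2)))) +
          2 * (Lam + lam * (n - 2)) * (γ * S) := by linarith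
        _ = 4 * Lam * (γ * (-(α + 1) * (q * q ^ (-(α + 1 + 1))) -
              α * (q * q ^ (-(α + 1 + 1)) -
                (α + 1) * (q * q ^ (-(α + 1 + 1)) * Real.log (q / r))))) +
            2 * (Lam + lam * (n - 2)) * (γ * (S - α * (S * Real.log (q / r)))) + v y ^ p := by
          rw [h1]; ring
        _ = _ := by ring
  have hlim0 : Tendsto (fun R : ℝ => R ^ (-α) * Real.log (R / r)) atTop (𝓝 0) := by
    have h1 := (isLittleO_log_rpow_atTop hα).tendsto_div_nhds_zero
    have h2 := h1.sub ((tendsto_rpow_neg_atTop hα).mul_const (Real.log r))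
    rw [zero_mul, sub_zero] at h2
    refine h2.congr' ?_
    filter_upwards [eventually_gt_atTop 0] with R hR
    rw [Real.log_div hR.ne' hr.ne', Real.rpow_neg hR.le]
    field_simp
  have hlim := (hlim0.const_sub (distLineSq x₁ e x ^ (-α) *
    Real.log (distLineSq x₁ e x / r))).const_mul γ
  rw [sub_zero] at hlim
  exact le_of_tendsto hlim ((eventually_gt_atTop _).mono key)

/-- The infimum over a cylinder is attained on its lateral boundary. -/
theorem le_of_le_on_cylinder (hv : IsInvariantSupersol lam Lam p M e v) (hn : 2 ≤ n) {x₁ : E}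
    {b R : ℝ} (hb : ∀ x, distLineSq x₁ e x = R → b ≤ v x) {x : E} (hx : distLineSq x₁ e x ≤ R) :
    b ≤ v x := by
  rcases hx.eq_or_lt with hx | hx
  · exact hb x hx
  have hn' : (0 : ℝ) < n - 1 := by
    have : (2 : ℝ) ≤ n := by exact_mod_cast hn
    linarith
  have key : ∀ ε > 0, b + -ε * (R - distLineSq x₁ e x) ≤ v x := by
    intro ε hε
    have hlam := hv.lam_pos
    refine hv.paraboloid_le (δ := 2 * ε * lam * (n - 1)) hb (by positivity) (fun y _ => ?_) x hx
    have : 0 ≤ v y ^ p := Real.rpow_nonneg (hv.nonneg y) p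
    linarith
  have hc : Continuous fun ε : ℝ => b + -ε * (R - distLineSq x₁ e x) := by fun_prop
  have hlim := hc.tendsto 0
  rw [neg_zero, zero_mul, add_zero] at hlim
  refine le_of_tendsto (hlim.mono_left nhdsWithin_le_nhds : Tendsto _ (𝓝[>] (0 : ℝ)) _) ?_
  filter_upwards [self_mem_nhdsWithin] with ε hε using key ε hε

theorem improve (hv : IsInvariantSupersol lam Lam p M e v) (hn : 2 ≤ n) {x₁ : E}
    {b R : ℝ} (hb0 : 0 < b) (hR : 0 < R) (hb : ∀ x, distLineSq x₁ e x ≤ 4 * R → b ≤ v x) {x : E}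
    (hx : distLineSq x₁ e x ≤ R) : 3 / (4 * lam * (n - 1)) * b ^ p * R ≤ v x := by
  have hn' : (0 : ℝ) < n - 1 := by
    have : (2 : ℝ) ≤ n := by exact_mod_cast hn
    linarith
  have hlam := hv.lam_pos
  set κ : ℝ := b ^ p / (4 * lam * (n - 1)) with hκ
  have hκ0 : 0 < κ := by positivity
  have hκ1 : 2 * κ * lam * (n - 1) = b ^ p / 2 := by rw [hκ]; field_simp; norm_num
  have key := hv.paraboloid_le (x₁ := x₁) (κ := κ) (δ := b ^ p / 2) (fun y hy => hb y hy.le)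
    (by positivity) (fun y hy => ?_) x (by linarith)
  · have h1 : κ * (3 * R) ≤ κ * (4 * R - distLineSq x₁ e x) := by gcongr; linarith
    calc _ = κ * (3 * R) := by rw [hκ]; ring
      _ ≤ v x := by linarith
  · rw [hκ1]
    have := Real.rpow_le_rpow hb0.le (hb y hy.le) (zero_lt_one.trans hv.one_lt).le
    linarith

theorem eq_zero (hv : IsInvariantSupersol lam Lam p M e v) (hn : 2 ≤ n)
    (hN : lam * (n - 2) ≤ Lam + 2 * Lam / (p - 1)) (x₁ : E) : v x₁ = 0 := by
  by_contra hne
  obtain ⟨a, r, ha, hr, har⟩ := hv.exists_pos_le ((hv.nonneg x₁).lt_of_ne' hne)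
  have hlam := hv.lam_pos
  have hLam : 0 < Lam := hlam.trans_le hv.lam_le
  have hp : 0 < p - 1 := sub_pos.2 hv.one_lt
  have hn' : (0 : ℝ) < n - 1 := by
    have : (2 : ℝ) ≤ n := by exact_mod_cast hn
    linarith
  set α : ℝ := 1 / (p - 1) with hα
  have hα0 : 0 < α := by positivity
  have hαp : α * p = α + 1 := by rw [hα]; field_simp; ring
  have hN' : Lam + lam * (n - 2) ≤ 2 * Lam * (α + 1) := by
    have : 2 * Lam * α = 2 * Lam / (p - 1) := by rw [hα]; ring
    linarith
  have hlow : ∀ x, r < distLineSq x₁ e x → a * r ^ α * distLineSq x₁ e x ^ (-α) ≤ v x := fun x hx =>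
    hv.rpow_neg_le_of_le ha hr (fun y hy => har y hy.le) hα0 hN' hx
  set γ : ℝ := (a * r ^ α) ^ p / (8 * Lam * (2 * α + 1)) with hγ
  have hγ0 : 0 < γ := by positivity
  set c₀ : ℝ := 3 / (4 * lam * (n - 1)) with hc₀
  have hc₀0 : 0 < c₀ := by positivity
  set Γ : ℝ := (2 * 4 ^ (α + 1) / c₀) ^ α with hΓ
  have hΓ0 : 0 < Γ := by positivity
  have hΓp : Γ ^ (p - 1) = 2 * 4 ^ (α + 1) / c₀ := by
    rw [hΓ, ← Real.rpow_mul (by positivity), hα, one_div_mul_cancel hp.ne', Real.rpow_one]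
  obtain ⟨R₀, hR₀r, hR₀⟩ : ∃ R₀, r < R₀ ∧ ∀ R, R₀ ≤ R → Γ / γ ≤ Real.log (R / r) := by
    have h1 : Tendsto (fun R => Real.log (R / r)) atTop atTop :=
      Real.tendsto_log_atTop.comp (tendsto_id.atTop_div_const hr)
    obtain ⟨R₁, hR₁⟩ := eventually_atTop.1 (h1.eventually_ge_atTop (Γ / γ))
    exact ⟨max R₁ (r + 1), (lt_add_one r).trans_le (le_max_right _ _), fun R hR =>
      hR₁ R ((le_max_left _ _).trans hR)⟩
  have hR₀0 : 0 < R₀ := hr.trans hR₀r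
  have hbase : ∀ R, R₀ ≤ R → ∀ x, distLineSq x₁ e x ≤ R → Γ * R ^ (-α) ≤ v x := by
    intro R hR x hx
    have hR' : 0 < R := hR₀0.trans_le hR
    refine hv.le_of_le_on_cylinder hn (fun y hy => ?_) hx
    have h1 := hv.rpow_neg_mul_log_le hα0 hαp (by positivity) hr hlow hN' hn
      (x := y) (by rw [hy]; linarith)
    rw [hy, ← hγ] at h1
    have h2 : Γ ≤ γ * Real.log (R / r) := by
      have := (div_le_iff₀ hγ0).1 (hR₀ R hR)
      linarith
    calc Γ * R ^ (-α) ≤ γ * Real.log (R / r) * R ^ (-α) := by gcongr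
      _ = _ := by ring
      _ ≤ v y := h1
  have hstep : ∀ G, Γ ≤ G → (∀ R, R₀ ≤ R → ∀ x, distLineSq x₁ e x ≤ R → G * R ^ (-α) ≤ v x) →
      ∀ R, R₀ ≤ R → ∀ x, distLineSq x₁ e x ≤ R → 2 * G * R ^ (-α) ≤ v x := by
    intro G hG hP R hR x hx
    have hR' : 0 < R := hR₀0.trans_le hR
    have hG0 : 0 < G := hΓ0.trans_le hG
    refine le_trans ?_ (hv.improve hn (b := G * (4 * R) ^ (-α)) (by positivity) hR'
      (fun y hy => hP (4 * R) (by linarith) y hy) hx)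
    rw [← hc₀]
    have h1 : (G * (4 * R) ^ (-α)) ^ p * R = G * G ^ (p - 1) * 4 ^ (-(α + 1)) * R ^ (-α) := by
      rw [Real.mul_rpow hG0.le (by positivity), ← Real.rpow_mul (by positivity), neg_mul, hαp,
        Real.mul_rpow (by norm_num) hR'.le, ← mul_rpow_neg_add_one hR' α,
        show p = 1 + (p - 1) by ring, Real.rpow_add hG0, Real.rpow_one]
      ring_nf
    have h2 : 2 ≤ c₀ * G ^ (p - 1) * 4 ^ (-(α + 1)) := by
      have h3 : Γ ^ (p - 1) ≤ G ^ (p - 1) := Real.rpow_le_rpow hΓ0.le hG hp.le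
      calc (2 : ℝ) = c₀ * Γ ^ (p - 1) * 4 ^ (-(α + 1)) := by
            rw [hΓp, Real.rpow_neg (by norm_num)]
            field_simp
        _ ≤ _ := by gcongr
    calc 2 * G * R ^ (-α) ≤ c₀ * G ^ (p - 1) * 4 ^ (-(α + 1)) * G * R ^ (-α) := by gcongr
      _ = c₀ * ((G * (4 * R) ^ (-α)) ^ p * R) := by rw [h1]; ring
      _ = _ := by ring
  have hall : ∀ k : ℕ, ∀ R, R₀ ≤ R → ∀ x, distLineSq x₁ e x ≤ R →
      2 ^ k * Γ * R ^ (-α) ≤ v x := by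
    intro k
    induction k with
    | zero => simpa using hbase
    | succ k ih =>
      have h1 : Γ ≤ 2 ^ k * Γ := le_mul_of_one_le_left hΓ0.le (one_le_pow₀ one_le_two)
      have := hstep _ h1 ih
      rwa [show 2 * (2 ^ k * Γ) = 2 ^ (k + 1) * Γ by ring] at this
  have hpos : 0 < Γ * R₀ ^ (-α) := by positivity
  obtain ⟨k, hk⟩ := pow_unbounded_of_one_lt (M / (Γ * R₀ ^ (-α))) one_lt_two
  rw [div_lt_iff₀ hpos, ← mul_assoc] at hk
  have h1 := hall k R₀ le_rfl x₁ (by simp [distLineSq, hR₀0.le])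
  linarith [hv.le x₁]

end IsInvariantSupersol

end Liouville

section HalfSpace

variable {n : ℕ} {lam Lam p M : ℝ}

local notation "E" => EuclideanSpace ℝ (Fin n)

theorem PucciSupersol.congr {Ω : Set E} {u U g G : E → ℝ} (hu : PucciSupersol lam Lam Ω u g)
    (hΩ : IsOpen Ω) (h : EqOn U u Ω) (hg : EqOn G g Ω) : PucciSupersol lam Lam Ω U G := by
  intro x hx φ hφ hmin
  rw [hg hx]
  refine hu x hx φ hφ (hmin.congr ?_)
  filter_upwards [hΩ.mem_nhds hx] with y hy using by rw [h hy]

theorem PucciSubsol.congr {Ω : Set E} {u U g G : E → ℝ} (hu : PucciSubsol lam Lam Ω u g)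
    (hΩ : IsOpen Ω) (h : EqOn U u Ω) (hg : EqOn G g Ω) : PucciSubsol lam Lam Ω U G := by
  intro x hx φ hφ hmax
  rw [hg hx]
  refine hu x hx φ hφ (hmax.congr ?_)
  filter_upwards [hΩ.mem_nhds hx] with y hy using by rw [h hy]

theorem isHalfSpaceSol_indicator (i : Fin n) (hlam : 0 < lam) (hLam : lam ≤ Lam) (hp : 1 < p)
    (hM : 1 ≤ M) {u : E → ℝ} (hu : ContinuousOn u {x | 0 ≤ x i})
    (hle : ∀ x, 0 ≤ x i → u x ≤ M) (hnonneg : ∀ x, 0 < x i → 0 ≤ u x)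
    (hbdry : ∀ x, x i = 0 → u x = 0)
    (hsuper : PucciSupersol lam Lam {x | 0 < x i} u (fun x => u x ^ p))
    (hsub : PucciSubsol lam Lam {x | 0 < x i} u (fun x => u x ^ p)) :
    IsHalfSpaceSol lam Lam p M (EuclideanSpace.single i 1) ({x | 0 < x i}.indicator u) := by
  have hc : Continuous fun x : E => x i := by fun_prop
  have hin : ∀ x : E, ⟪x, EuclideanSpace.single i (1 : ℝ)⟫ = x i := fun x => by
    simp [EuclideanSpace.inner_single_right]
  have ho : IsOpen {x : E | 0 < x i} := isOpen_lt continuous_const hc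
  have heq : EqOn ({x : E | 0 < x i}.indicator u) u {x | 0 < x i} := fun x hx =>
    indicator_of_mem hx u
  have hset : {x : E | 0 < ⟪x, EuclideanSpace.single i (1 : ℝ)⟫} = {x | 0 < x i} := by
    simp only [hin]
  refine ⟨i.pos, hlam, hLam, hp, by simp, hM, ?_, fun x => ?_, fun x => ?_, fun x hx => ?_, ?_, ?_⟩
  · have hite : ({x : E | 0 < x i}.indicator u) = fun x => if 0 ≤ x i then u x else 0 := by
      funext x
      rcases lt_trichotomy (x i) 0 with h | h | h
      · simp [indicator, h.not_ge, h.not_gt]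
      · simp [indicator, h, hbdry x h]
      · simp [indicator, h, h.le]
    rw [hite]
    refine continuous_if_le continuous_const hc hu continuousOn_const fun x hx => hbdry x hx.symm
  · exact indicator_nonneg (fun x hx => hnonneg x hx) x
  · exact indicator_apply_le' (fun hx => hle x (le_of_lt hx)) fun _ => zero_le_one.trans hM
  · exact indicator_of_notMem (by simpa [hin] using hx) u
  · rw [hset]; exact hsuper.congr ho heq fun x hx => by simp only [heq hx]
  · rw [hset]; exact hsub.congr ho heq fun x hx => by simp only [heq hx]

end HalfSpace

theorem le_of_subcritical {t Lam p : ℝ} (hLam : 0 < Lam) (hp : 1 < p)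
    (h : (Lam < t ∧ p ≤ (t + Lam) / (t - Lam)) ∨ t ≤ Lam) : t ≤ Lam + 2 * Lam / (p - 1) := by
  have hp' : 0 < p - 1 := sub_pos.2 hp
  rcases h with ⟨h1, h2⟩ | h
  · rw [le_div_iff₀ (sub_pos.2 h1)] at h2
    rw [← sub_le_iff_le_add', le_div_iff₀ hp']
    linarith
  · have : 0 < 2 * Lam / (p - 1) := by positivity
    linarith

theorem stmt1 (n : ℕ) (hn : 3 ≤ n) (lam Lam : ℝ) (hlam : 0 < lam) (hLam : lam ≤ Lam)
    (p : ℝ) (hp : 1 < p)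
    (hcrit : (Lam < lam * ((n : ℝ) - 2) ∧
        p ≤ (lam * ((n : ℝ) - 2) + Lam) / (lam * ((n : ℝ) - 2) - Lam)) ∨
      lam * ((n : ℝ) - 2) ≤ Lam)
    (u : EuclideanSpace ℝ (Fin n) → ℝ)
    (hu : ContinuousOn u {x | 0 ≤ x ⟨n - 1, by omega⟩})
    (hbdd : ∃ C : ℝ, ∀ x : EuclideanSpace ℝ (Fin n), 0 ≤ x ⟨n - 1, by omega⟩ → |u x| ≤ C)
    (hnonneg : ∀ x : EuclideanSpace ℝ (Fin n), 0 < x ⟨n - 1, by omega⟩ → 0 ≤ u x)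
    (hbdry : ∀ x : EuclideanSpace ℝ (Fin n), x ⟨n - 1, by omega⟩ = 0 → u x = 0)
    (hsuper : PucciSupersol lam Lam {x | 0 < x ⟨n - 1, by omega⟩} u (fun x => u x ^ p))
    (hsub : PucciSubsol lam Lam {x | 0 < x ⟨n - 1, by omega⟩} u (fun x => u x ^ p)) :
    ∀ x : EuclideanSpace ℝ (Fin n), 0 ≤ x ⟨n - 1, by omega⟩ → u x = 0 := by
  obtain ⟨C, hC⟩ := hbdd
  have hU := isHalfSpaceSol_indicator (M := max 1 C) ⟨n - 1, by omega⟩ hlam hLam hp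
    (le_max_left _ _) hu
    (fun x hx => (le_abs_self _).trans ((hC x hx).trans (le_max_right _ _))) hnonneg hbdry
    hsuper hsub
  obtain ⟨v, hv, hle⟩ := hU.exists_invariantSupersol
  intro x hx
  rcases hx.eq_or_lt with hx | hx
  · exact hbdry x hx.symm
  · have h1 := hle x
    rw [hv.eq_zero (by omega) (le_of_subcritical (hlam.trans_le hLam) hp hcrit) x,
      indicator_of_mem (by exact hx)] at h1
    exact le_antisymm h1 (hnonneg x hx)
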